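/- arXiv:math/0003062 — 3 statements merged into one kernel-verified Lean document; each statement's English description precedes it below -/
import Mathlib

section
/- Let K be a number field and F a bihomogeneous form of bidegree (2,2) in the variables x₀, x₁, y₀, y₁ over K whose zero locus D ⊂ P¹ × P¹ is a smooth curve (over an algebraic closure there is no solution of F = 0 with (x₀,x₁) ≠ (0,0) and (y₀,y₁) ≠ (0,0) at which all four partial derivatives of F vanish). Then there exist a finite extension K' of K and a finite set S of maximal ideals of O_{K'} such that, with R = O_{K',S}, the set of points ((a : b),(e : f)) ∈ P¹(K') × P¹(K') admitting representatives a, b, e, f ∈ R with aR + bR = R, eR + fR = R and F(a,b,e,f) ∈ R^× is Zariski dense in P¹ × P¹, i.e., for every nonzero bihomogeneous polynomial G over K' there is such a point at which G ≠ 0. -/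
open MvPolynomial IsDedekindDomain NumberField

/-- The weights making a polynomial in the four variables `x₀, x₁, y₀, y₁` bihomogeneous:
`x₀, x₁` have weight `(1,0)` and `y₀, y₁` have weight `(0,1)`. -/
def biWeight : Fin 4 → ℕ × ℕ := ![(1, 0), (1, 0), (0, 1), (0, 1)]


theorem totComplex {K : Type} [Field K] [NumberField K] (i : K) (hi : i ^ 2 = -1) : IsTotallyComplex K := by
  constructor
  intro v
  rw [← InfinitePlace.not_isReal_iff_isComplex]
  intro hv
  rw [InfinitePlace.isReal_iff] at hv
  have h := congrArg (hv.embedding) hi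
  simp at h
  nlinarith [sq_nonneg (hv.embedding i)]

theorem unit_exists (K L : Type) [Field K] [NumberField K] [Field L] [NumberField L] [Algebra K L]
    [IsTotallyComplex K] (h2 : Module.finrank K L = 2) :
    ∃ ε : (𝓞 L)ˣ, Algebra.norm K ((ε : 𝓞 L) : L) = 1 ∧ ∀ k : ℕ, 0 < k → ε ^ k ≠ 1 := by
  have : IsTotallyComplex L := isTotallyComplex_of_algebra K L
  have hL := IsTotallyComplex.finrank L
  have hK := IsTotallyComplex.finrank K
  have hr : Units.rank K < Units.rank L := by
    have h1 := InfinitePlace.card_eq_nrRealPlaces_add_nrComplexPlaces K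
    have h3 := InfinitePlace.card_eq_nrRealPlaces_add_nrComplexPlaces L
    rw [IsTotallyComplex.nrRealPlaces_eq_zero] at h1 h3
    have := Module.finrank_mul_finrank ℚ K L
    rw [h2] at this
    have : 0 < Module.finrank ℚ K := Module.finrank_pos
    unfold Units.rank
    omega
  by_contra! hcon
  let f : Additive (𝓞 L)ˣ →ₗ[ℤ] Additive (𝓞 K)ˣ :=
    (MonoidHom.toAdditive (Units.map (RingOfIntegers.norm K (L := L)))).toIntLinearMap
  have hker : Module.finrank ℤ (LinearMap.ker f) = 0 := by
    apply Module.finrank_eq_zero_of_rank_eq_zero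
    rw [rank_eq_zero_iff]
    rintro ⟨x, hx⟩
    have hx' : Units.map (RingOfIntegers.norm K (L := L)) x.toMul = 1 := hx
    obtain ⟨k, hk, h⟩ := hcon x.toMul (by
      have := congrArg (fun u : (𝓞 K)ˣ => ((u : 𝓞 K) : K)) hx'
      simpa using this)
    refine ⟨k, by exact_mod_cast hk.ne', ?_⟩
    ext
    have : (k : ℤ) • x = 0 := by
      rw [natCast_zsmul]
      exact h
    simpa using congrArg (fun y => ((y.toMul : 𝓞 L) : L)) this
  have h5 := Submodule.finrank_quotient_add_finrank (LinearMap.ker f)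
  rw [f.quotKerEquivRange.finrank_eq] at h5
  have h6 := Submodule.finrank_le (LinearMap.range f)
  rw [Units.finrank_eq] at h5 h6
  omega

theorem exists_nat_mul_integral {K : Type} [Field K] [NumberField K] (x : K) :
    ∃ n : ℕ, n ≠ 0 ∧ IsIntegral ℤ ((n : K) * x) := by
  have hx : IsAlgebraic ℤ x := by
    have := Algebra.IsAlgebraic.isAlgebraic (R := ℚ) x
    exact (IsFractionRing.isAlgebraic_iff ℤ ℚ K).mpr this
  obtain ⟨y, hy, h⟩ := hx.exists_integral_multiple
  refine ⟨y.natAbs, by simpa using hy, ?_⟩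
  rcases Int.natAbs_eq y with h' | h'
  · rw [h'] at h
    simpa using h
  · rw [h'] at h
    simpa using h.neg

theorem mem_int_of_integral {K : Type} [Field K] [NumberField K]
    (R : Subalgebra (𝓞 K) K) {x : K} (hx : IsIntegral ℤ x) : x ∈ R :=
  R.algebraMap_mem (⟨x, hx⟩ : 𝓞 K)

/-- Pell, square case -/
theorem pell_square {K : Type} [Field K] [NumberField K] (R : Subalgebra (𝓞 K) K)
    (hR : (2 : K)⁻¹ ∈ R) (d : K) (hd : d ≠ 0) :
    Set.Infinite {p : K × K | p.1 ∈ R ∧ p.2 ∈ R ∧ p.1 ^ 2 - d ^ 2 * p.2 ^ 2 = 1} := by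
  obtain ⟨n, hn, h⟩ := exists_nat_mul_integral d⁻¹
  obtain ⟨j, m, hm, rfl⟩ := Nat.exists_eq_two_pow_mul_odd hn
  have h2 : (2 : K) ∈ R := by exact_mod_cast natCast_mem R 2
  have key : ∀ i : ℕ, ((2 : K) ^ (m.totient * i) - 1) * d⁻¹ ∈ R := by
    intro i
    have hd : (m : ℤ) ∣ 2 ^ (m.totient * i) - 1 := by
      have h1 : m ∣ 2 ^ (m.totient) - 1 :=
        (Nat.modEq_iff_dvd' Nat.one_le_two_pow).mp (Nat.ModEq.pow_totient (Nat.coprime_two_left.mpr hm)).symm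
      have h1' : (m : ℤ) ∣ 2 ^ (m.totient) - 1 := by
        have := Int.natCast_dvd_natCast.mpr h1
        push_cast [Nat.one_le_two_pow] at this
        exact this
      rw [pow_mul]
      exact h1'.trans (by simpa using sub_dvd_pow_sub_pow ((2:ℤ) ^ m.totient) 1 i)
    obtain ⟨w, hw⟩ := hd
    have hw' : (2 : K) ^ (m.totient * i) - 1 = m * w := by exact_mod_cast congrArg (Int.cast : ℤ → K) hw
    have : ((2 : K) ^ (m.totient * i) - 1) * d⁻¹ = (w : K) * (2⁻¹) ^ j * (((2 ^ j * m : ℕ) : K) * d⁻¹) := by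
      rw [hw', inv_pow]; push_cast; field_simp
    rw [this]
    exact mul_mem (mul_mem (intCast_mem R w) (pow_mem hR _)) (mem_int_of_integral R h)
  have hm0 : 0 < m.totient := Nat.totient_pos.mpr hm.pos
  refine Set.infinite_of_injective_forall_mem (f := fun i : ℕ =>
    (((2 : K) ^ (m.totient * i) + (2⁻¹) ^ (m.totient * i)) * 2⁻¹,
     ((2 : K) ^ (m.totient * i) - (2⁻¹) ^ (m.totient * i)) * 2⁻¹ * d⁻¹)) ?_ ?_
  · intro i i' hii
    simp only [Prod.mk.injEq] at hii
    obtain ⟨h1, h2⟩ := hii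
    have h3 : (2 : K) ^ (m.totient * i) = 2 ^ (m.totient * i') := by
      field_simp at h1 h2
      have e1 := h2
      have e2 := h1
      have := mul_right_cancel₀ (two_ne_zero' K) <| show (2 : K) ^ (m.totient * i) * 2 = 2 ^ (m.totient * i') * 2 by
        linear_combination e1 + e2
      exact this
    have h4 : 2 ^ (m.totient * i) = 2 ^ (m.totient * i') := by exact_mod_cast h3
    have := Nat.pow_right_injective le_rfl h4
    exact Nat.eq_of_mul_eq_mul_left hm0 this
  · intro i
    refine ⟨mul_mem (add_mem (pow_mem h2 _) (pow_mem hR _)) hR, ?_, ?_⟩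
    · have : ((2 : K) ^ (m.totient * i) - (2⁻¹) ^ (m.totient * i)) * 2⁻¹ * d⁻¹
        = ((2 : K) ^ (m.totient * i) - 1) * d⁻¹ * ((2 : K) ^ (m.totient * i) + 1) * (2⁻¹) ^ (m.totient * i) * 2⁻¹ := by
        simp only [inv_pow]
        field_simp
        ring
      simp only [this]
      exact mul_mem (mul_mem (mul_mem (key i) (add_mem (pow_mem h2 _) (one_mem _))) (pow_mem hR _)) hR
    · simp only [inv_pow]
      field_simp
      ring

/-- Pell, nonsquare integral case -/
theorem pell_nonsquare {K : Type} [Field K] [NumberField K] [IsTotallyComplex K] (R : Subalgebra (𝓞 K) K)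
    (hR : (2 : K)⁻¹ ∈ R) (D : K) (hD : IsIntegral ℤ D) (hns : ∀ d, d ^ 2 ≠ D) :
    Set.Infinite {p : K × K | p.1 ∈ R ∧ p.2 ∈ R ∧ p.1 ^ 2 - D * p.2 ^ 2 = 1} := by
  have : Fact (∀ r : K, r ^ 2 ≠ D + 0 * r) := ⟨fun r => by simpa using hns r⟩
  have hD0 : D ≠ 0 := fun h => hns 0 (by simp [h])
  let L := QuadraticAlgebra K D 0
  have : NumberField L := NumberField.of_module_finite K L
  obtain ⟨ε, hε, hinf⟩ := unit_exists K L (QuadraticAlgebra.finrank_eq_two D 0)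
  have hnorm : ∀ z : L, Algebra.norm K z = z.re ^ 2 - D * z.im ^ 2 := by
    intro z
    have h := QuadraticAlgebra.det_toLinearMap_eq_norm z
    rw [QuadraticAlgebra.norm_def] at h
    have h' : Algebra.norm K z = LinearMap.det (DistribSMul.toLinearMap K L z) := by
      rw [Algebra.norm_apply]
      congr 1
    rw [h']
    refine h.trans ?_
    ring
  obtain ⟨n, hn, hnD⟩ := exists_nat_mul_integral D⁻¹
  -- integrality of components
  have hcomp : ∀ z : 𝓞 L, 2 * (z : L).re ∈ R ∧ 2 * (z : L).im * D ∈ R := by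
    intro z
    have hz : IsIntegral ℤ (z : L) := z.2
    have hzs : IsIntegral ℤ (star (z : L)) := by
      have := hz.map (starRingEnd L).toIntAlgHom
      exact this
    have hω : IsIntegral ℤ (⟨0, 1⟩ : L) := by
      have h1 : IsIntegral ℤ ((⟨0, 1⟩ : L) ^ 2) := by
        have : (⟨0, 1⟩ : L) ^ 2 = algebraMap K L D := by
          ext <;> simp [sq, L]
        rw [this]
        exact hD.algebraMap
      exact IsIntegral.of_pow two_pos h1
    constructor
    · apply mem_int_of_integral
      rw [← isIntegral_algebraMap_iff (algebraMap K L).injective]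
      suffices e : algebraMap K L (2 * (z : L).re) = (z : L) + star (z : L) by
        rw [e]; exact hz.add hzs
      refine QuadraticAlgebra.ext ?_ ?_
      · show 2 * (z : L).re = (z : L).re + ((z : L).re + 0 * (z : L).im)
        ring
      · show 0 = (z : L).im + - (z : L).im
        ring
    · apply mem_int_of_integral
      rw [← isIntegral_algebraMap_iff (algebraMap K L).injective]
      suffices e : algebraMap K L (2 * (z : L).im * D) = ((z : L) - star (z : L)) * (⟨0, 1⟩ : L) by
        rw [e]; exact (hz.sub hzs).mul hω
      refine QuadraticAlgebra.ext ?_ ?_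
      · show 2 * (z : L).im * D = _
        rw [QuadraticAlgebra.re_mul, QuadraticAlgebra.re_sub, QuadraticAlgebra.im_sub, QuadraticAlgebra.re_star, QuadraticAlgebra.im_star]
        ring
      · show 0 = _
        rw [QuadraticAlgebra.im_mul, QuadraticAlgebra.re_sub, QuadraticAlgebra.im_sub, QuadraticAlgebra.re_star, QuadraticAlgebra.im_star]
        ring
  -- congruence
  obtain ⟨m, hm, hmod⟩ : ∃ m : ℕ, 0 < m ∧ ∀ j : ℕ, ∃ z : 𝓞 L, ((ε ^ (m * j) : (𝓞 L)ˣ) : 𝓞 L) = 1 + (n : 𝓞 L) * z := by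
    let I : Ideal (𝓞 L) := Ideal.span {(n : 𝓞 L)}
    have hI : I ≠ ⊥ := by
      simpa [I] using hn
    have : Finite (𝓞 L ⧸ I) := Ideal.finiteQuotientOfFreeOfNeBot I hI
    let g : (𝓞 L ⧸ I)ˣ := Units.map (Ideal.Quotient.mk I).toMonoidHom ε
    refine ⟨orderOf g, orderOf_pos g, fun j => ?_⟩
    have h1 : g ^ (orderOf g * j) = 1 := by rw [pow_mul, pow_orderOf_eq_one, one_pow]
    have h2 : Ideal.Quotient.mk I ((ε ^ (orderOf g * j) : (𝓞 L)ˣ) : 𝓞 L) = Ideal.Quotient.mk I 1 := by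
      have := congrArg (fun u : (𝓞 L ⧸ I)ˣ => (u : 𝓞 L ⧸ I)) h1
      simpa [g] using this
    rw [Ideal.Quotient.eq, Ideal.mem_span_singleton] at h2
    obtain ⟨z, hz⟩ := h2
    exact ⟨z, by rw [← hz]; ring⟩
  refine Set.infinite_of_injective_forall_mem (f := fun j : ℕ =>
    ((((ε ^ (m * j) : (𝓞 L)ˣ) : 𝓞 L) : L).re, (((ε ^ (m * j) : (𝓞 L)ˣ) : 𝓞 L) : L).im)) ?_ ?_
  · intro j j' hjj
    simp only [Prod.mk.injEq] at hjj
    have h1 : ε ^ (m * j) = ε ^ (m * j') := by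
      apply Units.ext
      apply RingOfIntegers.ext
      exact QuadraticAlgebra.ext hjj.1 hjj.2
    have h2 : ¬ IsOfFinOrder ε := by
      rw [isOfFinOrder_iff_pow_eq_one]
      rintro ⟨k, hk, h⟩
      exact hinf k hk h
    have := (injective_pow_iff_not_isOfFinOrder.mpr h2) h1
    exact Nat.eq_of_mul_eq_mul_left hm this
  · intro j
    obtain ⟨z, hz⟩ := hmod j
    obtain ⟨hz1, hz2⟩ := hcomp z
    have hz' : (((ε ^ (m * j) : (𝓞 L)ˣ) : 𝓞 L) : L) = 1 + (n : L) * (z : L) := by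
      rw [hz]; simp
    refine ⟨?_, ?_, ?_⟩
    · have : (((ε ^ (m * j) : (𝓞 L)ˣ) : 𝓞 L) : L).re = 1 + n * (2⁻¹ * (2 * (z : L).re)) := by
        rw [hz']; simp [L, QuadraticAlgebra.re_one]
      simp only [this]
      exact add_mem (one_mem _) (mul_mem (natCast_mem _ _) (mul_mem hR hz1))
    · have : (((ε ^ (m * j) : (𝓞 L)ˣ) : 𝓞 L) : L).im = (n * D⁻¹) * (2⁻¹ * (2 * (z : L).im * D)) := by
        rw [hz']; simp [L, QuadraticAlgebra.im_one]; field_simp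
      simp only [this]
      exact (mul_mem (mem_int_of_integral R hnD) (mul_mem hR hz2))
    · have := hnorm (((ε ^ (m * j) : (𝓞 L)ˣ) : 𝓞 L) : L)
      rw [← this]
      simp [hε]

theorem pell {K : Type} [Field K] [NumberField K] [IsTotallyComplex K] (R : Subalgebra (𝓞 K) K)
    (hR : (2 : K)⁻¹ ∈ R) (D : K) :
    Set.Infinite {p : K × K | p.1 ∈ R ∧ p.2 ∈ R ∧ p.1 ^ 2 - D * p.2 ^ 2 = 1} := by
  by_cases h0 : D = 0
  · subst h0
    refine Set.infinite_of_injective_forall_mem (f := fun j : ℕ => ((1 : K), (j : K))) ?_ ?_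
    · intro i j h
      simpa using h
    · intro j
      exact ⟨one_mem _, natCast_mem _ _, by simp⟩
  by_cases hs : ∃ d, d ^ 2 = D
  · obtain ⟨d, rfl⟩ := hs
    exact pell_square R hR d (by rintro rfl; simp at h0)
  push Not at hs
  obtain ⟨n, hn, hnD⟩ := exists_nat_mul_integral D
  have hnK : (n : K) ≠ 0 := by exact_mod_cast hn
  have hi : IsIntegral ℤ ((n : K) ^ 2 * D) := by
    have : (n : K) ^ 2 * D = ((n : ℤ) : K) * ((n : K) * D) := by push_cast; ring
    rw [this]
    exact (isIntegral_algebraMap (R := ℤ) (A := K) (x := (n : ℤ))).mul hnD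
  have := pell_nonsquare R hR _ hi (fun d hd => hs (d / n) (by rw [div_pow, hd]; field_simp))
  have h2 := this.image (f := fun p : K × K => (p.1, (n : K) * p.2)) (by
    rintro ⟨a, b⟩ _ ⟨a', b'⟩ _ h
    simpa [hnK] using h)
  refine h2.mono ?_
  rintro _ ⟨⟨a, b⟩, ⟨h1, h2, h3⟩, rfl⟩
  refine ⟨h1, mul_mem (natCast_mem _ _) h2, ?_⟩
  simp only at h3 ⊢
  linear_combination h3

/-- Infinitely many slopes of Pell solutions. -/
theorem pell_slopes {K : Type} [Field K] [NumberField K] [IsTotallyComplex K] (R : Subalgebra (𝓞 K) K)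
    (hR : (2 : K)⁻¹ ∈ R) (D : K) :
    Set.Infinite {r : K | ∃ t u : K, t ∈ R ∧ u ∈ R ∧ t ^ 2 - D * u ^ 2 = 1 ∧ t ≠ 0 ∧ r = u / t} := by
  intro hfin
  have hfib : ∀ t0 u0 : K, Set.Finite {p : K × K | (p.1 = t0 ∨ p.1 = -t0) ∧ (p.2 = u0 ∨ p.2 = - u0)} := by
    intro t0 u0
    refine Set.Finite.subset ((Set.toFinite {t0, -t0}).prod (Set.toFinite {u0, -u0})) ?_
    rintro ⟨a, b⟩ h
    simpa using h
  apply pell R hR D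
  set P := {p : K × K | p.1 ∈ R ∧ p.2 ∈ R ∧ p.1 ^ 2 - D * p.2 ^ 2 = 1} with hP
  have hsplit : P ⊆ {p | p ∈ P ∧ p.1 = 0} ∪ {p | p ∈ P ∧ p.1 ≠ 0} := by
    intro p hp
    by_cases h : p.1 = 0
    · exact Or.inl ⟨hp, h⟩
    · exact Or.inr ⟨hp, h⟩
  refine Set.Finite.subset (Set.Finite.union ?_ ?_) hsplit
  · rcases Set.eq_empty_or_nonempty {p | p ∈ P ∧ p.1 = 0} with he | ⟨⟨t0, u0⟩, ⟨h1, h2, h3⟩, h0⟩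
    · rw [he]; exact Set.finite_empty
    · refine (hfib t0 u0).subset ?_
      rintro ⟨t, u⟩ ⟨⟨k1, k2, k3⟩, k0⟩
      simp only at h0 k0 h3 k3
      subst h0 k0
      refine ⟨Or.inl rfl, sq_eq_sq_iff_eq_or_eq_neg.mp ?_⟩
      have hD : D ≠ 0 := by rintro rfl; simp at h3
      apply mul_left_cancel₀ hD
      linear_combination h3 - k3
  · refine Set.Finite.of_finite_fibers (fun p : K × K => p.2 / p.1) (hfin.subset ?_) ?_
    · rintro _ ⟨⟨t, u⟩, ⟨⟨k1, k2, k3⟩, k0⟩, rfl⟩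
      exact ⟨t, u, k1, k2, k3, k0, rfl⟩
    · rintro _ ⟨⟨t0, u0⟩, ⟨⟨h1, h2, h3⟩, h0⟩, rfl⟩
      refine (hfib t0 u0).subset ?_
      rintro ⟨t, u⟩ ⟨⟨⟨k1, k2, k3⟩, k0⟩, hr⟩
      simp only [Set.mem_preimage, Set.mem_singleton_iff] at hr h0 k0 h3 k3
      have hu : u = u0 / t0 * t := by rw [← hr]; field_simp
      have ht : t ^ 2 = t0 ^ 2 := by
        have e : t0 ^ 2 * (t ^ 2 - D * u ^ 2) = t ^ 2 * (t0 ^ 2 - D * u0 ^ 2) := by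
          rw [hu]; field_simp
        rw [h3, k3] at e
        linear_combination -e
      rcases sq_eq_sq_iff_eq_or_eq_neg.mp ht with h | h
      · exact ⟨Or.inl h, Or.inl (by rw [hu, h]; field_simp)⟩
      · exact ⟨Or.inr h, Or.inr (by rw [hu, h]; field_simp)⟩

/-- The value of a form of bidegree `(2,2)` with coefficients `c`. -/
def bqEval {K : Type} [CommRing K] (c : Fin 3 → Fin 3 → K) (x0 x1 y0 y1 : K) : K :=
  x0 ^ 2 * (c 0 0 * y0 ^ 2 + c 0 1 * y0 * y1 + c 0 2 * y1 ^ 2)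
  + x0 * x1 * (c 1 0 * y0 ^ 2 + c 1 1 * y0 * y1 + c 1 2 * y1 ^ 2)
  + x1 ^ 2 * (c 2 0 * y0 ^ 2 + c 2 1 * y0 * y1 + c 2 2 * y1 ^ 2)

theorem biWeight_weight (d : Fin 4 →₀ ℕ) :
    Finsupp.weight biWeight d = (d 0 + d 1, d 2 + d 3) := by
  rw [Finsupp.weight_apply, Finsupp.sum_fintype _ _ (by simp)]
  ext <;> simp [Fin.sum_univ_four, biWeight]

theorem exists_coeffs {K : Type} [Field K] (F : MvPolynomial (Fin 4) K)
    (hF : F.IsWeightedHomogeneous biWeight ((2 : ℕ), (2 : ℕ))) :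
    ∃ c : Fin 3 → Fin 3 → K, F = bqEval (fun i j => C (c i j)) (X 0) (X 1) (X 2) (X 3) := by
  have key : ∀ d : Fin 4 →₀ ℕ, d ∈ F.support → ∃ c : Fin 3 → Fin 3 → K,
      monomial d (F.coeff d) = bqEval (fun i j => C (c i j)) (X 0) (X 1) (X 2) (X 3) := by
    intro d hd
    have h := hF (mem_support_iff.mp hd)
    rw [biWeight_weight, Prod.mk.injEq] at h
    obtain ⟨h1, h2⟩ := h
    have hm : monomial d (F.coeff d) = C (F.coeff d) * (X 0 ^ d 0 * X 1 ^ d 1 * X 2 ^ d 2 * X 3 ^ d 3) := by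
      rw [monomial_eq, Finsupp.prod_fintype _ _ (by simp)]
      simp [Fin.prod_univ_four]
    have e1 : (d 0 = 2 ∧ d 1 = 0) ∨ (d 0 = 1 ∧ d 1 = 1) ∨ (d 0 = 0 ∧ d 1 = 2) := by omega
    have e2 : (d 2 = 2 ∧ d 3 = 0) ∨ (d 2 = 1 ∧ d 3 = 1) ∨ (d 2 = 0 ∧ d 3 = 2) := by omega
    have gen : ∀ i j : Fin 3, d 0 = 2 - (i : ℕ) → d 1 = i → d 2 = 2 - (j : ℕ) → d 3 = j →
        ∃ c : Fin 3 → Fin 3 → K,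
      monomial d (F.coeff d) = bqEval (fun i j => C (c i j)) (X 0) (X 1) (X 2) (X 3) := by
      intro i j a1 a2 a3 a4
      refine ⟨fun i' j' => if i' = i ∧ j' = j then F.coeff d else 0, ?_⟩
      rw [hm, a1, a2, a3, a4]
      fin_cases i <;> fin_cases j <;> simp [bqEval] <;> ring
    rcases e1 with ⟨a1, a2⟩ | ⟨a1, a2⟩ | ⟨a1, a2⟩ <;> rcases e2 with ⟨a3, a4⟩ | ⟨a3, a4⟩ | ⟨a3, a4⟩
    · exact gen 0 0 a1 a2 a3 a4
    · exact gen 0 1 a1 a2 a3 a4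
    · exact gen 0 2 a1 a2 a3 a4
    · exact gen 1 0 a1 a2 a3 a4
    · exact gen 1 1 a1 a2 a3 a4
    · exact gen 1 2 a1 a2 a3 a4
    · exact gen 2 0 a1 a2 a3 a4
    · exact gen 2 1 a1 a2 a3 a4
    · exact gen 2 2 a1 a2 a3 a4
  rw [F.as_sum]
  apply Finset.sum_induction _ (fun P => ∃ c : Fin 3 → Fin 3 → K,
      P = bqEval (fun i j => C (c i j)) (X 0) (X 1) (X 2) (X 3))
  · rintro _ _ ⟨c, rfl⟩ ⟨c', rfl⟩
    refine ⟨fun i j => c i j + c' i j, ?_⟩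
    simp only [bqEval, C_add]
    ring
  · exact ⟨fun _ _ => 0, by simp [bqEval]⟩
  · exact key

theorem eval_scale {K : Type} [Field K] (G : MvPolynomial (Fin 4) K) {pq : ℕ × ℕ}
    (hG : G.IsWeightedHomogeneous biWeight pq) (l m a b e f : K) :
    eval ![l * a, l * b, m * e, m * f] G = l ^ pq.1 * m ^ pq.2 * eval ![a, b, e, f] G := by
  rw [eval_eq', eval_eq', Finset.mul_sum]
  refine Finset.sum_congr rfl fun d hd => ?_
  have h := hG (mem_support_iff.mp hd)
  rw [biWeight_weight] at h
  rw [← h]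
  simp [Fin.prod_univ_four]
  ring

/-- If a polynomial in one parameter vanishes on an infinite set it vanishes everywhere. -/
theorem line_zero {K : Type} [Field K] (G : MvPolynomial (Fin 4) K) (v w : Fin 4 → K)
    (T : Set K) (hT : T.Infinite) (h : ∀ r ∈ T, eval (fun i => v i + r * w i) G = 0) (r : K) :
    eval (fun i => v i + r * w i) G = 0 := by
  let P : Polynomial K := aeval (fun i => Polynomial.C (v i) + Polynomial.X * Polynomial.C (w i)) G
  have hP : ∀ r, P.eval r = eval (fun i => v i + r * w i) G := by
    intro r
    have h1 : (Polynomial.evalRingHom r).comp (aeval (fun i => Polynomial.C (v i) + Polynomial.X * Polynomial.C (w i)) :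
        MvPolynomial (Fin 4) K →ₐ[K] Polynomial K).toRingHom = eval (fun i => v i + r * w i) := by
      apply MvPolynomial.ringHom_ext
      · intro x; simp
      · intro i; simp; exact mul_comm _ _
    exact congrArg (fun φ => φ G) h1
  have : P = 0 := by
    apply Polynomial.eq_zero_of_infinite_isRoot
    refine hT.mono fun r hr => ?_
    show P.eval r = 0
    rw [hP, h r hr]
  rw [← hP, this, Polynomial.eval_zero]

theorem exists_good_y {K : Type} [Field K] [CharZero K] (G : MvPolynomial (Fin 4) K) (hG0 : G ≠ 0) {pq : ℕ × ℕ}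
    (hG : G.IsWeightedHomogeneous biWeight pq) (l0 l1 p0 p1 : K) (hlp : l0 * p0 + l1 * p1 = 1) :
    ∃ n : ℕ, ∃ x0 x1 : K, eval ![x0, x1, p0 - n * l1, p1 + n * l0] G ≠ 0 := by
  by_contra! hcon
  have h1 : ∀ x0 x1 s : K, eval ![x0, x1, p0 - s * l1, p1 + s * l0] G = 0 := by
    intro x0 x1 s
    have h := line_zero G ![x0, x1, p0, p1] ![0, 0, -l1, l0] (Set.range (Nat.cast : ℕ → K))
      (Set.infinite_range_of_injective Nat.cast_injective) (by
        rintro _ ⟨n, rfl⟩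
        refine Eq.trans ?_ (hcon n x0 x1)
        congr 2
        ext i
        fin_cases i <;> simp <;> ring) s
    refine Eq.trans ?_ h
    congr 2
    ext i
    fin_cases i <;> simp <;> ring
  have h2 : G * (C l0 * X 2 + C l1 * X 3) = 0 := by
    apply MvPolynomial.funext
    intro x
    have hx : x = ![x 0, x 1, x 2, x 3] := by
      ext i; fin_cases i <;> rfl
    simp only [map_mul, map_add, eval_C, eval_X, map_zero, mul_eq_zero]
    by_cases hl : l0 * x 2 + l1 * x 3 = 0
    · exact Or.inr hl
    · left
      set m := l0 * x 2 + l1 * x 3 with hm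
      set s := (p0 * x 3 - p1 * x 2) / m with hs
      have := eval_scale G hG 1 m (x 0) (x 1) (p0 - s * l1) (p1 + s * l0)
      rw [h1, mul_zero] at this
      rw [← this]
      congr 2
      rw [hx]
      have hsm : m * s = p0 * x 3 - p1 * x 2 := by rw [hs]; field_simp
      have e2 : m * (p0 - s * l1) = x 2 := by
        linear_combination x 2 * hlp - l1 * hsm + p0 * hm
      have e3 : m * (p1 + s * l0) = x 3 := by
        linear_combination x 3 * hlp + l0 * hsm + p1 * hm
      rw [e2, e3]
      simp
  rcases mul_eq_zero.mp h2 with h | h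
  · exact hG0 h
  · have := congrArg (eval ![0, 0, p0, p1]) h
    simp [hlp] at this

theorem exists_good_slope {K : Type} [Field K] [CharZero K] (G : MvPolynomial (Fin 4) K) {pq : ℕ × ℕ}
    (hG : G.IsWeightedHomogeneous biWeight pq) (a b w0 w1 y0 y1 : K) (hdet : a * w1 - b * w0 ≠ 0)
    (hne : ∃ x0 x1 : K, eval ![x0, x1, y0, y1] G ≠ 0) (T : Set K) (hT : T.Infinite) :
    ∃ r ∈ T, eval ![a + r * w0, b + r * w1, y0, y1] G ≠ 0 := by
  by_contra! hcon
  have h1 : ∀ r : K, eval ![a + r * w0, b + r * w1, y0, y1] G = 0 := by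
    intro r
    have h := line_zero G ![a, b, y0, y1] ![w0, w1, 0, 0] T hT (by
        intro r hr
        refine Eq.trans ?_ (hcon r hr)
        congr 2
        ext i
        fin_cases i <;> simp) r
    refine Eq.trans ?_ h
    congr 2
    ext i
    fin_cases i <;> simp
  have h2 : ∀ t u : K, t ≠ 0 → eval ![t * a + u * w0, t * b + u * w1, y0, y1] G = 0 := by
    intro t u ht
    have := eval_scale G hG t 1 (a + u / t * w0) (b + u / t * w1) y0 y1
    rw [h1, mul_zero] at this
    rw [← this]
    congr 2
    ext i
    fin_cases i <;> simp <;> field_simp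
  have h3 : ∀ t u : K, eval ![t * a + u * w0, t * b + u * w1, y0, y1] G = 0 := by
    intro t u
    have h := line_zero G ![u * w0, u * w1, y0, y1] ![a, b, 0, 0] {0}ᶜ
      (Set.finite_singleton (0 : K)).infinite_compl (by
        intro r hr
        refine Eq.trans ?_ (h2 r u hr)
        congr 2
        ext i
        fin_cases i <;> simp <;> ring) t
    refine Eq.trans ?_ h
    congr 2
    ext i
    fin_cases i <;> simp <;> ring
  obtain ⟨x0, x1, hx⟩ := hne
  apply hx
  have h4 := h3 ((x0 * w1 - x1 * w0) / (a * w1 - b * w0)) ((a * x1 - b * x0) / (a * w1 - b * w0))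
  have e0 : (x0 * w1 - x1 * w0) / (a * w1 - b * w0) * a + (a * x1 - b * x0) / (a * w1 - b * w0) * w0 = x0 := by
    rw [div_mul_eq_mul_div, div_mul_eq_mul_div, ← add_div, div_eq_iff hdet]; ring
  have e1 : (x0 * w1 - x1 * w0) / (a * w1 - b * w0) * b + (a * x1 - b * x0) / (a * w1 - b * w0) * w1 = x1 := by
    rw [div_mul_eq_mul_div, div_mul_eq_mul_div, ← add_div, div_eq_iff hdet]; ring
  rwa [e0, e1] at h4

theorem span_pair_top {K : Type} [Field K] [NumberField K] (R : Subalgebra (𝓞 K) K) (a b : R)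
    (c m n : K) (hc : c ≠ 0) (hci : c⁻¹ ∈ R) (hm : m ∈ R) (hn : n ∈ R) (h : m * a + n * b = c) :
    Ideal.span {a, b} = ⊤ := by
  rw [Ideal.eq_top_iff_one, Ideal.mem_span_pair]
  refine ⟨⟨c⁻¹ * m, mul_mem hci hm⟩, ⟨c⁻¹ * n, mul_mem hci hn⟩, ?_⟩
  apply Subtype.ext
  simp only [OneMemClass.coe_one, Subalgebra.coe_add, Subalgebra.coe_mul]
  rw [mul_assoc, mul_assoc, ← mul_add, h]
  field_simp

theorem exists_S {K : Type} [Field K] [NumberField K] (T : Set K) (hT : T.Finite) :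
    ∃ S : Finset (HeightOneSpectrum (𝓞 K)), ∀ x ∈ T, x ∈ (S : Set (HeightOneSpectrum (𝓞 K))).integer K := by
  have hfin : (⋃ x ∈ T, HeightOneSpectrum.Support (𝓞 K) x).Finite :=
    hT.biUnion fun x _ => HeightOneSpectrum.Support.finite (𝓞 K) x
  refine ⟨hfin.toFinset, fun x hx v hv => ?_⟩
  by_contra hlt
  apply hv
  simp only [Set.Finite.coe_toFinset, Set.mem_iUnion]
  exact ⟨x, hx, not_le.mp hlt⟩

theorem core {K : Type} [Field K] [NumberField K] [IsTotallyComplex K] (c : Fin 3 → Fin 3 → K)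
    (a b k l0 l1 p0 p1 : K) (hk : k ≠ 0) (hlp : l0 * p0 + l1 * p1 = 1)
    (hA : c 0 0 * a ^ 2 + c 1 0 * a * b + c 2 0 * b ^ 2 = k * l0 ^ 2)
    (hB : c 0 1 * a ^ 2 + c 1 1 * a * b + c 2 1 * b ^ 2 = 2 * k * l0 * l1)
    (hC : c 0 2 * a ^ 2 + c 1 2 * a * b + c 2 2 * b ^ 2 = k * l1 ^ 2) :
    ∃ S : Finset (HeightOneSpectrum (𝓞 K)),
      ∀ G : MvPolynomial (Fin 4) K, G ≠ 0 →
        (∃ pq : ℕ × ℕ, G.IsWeightedHomogeneous biWeight pq) →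
        ∃ a b e f : ((S : Set (HeightOneSpectrum (𝓞 K))).integer K),
          Ideal.span {a, b} = ⊤ ∧ Ideal.span {e, f} = ⊤ ∧
          (∃ u : ((S : Set (HeightOneSpectrum (𝓞 K))).integer K)ˣ,
            ((u : ((S : Set (HeightOneSpectrum (𝓞 K))).integer K)) : K) =
              bqEval c a b e f) ∧
          eval ![(a : K), (b : K), (e : K), (f : K)] G ≠ 0 := by
  obtain ⟨S, hS⟩ := exists_S (K := K)
    (Set.range (fun ij : Fin 3 × Fin 3 => c ij.1 ij.2) ∪ {a, b, k, k⁻¹, l0, l1, p0, p1, 2⁻¹})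
    ((Set.finite_range _).union (Set.toFinite _))
  set R := (S : Set (HeightOneSpectrum (𝓞 K))).integer K with hR
  have hc : ∀ i j, c i j ∈ R := fun i j => hS _ (Or.inl ⟨(i, j), rfl⟩)
  have ha : a ∈ R := hS _ (Or.inr (by simp))
  have hb : b ∈ R := hS _ (Or.inr (by simp))
  have hkR : k ∈ R := hS _ (Or.inr (by simp))
  have hki : k⁻¹ ∈ R := hS _ (Or.inr (by simp))
  have hl0 : l0 ∈ R := hS _ (Or.inr (by simp))
  have hl1 : l1 ∈ R := hS _ (Or.inr (by simp))
  have hp0 : p0 ∈ R := hS _ (Or.inr (by simp))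
  have hp1 : p1 ∈ R := hS _ (Or.inr (by simp))
  have h2 : (2 : K)⁻¹ ∈ R := hS _ (Or.inr (by simp))
  have hquad : ∀ u v w x y : K, u ∈ R → v ∈ R → w ∈ R → x ∈ R → y ∈ R →
      u * x ^ 2 + v * x * y + w * y ^ 2 ∈ R := fun u v w x y hu hv hw hx hy =>
    add_mem (add_mem (mul_mem hu (pow_mem hx _)) (mul_mem (mul_mem hv hx) hy)) (mul_mem hw (pow_mem hy _))
  refine ⟨S, ?_⟩
  rintro G hG0 ⟨pq, hG⟩
  obtain ⟨n, hn⟩ := exists_good_y G hG0 hG l0 l1 p0 p1 hlp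
  set y0 := p0 - n * l1 with hy0
  set y1 := p1 + n * l0 with hy1
  have hy0R : y0 ∈ R := sub_mem hp0 (mul_mem (natCast_mem _ _) hl1)
  have hy1R : y1 ∈ R := add_mem hp1 (mul_mem (natCast_mem _ _) hl0)
  have hly : l0 * y0 + l1 * y1 = 1 := by rw [hy0, hy1]; linear_combination hlp
  set α := c 0 0 * y0 ^ 2 + c 0 1 * y0 * y1 + c 0 2 * y1 ^ 2 with hα
  set β := c 1 0 * y0 ^ 2 + c 1 1 * y0 * y1 + c 1 2 * y1 ^ 2 with hβ
  set γ := c 2 0 * y0 ^ 2 + c 2 1 * y0 * y1 + c 2 2 * y1 ^ 2 with hγ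
  have hαR : α ∈ R := hquad _ _ _ _ _ (hc _ _) (hc _ _) (hc _ _) hy0R hy1R
  have hβR : β ∈ R := hquad _ _ _ _ _ (hc _ _) (hc _ _) (hc _ _) hy0R hy1R
  have hγR : γ ∈ R := hquad _ _ _ _ _ (hc _ _) (hc _ _) (hc _ _) hy0R hy1R
  have hq : α * a ^ 2 + β * a * b + γ * b ^ 2 = k := by
    have : α * a ^ 2 + β * a * b + γ * b ^ 2 = k * (l0 * y0 + l1 * y1) ^ 2 := by
      rw [hα, hβ, hγ]
      linear_combination y0 ^ 2 * hA + y0 * y1 * hB + y1 ^ 2 * hC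
    rw [this, hly]; ring
  set w0 := - β * a - 2 * γ * b with hw0
  set w1 := 2 * α * a + β * b with hw1
  clear_value y0 y1
  have h2R : (2 : K) ∈ R := by exact_mod_cast natCast_mem R 2
  have hw0R : w0 ∈ R := sub_mem (mul_mem (neg_mem hβR) ha) (mul_mem (mul_mem h2R hγR) hb)
  have hw1R : w1 ∈ R := add_mem (mul_mem (mul_mem h2R hαR) ha) (mul_mem hβR hb)
  have hdet : a * w1 - b * w0 ≠ 0 := by
    have : a * w1 - b * w0 = 2 * k := by rw [hw0, hw1]; linear_combination 2 * hq
    rw [this]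
    exact mul_ne_zero two_ne_zero hk
  obtain ⟨_, ⟨t, u, ht, hu, hpell, ht0, rfl⟩, hr⟩ := exists_good_slope G hG a b w0 w1 y0 y1 hdet hn _
    (pell_slopes R h2 (β ^ 2 - 4 * α * γ))
  have hx0R : t * a + u * w0 ∈ R := add_mem (mul_mem ht ha) (mul_mem hu hw0R)
  have hx1R : t * b + u * w1 ∈ R := add_mem (mul_mem ht hb) (mul_mem hu hw1R)
  set x0 := t * a + u * w0 with hx0
  set x1 := t * b + u * w1 with hx1
  clear_value x0 x1
  have hF1 : α * x0 ^ 2 + β * x0 * x1 + γ * x1 ^ 2 = k := by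
    have : α * x0 ^ 2 + β * x0 * x1 + γ * x1 ^ 2 =
        (t ^ 2 - (β ^ 2 - 4 * α * γ) * u ^ 2) * (α * a ^ 2 + β * a * b + γ * b ^ 2) := by
      rw [hx0, hx1, hw0, hw1]; ring
    rw [this, hpell, hq, one_mul]
  have hF : bqEval c x0 x1 y0 y1 = k := by
    rw [← hF1, hα, hβ, hγ, bqEval]; ring
  refine ⟨⟨x0, hx0R⟩, ⟨x1, hx1R⟩, ⟨y0, hy0R⟩, ⟨y1, hy1R⟩, ?_, ?_, ?_, ?_⟩
  · refine span_pair_top R _ _ k (α * x0 + β * x1) (γ * x1) hk hki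
      (add_mem (mul_mem hαR hx0R) (mul_mem hβR hx1R)) (mul_mem hγR hx1R) ?_
    rw [← hF1]; ring
  · refine span_pair_top R _ _ k
      ((c 0 0 * x0 ^ 2 + c 1 0 * x0 * x1 + c 2 0 * x1 ^ 2) * y0 + (c 0 1 * x0 ^ 2 + c 1 1 * x0 * x1 + c 2 1 * x1 ^ 2) * y1)
      ((c 0 2 * x0 ^ 2 + c 1 2 * x0 * x1 + c 2 2 * x1 ^ 2) * y1) hk hki
      (add_mem (mul_mem (hquad _ _ _ _ _ (hc _ _) (hc _ _) (hc _ _) hx0R hx1R) hy0R)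
        (mul_mem (hquad _ _ _ _ _ (hc _ _) (hc _ _) (hc _ _) hx0R hx1R) hy1R))
      (mul_mem (hquad _ _ _ _ _ (hc _ _) (hc _ _) (hc _ _) hx0R hx1R) hy1R) ?_
    rw [← hF, bqEval]; ring
  · refine ⟨⟨⟨k, hkR⟩, ⟨k⁻¹, hki⟩, ?_, ?_⟩, ?_⟩
    · apply Subtype.ext
      simp [hk]
    · apply Subtype.ext
      simp [hk]
    · exact hF.symm
  · have hsc := eval_scale G hG t 1 (a + u / t * w0) (b + u / t * w1) y0 y1
    have e0 : t * (a + u / t * w0) = x0 := by rw [mul_add, ← mul_assoc, mul_div_cancel₀ _ ht0, hx0]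
    have e1 : t * (b + u / t * w1) = x1 := by rw [mul_add, ← mul_assoc, mul_div_cancel₀ _ ht0, hx1]
    rw [e0, e1, one_mul, one_mul] at hsc
    show eval ![x0, x1, y0, y1] G ≠ 0
    rw [hsc]
    exact mul_ne_zero (mul_ne_zero (pow_ne_zero _ ht0) (by simp)) hr

theorem quad_zero {k : Type} [Field k] [IsAlgClosed k] (u v w : k) :
    ∃ y0 y1 : k, ¬ (y0 = 0 ∧ y1 = 0) ∧ u * y0 ^ 2 + v * y0 * y1 + w * y1 ^ 2 = 0 := by
  by_cases hu : u = 0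
  · exact ⟨1, 0, by simp, by simp [hu]⟩
  · let P : Polynomial k := Polynomial.C u * Polynomial.X ^ 2 + Polynomial.C v * Polynomial.X + Polynomial.C w
    obtain ⟨r, hr⟩ := IsAlgClosed.exists_root P (by
      rw [Polynomial.degree_quadratic hu]; decide)
    refine ⟨r, 1, by simp, ?_⟩
    have : P.eval r = 0 := hr
    simp [P] at this
    linear_combination this

theorem quartic_zero {k : Type} [Field k] [IsAlgClosed k] (d0 d1 d2 d3 d4 : k) (h : d4 ≠ 0) :
    ∃ r : k, d4 * r ^ 4 + d3 * r ^ 3 + d2 * r ^ 2 + d1 * r + d0 = 0 := by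
  let P : Polynomial k := Polynomial.C d4 * Polynomial.X ^ 4 + Polynomial.C d3 * Polynomial.X ^ 3 +
    Polynomial.C d2 * Polynomial.X ^ 2 + Polynomial.C d1 * Polynomial.X + Polynomial.C d0
  have hdeg : P.degree = 4 := by
    simp only [P]
    compute_degree!
  obtain ⟨r, hr⟩ := IsAlgClosed.exists_root P (by rw [hdeg]; decide)
  refine ⟨r, ?_⟩
  have : P.eval r = 0 := hr
  simpa [P] using this

theorem exists_branch {k : Type} [Field k] [IsAlgClosed k] (c : Fin 3 → Fin 3 → k) :
    ∃ a b : k, (a = 1 ∨ (a = 0 ∧ b = 1)) ∧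
      (c 0 1 * a ^ 2 + c 1 1 * a * b + c 2 1 * b ^ 2) ^ 2 =
      4 * (c 0 0 * a ^ 2 + c 1 0 * a * b + c 2 0 * b ^ 2) * (c 0 2 * a ^ 2 + c 1 2 * a * b + c 2 2 * b ^ 2) := by
  by_cases h : c 2 1 ^ 2 - 4 * c 2 0 * c 2 2 = 0
  · refine ⟨0, 1, Or.inr ⟨rfl, rfl⟩, ?_⟩
    linear_combination h
  · obtain ⟨r, hr⟩ := quartic_zero (c 0 1 ^ 2 - 4 * c 0 0 * c 0 2)
      (2 * c 0 1 * c 1 1 - 4 * c 0 0 * c 1 2 - 4 * c 1 0 * c 0 2)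
      (c 1 1 ^ 2 + 2 * c 0 1 * c 2 1 - 4 * c 0 0 * c 2 2 - 4 * c 1 0 * c 1 2 - 4 * c 2 0 * c 0 2)
      (2 * c 1 1 * c 2 1 - 4 * c 1 0 * c 2 2 - 4 * c 2 0 * c 1 2)
      (c 2 1 ^ 2 - 4 * c 2 0 * c 2 2) h
    refine ⟨1, r, Or.inl rfl, ?_⟩
    linear_combination hr

theorem nonzero_of_smooth {K : Type} [Field K] (c : Fin 3 → Fin 3 → K) (F : MvPolynomial (Fin 4) K)
    (hFc : F = bqEval (fun i j => C (c i j)) (X 0) (X 1) (X 2) (X 3))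
    (hDsmooth : ∀ x : Fin 4 → AlgebraicClosure K,
      ¬ (x 0 = 0 ∧ x 1 = 0) → ¬ (x 2 = 0 ∧ x 3 = 0) →
      ¬ (aeval x F = 0 ∧ ∀ i : Fin 4, aeval x (pderiv i F) = 0))
    (d : Fin 3 → Fin 3 → AlgebraicClosure K) (hd : ∀ i j, d i j = algebraMap K _ (c i j))
    (a b : AlgebraicClosure K) (hab : a = 1 ∨ (a = 0 ∧ b = 1))
    (h : ∀ j, d 0 j * a ^ 2 + d 1 j * a * b + d 2 j * b ^ 2 = 0) : False := by
  have h0 := h 0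
  have h1 := h 1
  have h2 := h 2
  have e : ∀ x : Fin 4 → AlgebraicClosure K, aeval x F = bqEval d (x 0) (x 1) (x 2) (x 3) := by
    intro x
    simp [hFc, bqEval, hd]
  have e0 : ∀ x : Fin 4 → AlgebraicClosure K, aeval x (pderiv 0 F) =
      2 * x 0 * (d 0 0 * x 2 ^ 2 + d 0 1 * x 2 * x 3 + d 0 2 * x 3 ^ 2) +
      x 1 * (d 1 0 * x 2 ^ 2 + d 1 1 * x 2 * x 3 + d 1 2 * x 3 ^ 2) := by
    intro x
    simp [hFc, bqEval, hd, pderiv_X, Derivation.leibniz_pow]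
    ring
  have e1 : ∀ x : Fin 4 → AlgebraicClosure K, aeval x (pderiv 1 F) =
      x 0 * (d 1 0 * x 2 ^ 2 + d 1 1 * x 2 * x 3 + d 1 2 * x 3 ^ 2) +
      2 * x 1 * (d 2 0 * x 2 ^ 2 + d 2 1 * x 2 * x 3 + d 2 2 * x 3 ^ 2) := by
    intro x
    simp [hFc, bqEval, hd, pderiv_X, Derivation.leibniz_pow]
    ring
  have e2 : ∀ x : Fin 4 → AlgebraicClosure K, aeval x (pderiv 2 F) =
      2 * x 2 * (d 0 0 * x 0 ^ 2 + d 1 0 * x 0 * x 1 + d 2 0 * x 1 ^ 2) +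
      x 3 * (d 0 1 * x 0 ^ 2 + d 1 1 * x 0 * x 1 + d 2 1 * x 1 ^ 2) := by
    intro x
    simp [hFc, bqEval, hd, pderiv_X, Derivation.leibniz_pow]
    ring
  have e3 : ∀ x : Fin 4 → AlgebraicClosure K, aeval x (pderiv 3 F) =
      x 2 * (d 0 1 * x 0 ^ 2 + d 1 1 * x 0 * x 1 + d 2 1 * x 1 ^ 2) +
      2 * x 3 * (d 0 2 * x 0 ^ 2 + d 1 2 * x 0 * x 1 + d 2 2 * x 1 ^ 2) := by
    intro x
    simp [hFc, bqEval, hd, pderiv_X, Derivation.leibniz_pow]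
    ring
  obtain ⟨y0, y1, hy, k0, k1⟩ : ∃ y0 y1 : AlgebraicClosure K, ¬ (y0 = 0 ∧ y1 = 0) ∧
      2 * a * (d 0 0 * y0 ^ 2 + d 0 1 * y0 * y1 + d 0 2 * y1 ^ 2) +
      b * (d 1 0 * y0 ^ 2 + d 1 1 * y0 * y1 + d 1 2 * y1 ^ 2) = 0 ∧
      a * (d 1 0 * y0 ^ 2 + d 1 1 * y0 * y1 + d 1 2 * y1 ^ 2) +
      2 * b * (d 2 0 * y0 ^ 2 + d 2 1 * y0 * y1 + d 2 2 * y1 ^ 2) = 0 := by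
    rcases hab with rfl | ⟨rfl, rfl⟩
    · obtain ⟨y0, y1, hy, hz⟩ := quad_zero (d 1 0 + 2 * b * d 2 0) (d 1 1 + 2 * b * d 2 1) (d 1 2 + 2 * b * d 2 2)
      refine ⟨y0, y1, hy, ?_, ?_⟩
      · linear_combination 2 * y0 ^ 2 * h0 + 2 * y0 * y1 * h1 + 2 * y1 ^ 2 * h2 - b * hz
      · linear_combination hz
    · obtain ⟨y0, y1, hy, hz⟩ := quad_zero (d 1 0) (d 1 1) (d 1 2)
      refine ⟨y0, y1, hy, ?_, ?_⟩
      · linear_combination hz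
      · linear_combination 2 * y0 ^ 2 * h0 + 2 * y0 * y1 * h1 + 2 * y1 ^ 2 * h2
  refine hDsmooth ![a, b, y0, y1] ?_ hy ⟨?_, ?_⟩
  · rintro ⟨ha, hb⟩
    simp only [Matrix.cons_val_zero, Matrix.cons_val_one] at ha hb
    rcases hab with h | ⟨_, h⟩
    · rw [h] at ha; exact one_ne_zero ha
    · rw [h] at hb; exact one_ne_zero hb
  · rw [e]
    show bqEval d a b y0 y1 = 0
    rw [bqEval]
    linear_combination y0 ^ 2 * h0 + y0 * y1 * h1 + y1 ^ 2 * h2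
  · intro i
    fin_cases i
    · exact (e0 _).trans k0
    · exact (e1 _).trans k1
    · refine (e2 _).trans ?_
      show 2 * y0 * (d 0 0 * a ^ 2 + d 1 0 * a * b + d 2 0 * b ^ 2) +
        y1 * (d 0 1 * a ^ 2 + d 1 1 * a * b + d 2 1 * b ^ 2) = 0
      linear_combination (2 * y0) * h0 + y1 * h1
    · refine (e3 _).trans ?_
      show y0 * (d 0 1 * a ^ 2 + d 1 1 * a * b + d 2 1 * b ^ 2) +
        2 * y1 * (d 0 2 * a ^ 2 + d 1 2 * a * b + d 2 2 * b ^ 2) = 0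
      linear_combination y0 * h1 + (2 * y1) * h2

theorem factor_square {K : Type} [Field K] [CharZero K] (A B C : K) (h : B ^ 2 = 4 * A * C)
    (hn : ¬ (A = 0 ∧ B = 0 ∧ C = 0)) :
    ∃ k l0 l1 p0 p1 : K, k ≠ 0 ∧ l0 * p0 + l1 * p1 = 1 ∧ A = k * l0 ^ 2 ∧ B = 2 * k * l0 * l1 ∧ C = k * l1 ^ 2 := by
  by_cases hA : A = 0
  · have hB : B = 0 := by
      rw [hA] at h
      simpa using h
    have hC : C ≠ 0 := fun hC => hn ⟨hA, hB, hC⟩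
    exact ⟨C, 0, 1, 0, 1, hC, by simp, by simp [hA], by simp [hB], by simp⟩
  · refine ⟨A, 1, B / (2 * A), 1, 0, hA, by simp, by simp, ?_, ?_⟩
    · field_simp
    · field_simp
      linear_combination -h

/-- **Potential density of integral points on the complement of a smooth `(2,2)` curve in
`ℙ¹ × ℙ¹`** (the case `X = ℙ¹ × ℙ¹`, `D` of type `(2,2)`, of Section 7 of the paper;
it follows from Theorem 6.16).

Let `K` be a number field and `F` a bihomogeneous form of bidegree `(2,2)` in
`x₀, x₁, y₀, y₁` over `K` whose zero locus `D ⊂ ℙ¹ × ℙ¹` is a smooth curve.  Then there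
are a finite extension `K'` of `K` and a finite set `S` of maximal ideals of `𝓞 K'` such
that, with `R` the ring of `S`-integers of `K'`, the set of points
`((a : b), (e : f)) ∈ ℙ¹(K') × ℙ¹(K')` admitting representatives `a, b, e, f ∈ R` with
`aR + bR = R`, `eR + fR = R` and `F(a,b,e,f) ∈ Rˣ` is Zariski dense in `ℙ¹ × ℙ¹`:
for every nonzero bihomogeneous polynomial `G` over `K'` there is such a point at which
`G ≠ 0`. -/
theorem smooth_two_two_curve_complement_integral_points_potentially_dense
    (K : Type) [Field K] [NumberField K]
    (F : MvPolynomial (Fin 4) K)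
    (hF : F.IsWeightedHomogeneous biWeight ((2 : ℕ), (2 : ℕ)))
    -- `D` is a smooth curve: over an algebraic closure there is no zero of `F` with
    -- `(x₀, x₁) ≠ (0,0)` and `(y₀, y₁) ≠ (0,0)` at which all four partial derivatives
    -- of `F` vanish
    (hDsmooth : ∀ x : Fin 4 → AlgebraicClosure K,
      ¬ (x 0 = 0 ∧ x 1 = 0) → ¬ (x 2 = 0 ∧ x 3 = 0) →
      ¬ (aeval x F = 0 ∧ ∀ i : Fin 4, aeval x (pderiv i F) = 0)) :
    ∃ (K' : Type) (_ : Field K') (_ : NumberField K') (_ : Algebra K K')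
      (_ : FiniteDimensional K K')
      (S : Finset (HeightOneSpectrum (𝓞 K'))),
      ∀ G : MvPolynomial (Fin 4) K', G ≠ 0 →
        (∃ pq : ℕ × ℕ, G.IsWeightedHomogeneous biWeight pq) →
        ∃ a b e f : ((S : Set (HeightOneSpectrum (𝓞 K'))).integer K'),
          -- the coordinates of each factor generate the unit ideal of `R`
          Ideal.span {a, b} = ⊤ ∧ Ideal.span {e, f} = ⊤ ∧
          -- `F` takes a unit value in `R` at the point
          (∃ u : ((S : Set (HeightOneSpectrum (𝓞 K'))).integer K')ˣ,
            ((u : ((S : Set (HeightOneSpectrum (𝓞 K'))).integer K')) : K') =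
              eval ![(a : K'), (b : K'), (e : K'), (f : K')]
                (MvPolynomial.map (algebraMap K K') F)) ∧
          -- `G` does not vanish at the point
          eval ![(a : K'), (b : K'), (e : K'), (f : K')] G ≠ 0 := by
  obtain ⟨c, hFc⟩ := exists_coeffs F hF
  let d : Fin 3 → Fin 3 → AlgebraicClosure K := fun i j => algebraMap K _ (c i j)
  obtain ⟨a, b, hab, hdisc⟩ := exists_branch d
  have hnz := nonzero_of_smooth c F hFc hDsmooth d (fun _ _ => rfl) a b hab
  obtain ⟨I, hI⟩ := IsAlgClosed.exists_pow_nat_eq (-1 : AlgebraicClosure K) (n := 2) two_pos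
  let K' : IntermediateField K (AlgebraicClosure K) := IntermediateField.adjoin K {a, b, I}
  have hfin : FiniteDimensional K K' :=
    IntermediateField.finiteDimensional_adjoin fun x _ => Algebra.IsIntegral.isIntegral x
  have hNF : NumberField K' := NumberField.of_module_finite K K'
  have hsub : ∀ x ∈ ({a, b, I} : Set (AlgebraicClosure K)), x ∈ K' :=
    fun x hx => IntermediateField.subset_adjoin K _ hx
  let a' : K' := ⟨a, hsub a (by simp)⟩
  let b' : K' := ⟨b, hsub b (by simp)⟩
  let I' : K' := ⟨I, hsub I (by simp)⟩
  have : IsTotallyComplex K' := totComplex I' (Subtype.ext hI)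
  let c' : Fin 3 → Fin 3 → K' := fun i j => algebraMap K K' (c i j)
  have hcoe : ∀ j, ((c' 0 j * a' ^ 2 + c' 1 j * a' * b' + c' 2 j * b' ^ 2 : K') : AlgebraicClosure K) =
      d 0 j * a ^ 2 + d 1 j * a * b + d 2 j * b ^ 2 := fun j => rfl
  have hdisc' : (c' 0 1 * a' ^ 2 + c' 1 1 * a' * b' + c' 2 1 * b' ^ 2) ^ 2 =
      4 * (c' 0 0 * a' ^ 2 + c' 1 0 * a' * b' + c' 2 0 * b' ^ 2) *
        (c' 0 2 * a' ^ 2 + c' 1 2 * a' * b' + c' 2 2 * b' ^ 2) := Subtype.ext hdisc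
  have hnz' : ¬ ∀ j, c' 0 j * a' ^ 2 + c' 1 j * a' * b' + c' 2 j * b' ^ 2 = 0 := by
    intro h
    apply hnz
    intro j
    rw [← hcoe j, h j]
    rfl
  obtain ⟨k, l0, l1, p0, p1, hk, hlp, hA, hB, hC⟩ : ∃ k l0 l1 p0 p1 : K', k ≠ 0 ∧ l0 * p0 + l1 * p1 = 1 ∧
      c' 0 0 * a' ^ 2 + c' 1 0 * a' * b' + c' 2 0 * b' ^ 2 = k * l0 ^ 2 ∧
      c' 0 1 * a' ^ 2 + c' 1 1 * a' * b' + c' 2 1 * b' ^ 2 = 2 * k * l0 * l1 ∧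
      c' 0 2 * a' ^ 2 + c' 1 2 * a' * b' + c' 2 2 * b' ^ 2 = k * l1 ^ 2 :=
    factor_square _ _ _ hdisc' (by
      rintro ⟨h0, h1, h2⟩
      apply hnz'
      intro j
      fin_cases j
      · exact h0
      · exact h1
      · exact h2)
  obtain ⟨S, hS⟩ := core c' a' b' k l0 l1 p0 p1 hk hlp hA hB hC
  refine ⟨K', inferInstance, hNF, inferInstance, hfin, S, ?_⟩
  intro G hG0 hG
  obtain ⟨x0, x1, y0, y1, h1, h2, ⟨u, hu⟩, h4⟩ := hS G hG0 hG
  refine ⟨x0, x1, y0, y1, h1, h2, ⟨u, ?_⟩, h4⟩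
  rw [hu, hFc]
  simp [bqEval, c']
end

section
/- Let K be a number field, and let Q₁, Q₂ ∈ K[x₀,…,x₄] be quadratic forms whose common zero locus X ⊂ P⁴ is a smooth surface (a smooth complete intersection of dimension 2: at every common nonzero solution over an algebraic closure the 2×5 Jacobian matrix of (Q₁, Q₂) has rank 2). Let H be a nonzero linear form over K such that D = X ∩ {H = 0} is a smooth curve. Then there exist a finite extension K' of K and a finite set S of maximal ideals of O_{K'} such that, with R = O_{K',S}, the set of points (a₀ : ⋯ : a₄) ∈ P⁴(K') admitting representatives a₀,…,a₄ ∈ R with a₀R + ⋯ + a₄R = R, Q₁(a) = Q₂(a) = 0 and H(a) ∈ R^× is Zariski dense in X, i.e., for every homogeneous polynomial G over K' not vanishing identically on X there is such a point at which G ≠ 0. -/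
open MvPolynomial IsDedekindDomain NumberField


namespace DP4

/-- Parameters of the normal form of a quartic del Pezzo surface with a line and a hyperplane. -/
structure Prm (F : Type*) where
  c1 : F
  c2 : F
  a0 : F
  a1 : F
  a2 : F
  b0 : F
  b1 : F
  b2 : F
  h1 : F
  h2 : F
  h : F

/-- The quadric of rank four. -/
def qA {A : Type*} [CommRing A] (x : Fin 5 → A) : A := x 0 * x 1 - x 2 * x 3

namespace Prm

def map {A B : Type*} (f : A → B) (P : Prm A) : Prm B :=
  ⟨f P.c1, f P.c2, f P.a0, f P.a1, f P.a2, f P.b0, f P.b1, f P.b2, f P.h1, f P.h2, f P.h⟩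

variable {A : Type*} [CommRing A] (P : Prm A)

/-- The second quadric. -/
def qB (x : Fin 5 → A) : A :=
  x 4 ^ 2 + x 4 * (P.c1 * x 0 + P.c2 * x 2) + P.a0 * x 1 ^ 2 + P.a1 * x 1 * x 3 + P.a2 * x 3 ^ 2
    + P.b0 * x 1 * x 2 + P.b1 * x 1 * x 0 + P.b2 * x 3 * x 0

/-- The linear form. -/
def hh (x : Fin 5 → A) : A := x 2 + P.h1 * x 1 + P.h2 * x 3 + P.h * x 4

def l (t : A) : A := P.c1 * t + P.c2
def a (t : A) : A := P.a0 + P.a1 * t + P.a2 * t ^ 2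
def b (t : A) : A := P.b0 + P.b1 * t + P.b2 * t ^ 2
def e (t : A) : A := P.h1 + P.h2 * t
def al (t : A) : A := 1 - P.h * P.l t
def be (t : A) : A := -(P.l t * P.e t + P.b t * P.h)
def ga (t : A) : A := P.a t - P.b t * P.e t
def disc (t : A) : A := P.be t ^ 2 - 4 * P.al t * P.ga t
def disc2 (t : A) : A := P.b t ^ 2 + P.a t * P.l t ^ 2
def del : A := P.c1 * P.h2 - P.b2 * P.h

def sg (t x y : A) : A := y * (P.be t * P.l t - 2 * P.al t * P.b t) - x * P.l t
def ze (t x y : A) : A := y * (P.be t * P.b t - 2 * P.ga t * P.l t) + x * P.b t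

/-- The integral point attached to a solution of `x ^ 2 - disc t * y ^ 2 = 1`. -/
def pt (t x y : A) : Fin 5 → A :=
  ![t * (1 - P.e t * (2 * y * P.sg t x y) - P.h * (2 * y * P.ze t x y)),
    2 * y * P.sg t x y,
    1 - P.e t * (2 * y * P.sg t x y) - P.h * (2 * y * P.ze t x y),
    t * (2 * y * P.sg t x y),
    2 * y * P.ze t x y]

/-- Parametrisation of the conic. -/
def ph (t s z : A) : Fin 5 → A :=
  ![t * (-(z ^ 2 + P.a t * s ^ 2)), s * (P.l t * z + P.b t * s), -(z ^ 2 + P.a t * s ^ 2),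
    t * (s * (P.l t * z + P.b t * s)), z * (P.l t * z + P.b t * s)]

lemma qA_pt (t x y : A) : qA (P.pt t x y) = 0 := by
  simp [qA, pt]; ring

lemma hh_pt (t x y : A) : P.hh (P.pt t x y) = 1 := by
  simp [hh, pt, e]; ring

lemma qB_pt (t x y : A) (h : x ^ 2 - P.disc t * y ^ 2 = 1) : P.qB (P.pt t x y) = 0 := by
  have : P.qB (P.pt t x y) =
      4 * y ^ 2 * P.disc2 t * (x ^ 2 - P.disc t * y ^ 2 - 1) := by
    simp [qB, pt, sg, ze, disc, disc2, al, be, ga, e, a, b, l]; ring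
  rw [this, h]; ring

lemma pt_ph (t x y : A) (h : x ^ 2 - P.disc t * y ^ 2 = 1) (i : Fin 5) :
    P.ph t (P.sg t x y) (P.ze t x y) i = (-P.disc2 t) * P.pt t x y i := by
  have key : -(P.ze t x y ^ 2 + P.a t * P.sg t x y ^ 2) = (-P.disc2 t) *
      (1 - P.e t * (2 * y * P.sg t x y) - P.h * (2 * y * P.ze t x y)) := by
    have : -(P.ze t x y ^ 2 + P.a t * P.sg t x y ^ 2) - (-P.disc2 t) *
      (1 - P.e t * (2 * y * P.sg t x y) - P.h * (2 * y * P.ze t x y)) =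
      - P.disc2 t * (x ^ 2 - P.disc t * y ^ 2 - 1) := by
      simp [sg, ze, disc, disc2, al, be, ga]; ring
    rw [h] at this
    linear_combination this
  have k2 : P.l t * P.ze t x y + P.b t * P.sg t x y = -2 * y * P.disc2 t := by
    simp [sg, ze, disc2, al, be, ga]; ring
  fin_cases i
  · simp only [ph, pt]; simp; linear_combination t * key
  · simp only [ph, pt]; simp; rw [k2]; ring
  · simp only [ph, pt]; simp; linear_combination key
  · simp only [ph, pt]; simp; rw [k2]; ring
  · simp only [ph, pt]; simp; rw [k2]; ring

end Prm

end DP4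

namespace DP4

section maps
variable {A B : Type*} [CommRing A] [CommRing B] (f : A →+* B) (P : Prm A)

lemma map_qA (x : Fin 5 → A) : f (qA x) = qA (fun i => f (x i)) := by simp [qA]
lemma map_qB (x : Fin 5 → A) : f (P.qB x) = (P.map f).qB (fun i => f (x i)) := by
  simp [Prm.qB, Prm.map]
lemma map_hh (x : Fin 5 → A) : f (P.hh x) = (P.map f).hh (fun i => f (x i)) := by
  simp [Prm.hh, Prm.map]
lemma map_l (t : A) : f (P.l t) = (P.map f).l (f t) := by simp [Prm.l, Prm.map]
lemma map_a (t : A) : f (P.a t) = (P.map f).a (f t) := by simp [Prm.a, Prm.map]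
lemma map_b (t : A) : f (P.b t) = (P.map f).b (f t) := by simp [Prm.b, Prm.map]
lemma map_e (t : A) : f (P.e t) = (P.map f).e (f t) := by simp [Prm.e, Prm.map]
lemma map_al (t : A) : f (P.al t) = (P.map f).al (f t) := by
  simp [Prm.al, map_l]; simp [Prm.map]
lemma map_be (t : A) : f (P.be t) = (P.map f).be (f t) := by
  simp [Prm.be, map_l, map_e, map_b]; simp [Prm.map]
lemma map_ga (t : A) : f (P.ga t) = (P.map f).ga (f t) := by
  simp [Prm.ga, map_a, map_e, map_b]
lemma map_disc (t : A) : f (P.disc t) = (P.map f).disc (f t) := by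
  simp [Prm.disc, map_al, map_be, map_ga, map_ofNat]
lemma map_disc2 (t : A) : f (P.disc2 t) = (P.map f).disc2 (f t) := by
  simp [Prm.disc2, map_a, map_b, map_l]
lemma map_del : f P.del = (P.map f).del := by
  simp [Prm.del]; simp [Prm.map]
lemma map_sg (t x y : A) : f (P.sg t x y) = (P.map f).sg (f t) (f x) (f y) := by
  simp [Prm.sg, map_al, map_be, map_l, map_b, map_ofNat]
lemma map_ze (t x y : A) : f (P.ze t x y) = (P.map f).ze (f t) (f x) (f y) := by
  simp [Prm.ze, map_ga, map_be, map_l, map_b, map_ofNat]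
lemma map_ph (t s z : A) (i : Fin 5) : f (P.ph t s z i) = (P.map f).ph (f t) (f s) (f z) i := by
  fin_cases i <;> simp [Prm.ph, map_a, map_l, map_b]
lemma map_pt (t x y : A) (i : Fin 5) : f (P.pt t x y i) = (P.map f).pt (f t) (f x) (f y) i := by
  fin_cases i <;> simp [Prm.pt, map_e, map_sg, map_ze, map_ofNat] <;> simp [Prm.map]

end maps

lemma eval_scale {F : Type*} [Field F] {n : ℕ} {G : MvPolynomial (Fin 5) F}
    (hG : G.IsHomogeneous n) (c : F) (x : Fin 5 → F) :
    eval (fun i => c * x i) G = c ^ n * eval x G := by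
  rw [eval_eq, eval_eq, Finset.mul_sum]
  refine Finset.sum_congr rfl fun d hd => ?_
  have h1 := hG (mem_support_iff.mp hd)
  rw [Finsupp.weight_apply, Finsupp.sum_fintype _ _ (by simp)] at h1
  simp at h1
  simp_rw [mul_pow]
  rw [Finset.prod_mul_distrib, Finset.prod_pow_eq_pow_sum]
  have : ∑ i ∈ d.support, d i = n := by
    rw [← h1]; exact Finset.sum_subset (Finset.subset_univ _) (by simp)
  rw [this]; ring

lemma path_vanish {F : Type*} [Field F] (G : MvPolynomial (Fin 5) F)
    (v : Fin 5 → Polynomial F)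
    (hinf : {τ : F | eval (fun i => (v i).eval τ) G = 0}.Infinite) (τ : F) :
    eval (fun i => (v i).eval τ) G = 0 := by
  have key : ∀ τ : F, (aeval v G).eval τ = eval (fun i => (v i).eval τ) G := by
    intro τ
    have : (Polynomial.evalRingHom τ) (aeval v G) = _ := map_aeval v (Polynomial.evalRingHom τ) G
    simp only [Polynomial.coe_evalRingHom] at this
    rw [this]
    congr 1
    apply MvPolynomial.ringHom_ext <;> simp
  have h0 : aeval v G = 0 := by
    apply Polynomial.eq_zero_of_infinite_isRoot
    refine hinf.mono fun τ hτ => ?_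
    simpa [Polynomial.IsRoot, key] using hτ
  rw [← key, h0]; simp

lemma map_C_eval {F : Type*} [Field F] (P : Prm F) (τ : F) :
    (P.map Polynomial.C).map (Polynomial.evalRingHom τ) = P := by
  simp [Prm.map]

lemma conic_vanish {F : Type*} [Field F] [CharZero F] (P : Prm F) (t : F)
    (hd : P.disc2 t ≠ 0) {n : ℕ} (G : MvPolynomial (Fin 5) F) (hG : G.IsHomogeneous n)
    (xs ys : ℕ → F) (hpell : ∀ i, xs i ^ 2 - P.disc t * ys i ^ 2 = 1) (hy : ∀ i, ys i ≠ 0)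
    (hinj : Function.Injective fun i => xs i / ys i)
    (hv : ∀ i, eval (P.pt t (xs i) (ys i)) G = 0) (q r z : F)
    (hq : P.qB ![t * r, q, r, t * q, z] = 0) : eval ![t * r, q, r, t * q, z] G = 0 := by
  -- the function on the plane of pairs
  have hpath : ∀ (X Y : Polynomial F) (τ : F) (i : Fin 5),
      ((P.map Polynomial.C).ph (Polynomial.C t) ((P.map Polynomial.C).sg (Polynomial.C t) X Y)
        ((P.map Polynomial.C).ze (Polynomial.C t) X Y) i).eval τ =
      P.ph t (P.sg t (X.eval τ) (Y.eval τ)) (P.ze t (X.eval τ) (Y.eval τ)) i := by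
    intro X Y τ i
    have := map_ph (Polynomial.evalRingHom τ) (P.map Polynomial.C) (Polynomial.C t)
      ((P.map Polynomial.C).sg (Polynomial.C t) X Y) ((P.map Polynomial.C).ze (Polynomial.C t) X Y) i
    rw [map_sg, map_ze, map_C_eval] at this
    simpa using this
  have hscale : ∀ c x y : F, P.ph t (P.sg t (c * x) (c * y)) (P.ze t (c * x) (c * y)) =
      fun i => c ^ 2 * P.ph t (P.sg t x y) (P.ze t x y) i := by
    intro c x y
    funext i
    fin_cases i <;> simp [Prm.ph, Prm.sg, Prm.ze] <;> ring
  have h0 : ∀ c i, eval (P.ph t (P.sg t (c * xs i) (c * ys i)) (P.ze t (c * xs i) (c * ys i))) G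
      = 0 := by
    intro c i
    rw [hscale, eval_scale hG]
    have : P.ph t (P.sg t (xs i) (ys i)) (P.ze t (xs i) (ys i)) =
      fun j => (-P.disc2 t) * P.pt t (xs i) (ys i) j := by
      funext j; exact P.pt_ph _ _ _ (hpell i) j
    rw [this, eval_scale hG, hv]; simp
  have h1 : ∀ x y, y ≠ 0 → eval (P.ph t (P.sg t x y) (P.ze t x y)) G = 0 := by
    intro x y hy0
    have := path_vanish G (hinf := ?_) (τ := x) (v := fun i => (P.map Polynomial.C).ph (Polynomial.C t)
      ((P.map Polynomial.C).sg (Polynomial.C t) Polynomial.X (Polynomial.C y))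
        ((P.map Polynomial.C).ze (Polynomial.C t) Polynomial.X (Polynomial.C y)) i)
    · simp_rw [hpath] at this
      simpa using this
    · simp_rw [hpath]
      have hi2 : Function.Injective fun i => y * (xs i / ys i) := fun i j hij =>
        hinj (mul_left_cancel₀ hy0 hij)
      refine (Set.infinite_range_of_injective hi2).mono ?_
      rintro _ ⟨i, rfl⟩
      have := h0 (y / ys i) i
      have e1 : y / ys i * xs i = y * (xs i / ys i) := by ring
      have e2 : y / ys i * ys i = y := by field_simp [hy i]
      rw [e1, e2] at this
      simpa using this
  have h2 : ∀ x y, eval (P.ph t (P.sg t x y) (P.ze t x y)) G = 0 := by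
    intro x y
    by_cases hy0 : y = 0
    · subst hy0
      have := path_vanish G (hinf := ?_) (τ := 0) (v := fun i => (P.map Polynomial.C).ph (Polynomial.C t)
      ((P.map Polynomial.C).sg (Polynomial.C t) (Polynomial.C x) Polynomial.X)
        ((P.map Polynomial.C).ze (Polynomial.C t) (Polynomial.C x) Polynomial.X) i)
      · simp_rw [hpath] at this
        simpa using this
      · simp_rw [hpath]
        refine (Set.Finite.infinite_compl (Set.finite_singleton (0 : F))).mono ?_
        intro τ hτ
        simpa using h1 x τ hτ
    · exact h1 x y hy0
  have h3 : ∀ s w, eval (P.ph t s w) G = 0 := by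
    intro s w
    -- invert the Moebius transformation
    have := h2 ((-(P.be t * P.b t - 2 * P.ga t * P.l t) * s
        + (P.be t * P.l t - 2 * P.al t * P.b t) * w) / (-2 * P.disc2 t))
      (( P.b t * s + P.l t * w) / (-2 * P.disc2 t))
    have hne : (-2 * P.disc2 t) ≠ 0 := by simp [hd]
    have e0 : P.disc2 t = P.al t * P.b t ^ 2 - P.be t * P.b t * P.l t + P.ga t * P.l t ^ 2 := by
      simp [Prm.disc2, Prm.al, Prm.be, Prm.ga]; ring
    have e1 : P.sg t ((-(P.be t * P.b t - 2 * P.ga t * P.l t) * s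
        + (P.be t * P.l t - 2 * P.al t * P.b t) * w) / (-2 * P.disc2 t))
      (( P.b t * s + P.l t * w) / (-2 * P.disc2 t)) = s := by
      simp only [Prm.sg]; field_simp; rw [e0]; ring
    have e2 : P.ze t ((-(P.be t * P.b t - 2 * P.ga t * P.l t) * s
        + (P.be t * P.l t - 2 * P.al t * P.b t) * w) / (-2 * P.disc2 t))
      (( P.b t * s + P.l t * w) / (-2 * P.disc2 t)) = w := by
      simp only [Prm.ze]; field_simp; rw [e0]; ring
    rwa [e1, e2] at this
  have hN : z ^ 2 + P.a t * q ^ 2 + r * (P.l t * z + P.b t * q) = 0 := by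
    rw [← hq]; simp [Prm.qB, Prm.a, Prm.b, Prm.l]; ring
  by_cases hk : P.l t * z + P.b t * q = 0
  · have hN2 : z ^ 2 + P.a t * q ^ 2 = 0 := by rw [hk] at hN; simpa using hN
    have hq0 : q = 0 := by
      have : P.disc2 t * q ^ 2 = 0 := by
        simp only [Prm.disc2]
        linear_combination P.l t ^ 2 * hN2 + (P.b t * q - P.l t * z) * hk
      simpa [hd] using this
    have hz0 : z = 0 := by subst hq0; simpa using hN2
    subst hq0 hz0
    have := h3 (P.l t) (-P.b t)
    have e : (![t * r, 0, r, t * 0, 0] : Fin 5 → F) =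
        fun i => (-r / P.disc2 t) * P.ph t (P.l t) (-P.b t) i := by
      have e3 : (-r / P.disc2 t) * (-(P.b t ^ 2 + P.a t * P.l t ^ 2)) = r := by
        rw [← Prm.disc2]; field_simp
      funext i
      fin_cases i
      · simp [Prm.ph]; linear_combination -t * e3
      · simp [Prm.ph]; right; right; ring
      · simp [Prm.ph]; linear_combination - e3
      · simp [Prm.ph]; right; right; right; ring
      · simp [Prm.ph]; right; right; ring
    rw [e, eval_scale hG, this]; simp
  · have := h3 q z
    have e : P.ph t q z =
        fun i => (P.l t * z + P.b t * q) * (![t * r, q, r, t * q, z] : Fin 5 → F) i := by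
      funext i
      fin_cases i
      · simp [Prm.ph]; linear_combination -t * hN
      · simp [Prm.ph]; ring
      · simp [Prm.ph]; linear_combination - hN
      · simp [Prm.ph]; ring
      · simp [Prm.ph]; ring
    rw [e, eval_scale hG] at this
    exact (mul_eq_zero.mp this).resolve_left (pow_ne_zero _ hk)

end DP4

namespace DP4

lemma path2 {F : Type*} [Field F] [CharZero F] [IsAlgClosed F] (P : Prm F)
    (G : MvPolynomial (Fin 5) F) (x0 x1 x2 x3 : Polynomial F) (T : Set F) (hT : T.Infinite)
    (h : ∀ τ ∈ T, ∀ Z, P.qB ![x0.eval τ, x1.eval τ, x2.eval τ, x3.eval τ, Z] = 0 →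
      eval ![x0.eval τ, x1.eval τ, x2.eval τ, x3.eval τ, Z] G = 0) (τ Z : F)
    (hZ : P.qB ![x0.eval τ, x1.eval τ, x2.eval τ, x3.eval τ, Z] = 0) :
    eval ![x0.eval τ, x1.eval τ, x2.eval τ, x3.eval τ, Z] G = 0 := by
  classical
  set L : Polynomial F := Polynomial.C P.c1 * x0 + Polynomial.C P.c2 * x2 with hL
  set N : Polynomial F := Polynomial.C P.a0 * x1 ^ 2 + Polynomial.C P.a1 * x1 * x3
    + Polynomial.C P.a2 * x3 ^ 2 + Polynomial.C P.b0 * x1 * x2 + Polynomial.C P.b1 * x1 * x0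
    + Polynomial.C P.b2 * x3 * x0 with hN
  have hqB : ∀ τ Z, P.qB ![x0.eval τ, x1.eval τ, x2.eval τ, x3.eval τ, Z] =
      Z ^ 2 + L.eval τ * Z + N.eval τ := by
    intro τ Z; simp [Prm.qB, hL, hN]; ring
  set D : Polynomial (Polynomial F) :=
    Polynomial.X ^ 2 + (Polynomial.C L * Polynomial.X + Polynomial.C N) with hD
  have hdeg : (Polynomial.C L * Polynomial.X + Polynomial.C N).degree < 2 := 
    lt_of_le_of_lt (Polynomial.degree_linear_le) (by norm_num)
  have hDm : D.Monic := Polynomial.monic_X_pow_add hdeg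
  have hDd : D.degree = 2 := by
    rw [hD, Polynomial.degree_add_eq_left_of_degree_lt]
    · simp
    · simpa using hdeg
  set p : Polynomial (Polynomial F) :=
    aeval ![Polynomial.C x0, Polynomial.C x1, Polynomial.C x2, Polynomial.C x3, Polynomial.X] G
    with hp
  have hr : (p %ₘ D).natDegree ≤ 1 := by
    have := Polynomial.degree_modByMonic_lt p hDm
    rw [hDd] at this
    by_cases h0 : p %ₘ D = 0
    · simp [h0]
    · rw [Polynomial.degree_eq_natDegree h0] at this
      have : (p %ₘ D).natDegree < 2 := by exact_mod_cast this
      omega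
  obtain ⟨u, w, huw⟩ := Polynomial.exists_eq_X_add_C_of_natDegree_le_one hr
  have hdiv := Polynomial.modByMonic_add_div p D
  have hev : ∀ τ Z, P.qB ![x0.eval τ, x1.eval τ, x2.eval τ, x3.eval τ, Z] = 0 →
      eval ![x0.eval τ, x1.eval τ, x2.eval τ, x3.eval τ, Z] G = u.eval τ * Z + w.eval τ := by
    intro τ Z hZ
    set ψ : Polynomial (Polynomial F) →+* F :=
      (Polynomial.evalRingHom τ).comp (Polynomial.evalRingHom (Polynomial.C Z)) with hψ
    have e1 : ψ p = eval ![x0.eval τ, x1.eval τ, x2.eval τ, x3.eval τ, Z] G := by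
      rw [hp]
      have := map_aeval ![Polynomial.C x0, Polynomial.C x1, Polynomial.C x2, Polynomial.C x3,
        Polynomial.X] ψ G
      rw [this]
      congr 1
      apply MvPolynomial.ringHom_ext
      · intro r; simp [hψ, IsScalarTower.algebraMap_apply F (Polynomial F) (Polynomial (Polynomial F))]
      · intro i; fin_cases i <;> simp [hψ]
    have e2 : ψ D = 0 := by
      rw [hqB] at hZ
      simp [hψ, hD]; linear_combination hZ
    rw [← e1, ← hdiv, map_add, map_mul, e2, huw]
    simp [hψ]
  have hroots : ∀ τ ∈ T, (u ^ 2 * (L ^ 2 - 4 * N)).eval τ = 0 ∧ (2 * w - u * L).eval τ = 0 := by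
    intro τ hτ
    obtain ⟨d, hd⟩ := IsAlgClosed.exists_pow_nat_eq ((L.eval τ) ^ 2 - 4 * N.eval τ) (n := 2) (by norm_num)
    have r1 := h τ hτ ((-L.eval τ + d) / 2) (by rw [hqB]; field_simp; linear_combination hd)
    have r2 := h τ hτ ((-L.eval τ - d) / 2) (by rw [hqB]; field_simp; linear_combination hd)
    rw [hev τ _ (by rw [hqB]; field_simp; linear_combination hd)] at r1 r2
    have s1 : u.eval τ * d = 0 := by linear_combination r1 - r2
    constructor
    · have : (u.eval τ * d) ^ 2 = 0 := by rw [s1]; simp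
      rw [mul_pow, hd] at this
      simp only [Polynomial.eval_mul, Polynomial.eval_sub, Polynomial.eval_pow,
        Polynomial.eval_ofNat]
      exact this
    · simp
      linear_combination r1 + r2
  have hu : u ^ 2 * (L ^ 2 - 4 * N) = 0 :=
    Polynomial.eq_zero_of_infinite_isRoot _ (hT.mono fun τ hτ => (hroots τ hτ).1)
  have hw : 2 * w - u * L = 0 :=
    Polynomial.eq_zero_of_infinite_isRoot _ (hT.mono fun τ hτ => (hroots τ hτ).2)
  rw [hev τ Z hZ]
  rw [hqB] at hZ
  have hu' := congrArg (Polynomial.eval τ) hu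
  have hw' := congrArg (Polynomial.eval τ) hw
  simp only [Polynomial.eval_mul, Polynomial.eval_sub, Polynomial.eval_pow, Polynomial.eval_ofNat,
    Polynomial.eval_zero] at hu' hw'
  have : (u.eval τ * Z + w.eval τ) ^ 2 = 0 := by
    linear_combination (1/4) * hu' + (u.eval τ)^2 * hZ + (u.eval τ * Z + u.eval τ * L.eval τ / 4 + w.eval τ / 2) * hw'
  exact pow_eq_zero_iff (two_ne_zero) |>.mp this

lemma surf_vanish {F : Type*} [Field F] [CharZero F] [IsAlgClosed F] (P : Prm F)
    (G : MvPolynomial (Fin 5) F) (T : Set F) (hT : T.Infinite)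
    (h : ∀ t ∈ T, ∀ q r z, P.qB ![t * r, q, r, t * q, z] = 0 → eval ![t * r, q, r, t * q, z] G = 0)
    (y : Fin 5 → F) (hA : qA y = 0) (hB : P.qB y = 0) : eval y G = 0 := by
  have hy : y = ![y 0, y 1, y 2, y 3, y 4] := by funext i; fin_cases i <;> rfl
  have case1 : ∀ t, y 0 = t * y 2 → y 3 = t * y 1 → eval y G = 0 := by
    intro t h0 h3
    have := path2 P G (Polynomial.X * Polynomial.C (y 2)) (Polynomial.C (y 1))
      (Polynomial.C (y 2)) (Polynomial.X * Polynomial.C (y 1)) T hT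
      (by
        intro τ hτ Z hZ
        simp only [Polynomial.eval_mul, Polynomial.eval_X, Polynomial.eval_C] at hZ ⊢
        exact h τ hτ (y 1) (y 2) Z hZ) t (y 4)
    simp only [Polynomial.eval_mul, Polynomial.eval_X, Polynomial.eval_C, ← h0, ← h3, ← hy] at this
    exact this hB
  by_cases h2 : y 2 = 0
  · by_cases h1 : y 1 = 0
    · have := path2 P G (Polynomial.C (y 0)) (Polynomial.X * Polynomial.C (y 3))
        (Polynomial.X * Polynomial.C (y 0)) (Polynomial.C (y 3)) ((fun t => t⁻¹) '' (T \ {0})) 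
        ((hT.sdiff (Set.finite_singleton 0)).image (inv_injective.injOn))
        (by
          rintro _ ⟨t, ⟨ht, ht0⟩, rfl⟩ Z hZ
          have ht0 : t ≠ 0 := ht0
          have := h t ht (t⁻¹ * y 3) (t⁻¹ * y 0) Z
          rw [mul_inv_cancel_left₀ ht0, mul_inv_cancel_left₀ ht0] at this
          simp only [Polynomial.eval_mul, Polynomial.eval_X, Polynomial.eval_C] at hZ ⊢
          exact this hZ) 0 (y 4)
      have hy' : y = ![y 0, 0, 0, y 3, y 4] := by rw [hy, h1, h2]; simp
      simp only [Polynomial.eval_mul, Polynomial.eval_X, Polynomial.eval_C, zero_mul, ← hy'] at this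
      exact this hB
    · apply case1 (y 3 / y 1)
      · simp only [qA, h2] at hA
        simp [h1] at hA
        simp [hA, h2]
      · field_simp
  · apply case1 (y 0 / y 2)
    · field_simp
    · simp only [qA] at hA
      field_simp
      linear_combination -hA

end DP4

namespace DP4

lemma pell_seq {K' : Type*} [Field K'] (φ : K' →+* ℂ) (R : Subring K') (D x0 y0 : K')
    (hx0 : x0 ∈ R) (hy0 : y0 ∈ R) (h : x0 ^ 2 - D * y0 ^ 2 = 1) (hx : 1 < ‖φ x0‖) :
    ∃ xs ys : ℕ → K', (∀ i, xs i ∈ R) ∧ (∀ i, ys i ∈ R) ∧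
      (∀ i, xs i ^ 2 - D * ys i ^ 2 = 1) ∧ (∀ i, ys i ≠ 0) ∧
      Function.Injective fun i => xs i / ys i := by
  let f : ℕ → K' × K' := fun n => Nat.rec (x0, y0)
    (fun _ p => (2 * p.1 ^ 2 - 1, 2 * p.1 * p.2)) n
  have f0 : f 0 = (x0, y0) := rfl
  have fs : ∀ n, f (n + 1) = (2 * (f n).1 ^ 2 - 1, 2 * (f n).1 * (f n).2) := fun n => rfl
  have hmem : ∀ n, (f n).1 ∈ R ∧ (f n).2 ∈ R := by
    intro n
    have h2 : (2 : K') ∈ R := by exact_mod_cast natCast_mem R 2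
    induction n with
    | zero => exact ⟨hx0, hy0⟩
    | succ n ih =>
      rw [fs]
      exact ⟨R.sub_mem (R.mul_mem h2 (R.pow_mem ih.1 2)) R.one_mem,
        R.mul_mem (R.mul_mem h2 ih.1) ih.2⟩
  have hpell : ∀ n, (f n).1 ^ 2 - D * (f n).2 ^ 2 = 1 := by
    intro n
    induction n with
    | zero => exact h
    | succ n ih => rw [fs]; simp only; linear_combination (4 * (f n).1 ^ 2) * ih
  have hstep : ∀ n, 1 < ‖φ (f n).1‖ → ‖φ (f n).1‖ < ‖φ (f (n + 1)).1‖ := by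
    intro n hn
    rw [fs]; simp only [map_sub, map_mul, map_pow, map_one, map_ofNat]
    have := norm_sub_norm_le (2 * φ (f n).1 ^ 2) 1
    simp only [norm_mul, norm_pow, norm_one, Complex.norm_ofNat] at this
    nlinarith
  have hlt : ∀ n, 1 < ‖φ (f n).1‖ := by
    intro n
    induction n with
    | zero => exact hx
    | succ n ih => exact ih.trans (hstep n ih)
  have hmono : StrictMono fun n => ‖φ (f n).1‖ := strictMono_nat_of_lt_succ fun n => hstep n (hlt n)
  have hy : ∀ n, (f n).2 ≠ 0 := by
    intro n h0
    have h1 := hpell n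
    rw [h0] at h1
    have h2 : ‖φ (f n).1‖ ^ 2 = 1 := by
      rw [← norm_pow, ← map_pow]
      have : (f n).1 ^ 2 = 1 := by linear_combination h1
      rw [this]; simp
    nlinarith [hlt n]
  refine ⟨fun n => (f n).1, fun n => (f n).2, fun i => (hmem i).1, fun i => (hmem i).2, hpell, hy, ?_⟩
  intro i j hij
  simp only at hij
  rw [div_eq_div_iff (hy i) (hy j)] at hij
  have h1 := hpell i
  have h2 := hpell j
  have h3 : (f i).2 ^ 2 = (f j).2 ^ 2 := by
    linear_combination (-((f i).1 * (f j).2 + (f j).1 * (f i).2)) * hij + (f j).2 ^ 2 * h1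
      - (f i).2 ^ 2 * h2
  have h4 : (f i).1 ^ 2 = (f j).1 ^ 2 := by
    linear_combination h1 - h2 + D * h3
  apply hmono.injective
  have h5 : ‖φ (f i).1‖ ^ 2 = ‖φ (f j).1‖ ^ 2 := by
    rw [← norm_pow, ← map_pow, h4, map_pow, norm_pow]
  simp only
  exact (pow_left_inj₀ (norm_nonneg _) (norm_nonneg _) two_ne_zero).mp h5

lemma big (A B C : ℂ) (hA : A ≠ 0) :
    ∃ N0 : ℕ, ∀ N ≥ N0, 1 < ‖A * 2 ^ N + B + C / 2 ^ N‖ := by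
  obtain ⟨N0, h0⟩ := pow_unbounded_of_one_lt ((1 + ‖B‖ + ‖C‖) / ‖A‖) (one_lt_two (α := ℝ))
  refine ⟨N0, fun N hN => ?_⟩
  have hA' : 0 < ‖A‖ := norm_pos_iff.mpr hA
  rw [div_lt_iff₀ hA'] at h0
  have h1 : (2 : ℝ) ^ N0 ≤ 2 ^ N := pow_le_pow_right₀ (by norm_num) hN
  have h2 : ‖C / 2 ^ N‖ ≤ ‖C‖ := by
    rw [norm_div, norm_pow, Complex.norm_ofNat]
    exact div_le_self (norm_nonneg _) (one_le_pow₀ (by norm_num))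
  have h3 : ‖A * 2 ^ N‖ = 2 ^ N * ‖A‖ := by
    rw [norm_mul, norm_pow, Complex.norm_ofNat, mul_comm]
  have h4 : ‖A * 2 ^ N‖ ≤ ‖A * 2 ^ N + B + C / 2 ^ N‖ + ‖B‖ + ‖C / 2 ^ N‖ := by
    calc ‖A * 2 ^ N‖ = ‖(A * 2 ^ N + B + C / 2 ^ N) - B - C / 2 ^ N‖ := by ring_nf
      _ ≤ _ := (norm_sub_le _ _).trans (by gcongr; exact norm_sub_le _ _)
  nlinarith [mul_le_mul_of_nonneg_right h1 hA'.le]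

lemma exists_S (K' : Type*) [Field K'] [NumberField K'] (E : Set K') (hE : E.Finite) :
    ∃ S : Finset (HeightOneSpectrum (𝓞 K')),
      ∀ x ∈ E, x ∈ (S : Set (HeightOneSpectrum (𝓞 K'))).integer K' := by
  classical
  have hfin : (⋃ x ∈ E, HeightOneSpectrum.Support (𝓞 K') x).Finite :=
    hE.biUnion fun x _ => HeightOneSpectrum.Support.finite (𝓞 K') x
  refine ⟨hfin.toFinset, fun x hx v hv => ?_⟩
  by_contra hlt
  apply hv
  simp only [Set.Finite.coe_toFinset, Set.mem_iUnion]
  exact ⟨x, hx, not_le.mp hlt⟩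

lemma pt_mem {K' : Type*} [Field K'] (R : Subring K') (P : Prm K') (Q : Prm R)
    (hP : P = Q.map (R.subtype)) (t x y : K') (ht : t ∈ R) (hx : x ∈ R) (hy : y ∈ R) (i : Fin 5) :
    P.pt t x y i ∈ R := by
  have := map_pt R.subtype Q ⟨t, ht⟩ ⟨x, hx⟩ ⟨y, hy⟩ i
  rw [hP]
  simp only [Subring.coe_subtype] at this
  change (Q.map R.subtype).pt t x y i ∈ R
  erw [← this]
  exact Subtype.property _

end DP4

namespace DP4

theorem partC (K' : Type*) [Field K'] [NumberField K'] (k : Type*) [Field k] [CharZero k]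
    [IsAlgClosed k] [Algebra K' k] (q1 q2 hf : MvPolynomial (Fin 5) K')
    (M : Fin 5 → Fin 5 → K') (x1 y1 x2 y2 : K') (P : Prm K') (m0 m1 s0 s1 : K')
    (η : Fin 5 → K') (t0 : k)
    (h1 : ∀ v : Fin 5 → k, aeval (fun i => ∑ j, algebraMap K' k (M i j) * v j) q1 =
      algebraMap K' k x1 * qA v + algebraMap K' k y1 * (P.map (algebraMap K' k)).qB v)
    (h2 : ∀ v : Fin 5 → k, aeval (fun i => ∑ j, algebraMap K' k (M i j) * v j) q2 =
      algebraMap K' k x2 * qA v + algebraMap K' k y2 * (P.map (algebraMap K' k)).qB v)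
    (hh : ∀ v : Fin 5 → k, aeval (fun i => ∑ j, algebraMap K' k (M i j) * v j) hf =
      (P.map (algebraMap K' k)).hh v)
    (hM : ∀ y : Fin 5 → k, ∃ v : Fin 5 → k, y = fun i => ∑ j, algebraMap K' k (M i j) * v j)
    (hdet : x1 * y2 - x2 * y1 ≠ 0) (hs1 : s1 ≠ 0) (hdel : P.del ≠ 0)
    (hdisc : ∀ t : K', P.disc t = (P.del * t ^ 2 + m1 * t + m0) ^ 2 - (s1 * t + s0) ^ 2)
    (ht0 : (P.map (algebraMap K' k)).disc2 t0 ≠ 0)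
    (hη : ∀ v : Fin 5 → K', eval v hf = ∑ i, η i * v i) :
    ∃ S : Finset (HeightOneSpectrum (𝓞 K')),
      ∀ G : MvPolynomial (Fin 5) K', (∃ n : ℕ, G.IsHomogeneous n) →
        (∃ y : Fin 5 → AlgebraicClosure K', aeval y q1 = 0 ∧ aeval y q2 = 0 ∧ aeval y G ≠ 0) →
        ∃ a : Fin 5 → ((S : Set (HeightOneSpectrum (𝓞 K'))).integer K'),
          Ideal.span (Set.range a) = ⊤ ∧
          eval (fun i => (a i : K')) q1 = 0 ∧
          eval (fun i => (a i : K')) q2 = 0 ∧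
          (∃ u : ((S : Set (HeightOneSpectrum (𝓞 K'))).integer K')ˣ,
            ((u : ((S : Set (HeightOneSpectrum (𝓞 K'))).integer K')) : K') =
              eval (fun i => (a i : K')) hf) ∧
          eval (fun i => (a i : K')) G ≠ 0 := by
  classical
  set ι := algebraMap K' k with hι
  have hinj : Function.Injective ι := ι.injective
  obtain ⟨S, hS⟩ := exists_S K'
    (Set.range (fun p : Fin 5 × Fin 5 => M p.1 p.2) ∪ Set.range η ∪
      ({m0, m1, s0, s1, s1⁻¹, 2⁻¹, P.c1, P.c2, P.a0, P.a1, P.a2, P.b0, P.b1, P.b2, P.h1, P.h2, P.h}))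
    (((Set.finite_range _).union (Set.finite_range _)).union (Set.toFinite _))
  refine ⟨S, ?_⟩
  set R := ((S : Set (HeightOneSpectrum (𝓞 K'))).integer K') with hR
  have memM : ∀ i j, M i j ∈ R := fun i j => hS _ (Or.inl (Or.inl ⟨(i, j), rfl⟩))
  have memη : ∀ i, η i ∈ R := fun i => hS _ (Or.inl (Or.inr ⟨i, rfl⟩))
  have mem0 : ∀ x ∈ ({m0, m1, s0, s1, s1⁻¹, 2⁻¹, P.c1, P.c2, P.a0, P.a1, P.a2, P.b0, P.b1, P.b2,
    P.h1, P.h2, P.h} : Set K'), x ∈ R := fun x hx => hS _ (Or.inr hx)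
  let Q : Prm R.toSubring := ⟨⟨P.c1, mem0 _ (by simp)⟩, ⟨P.c2, mem0 _ (by simp)⟩,
    ⟨P.a0, mem0 _ (by simp)⟩, ⟨P.a1, mem0 _ (by simp)⟩, ⟨P.a2, mem0 _ (by simp)⟩,
    ⟨P.b0, mem0 _ (by simp)⟩, ⟨P.b1, mem0 _ (by simp)⟩, ⟨P.b2, mem0 _ (by simp)⟩,
    ⟨P.h1, mem0 _ (by simp)⟩, ⟨P.h2, mem0 _ (by simp)⟩, ⟨P.h, mem0 _ (by simp)⟩⟩
  have hQ : P = Q.map R.toSubring.subtype := rfl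
  have memm0 : m0 ∈ R := mem0 _ (by simp)
  have memm1 : m1 ∈ R := mem0 _ (by simp)
  have mems0 : s0 ∈ R := mem0 _ (by simp)
  have mems1 : s1 ∈ R := mem0 _ (by simp)
  have mems1i : s1⁻¹ ∈ R := mem0 _ (by simp)
  have mem2i : (2 : K')⁻¹ ∈ R := mem0 _ (by simp)
  have mem2 : (2 : K') ∈ R := by exact_mod_cast natCast_mem R 2
  have memdel : P.del ∈ R := by
    rw [Prm.del]
    exact R.sub_mem (R.mul_mem (mem0 _ (by simp)) (mem0 _ (by simp)))
      (R.mul_mem (mem0 _ (by simp)) (mem0 _ (by simp)))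
  rintro G ⟨n, hG⟩ ⟨y, hy1, hy2, hyG⟩
  by_contra hcon
  -- all integral points are zeros of G
  have hvan : ∀ t x y : K', t ∈ R → x ∈ R → y ∈ R → x ^ 2 - P.disc t * y ^ 2 = 1 →
      eval (fun i => ∑ j, M i j * P.pt t x y j) G = 0 := by
    intro t x y ht hx hy hp
    by_contra hne
    apply hcon
    have hmem : ∀ i, ∑ j, M i j * P.pt t x y j ∈ R := fun i =>
      R.sum_mem fun j _ => R.mul_mem (memM i j) (pt_mem R.toSubring P Q hQ t x y ht hx hy j)
    have tr : ∀ q : MvPolynomial (Fin 5) K', ι (eval (fun i => ∑ j, M i j * P.pt t x y j) q) =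
        aeval (fun i => ∑ j, ι (M i j) * ι (P.pt t x y j)) q := by
      intro q
      have : aeval (fun i => ∑ j, ι (M i j) * ι (P.pt t x y j)) q =
          aeval (fun i => ι (∑ j, M i j * P.pt t x y j)) q := by
        congr; ext i; simp
      rw [this]
      exact (aeval_algebraMap_apply k _ q).symm
    have hA0 : qA (fun i => ι (P.pt t x y i)) = 0 := by rw [← map_qA, P.qA_pt, map_zero]
    have hB0 : (P.map ι).qB (fun i => ι (P.pt t x y i)) = 0 := by
      rw [← map_qB, P.qB_pt _ _ _ hp, map_zero]
    have e1 : eval (fun i => ∑ j, M i j * P.pt t x y j) q1 = 0 := by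
      apply hinj; rw [tr, h1, hA0, hB0]; simp
    have e2 : eval (fun i => ∑ j, M i j * P.pt t x y j) q2 = 0 := by
      apply hinj; rw [tr, h2, hA0, hB0]; simp
    have e3 : eval (fun i => ∑ j, M i j * P.pt t x y j) hf = 1 := by
      apply hinj; rw [tr, hh, ← map_hh, P.hh_pt]
    refine ⟨fun i => ⟨_, hmem i⟩, ?_, e1, e2, ⟨1, ?_⟩, hne⟩
    · rw [Ideal.eq_top_iff_one]
      have : (1 : R) = ∑ i, (⟨η i, memη i⟩ : R) * ⟨_, hmem i⟩ := by
        apply Subtype.ext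
        rw [hη] at e3
        push_cast
        simpa using e3.symm
      rw [this]
      exact Ideal.sum_mem _ fun i _ => Ideal.mul_mem_left _ _ (Ideal.subset_span ⟨i, rfl⟩)
    · rw [e3]; simp
  -- the transformed polynomial over k
  set G' : MvPolynomial (Fin 5) k :=
    bind₁ (fun i => ∑ j, C (ι (M i j)) * X j) (MvPolynomial.map ι G) with hG'
  have hG'h : G'.IsHomogeneous n := by
    have := (hG.map ι).aeval (φ := MvPolynomial.map ι G) (fun i : Fin 5 => ∑ j, C (ι (M i j)) * X j)
      (n := 1) (fun i => IsHomogeneous.sum _ _ _ fun j _ => by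
        simpa using (isHomogeneous_C (Fin 5) (ι (M i j))).mul (isHomogeneous_X k j))
    simpa using this
  have hG'e : ∀ v, eval v G' = aeval (fun i => ∑ j, ι (M i j) * v j) G := by
    intro v
    rw [hG', ← MvPolynomial.coe_aeval_eq_eval]
    change aeval v (bind₁ _ _) = _
    rw [aeval_bind₁, aeval_map_algebraMap]
    simp
  obtain ⟨φ⟩ : Nonempty (K' →+* ℂ) := inferInstance
  obtain ⟨N0, hN0⟩ := big (φ (P.del / s1 ^ 2)) (φ (m1 / s1 - 2 * P.del * s0 / s1 ^ 2))
    (φ (P.del * s0 ^ 2 / s1 ^ 2 - m1 * s0 / s1 + m0)) (by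
      rw [Ne, map_eq_zero]; exact div_ne_zero hdel (pow_ne_zero 2 hs1))
  set τ : ℕ → K' := fun N => (2 ^ N - s0) / s1 with hτ
  have hτinj : Function.Injective τ := by
    intro i j hij
    simp only [hτ] at hij
    rw [div_left_inj' hs1, sub_left_inj] at hij
    have : (2 ^ i : ℕ) = 2 ^ j := by exact_mod_cast hij
    exact Nat.pow_right_injective le_rfl this
  have hconic : ∀ N ≥ N0, (P.map ι).disc2 (ι (τ N)) ≠ 0 → ∀ q r z,
      (P.map ι).qB ![ι (τ N) * r, q, r, ι (τ N) * q, z] = 0 →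
      eval ![ι (τ N) * r, q, r, ι (τ N) * q, z] G' = 0 := by
    intro N hN hd2
    have hu : (2 : K') ^ N ≠ 0 := pow_ne_zero _ two_ne_zero
    have memu : (2 : K') ^ N ∈ R := R.pow_mem mem2 N
    have memui : ((2 : K') ^ N)⁻¹ ∈ R := by rw [← inv_pow]; exact R.pow_mem mem2i N
    have memt : τ N ∈ R := by
      simp only [hτ, div_eq_mul_inv]
      exact R.mul_mem (R.sub_mem memu mems0) mems1i
    have hsu : s1 * τ N + s0 = 2 ^ N := by simp only [hτ]; field_simp; ring
    obtain ⟨xs, ys, hxs, hys, hp, hy0, hi⟩ := pell_seq φ R.toSubring (P.disc (τ N))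
      ((P.del * (τ N) ^ 2 + m1 * τ N + m0) * (2 ^ N)⁻¹) ((2 ^ N)⁻¹)
      (R.mul_mem (R.add_mem (R.add_mem (R.mul_mem memdel (R.pow_mem memt 2))
        (R.mul_mem memm1 memt)) memm0) memui) memui
      (by rw [hdisc, hsu]; field_simp; ring)
      (by
        have : (P.del * (τ N) ^ 2 + m1 * τ N + m0) * (2 ^ N)⁻¹ =
            P.del / s1 ^ 2 * 2 ^ N + (m1 / s1 - 2 * P.del * s0 / s1 ^ 2) +
            (P.del * s0 ^ 2 / s1 ^ 2 - m1 * s0 / s1 + m0) / 2 ^ N := by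
          simp only [hτ]; field_simp; ring
        rw [this]
        have := hN0 N hN
        simpa only [map_add, map_mul, map_div₀, map_pow, map_ofNat] using this)
    apply conic_vanish (P.map ι) (ι (τ N)) hd2 G' hG'h (fun i => ι (xs i)) (fun i => ι (ys i))
    · intro i; rw [← map_disc, ← map_pow, ← map_pow, ← map_mul, ← map_sub, hp, map_one]
    · intro i; rw [Ne, map_eq_zero]; exact hy0 i
    · intro i j hij
      apply hi
      apply hinj
      simpa only [map_div₀] using hij
    · intro i
      rw [hG'e]
      have := hvan (τ N) (xs i) (ys i) memt (hxs i) (hys i) (hp i)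
      have h := congrArg ι this
      rw [map_zero] at h
      rw [← h]
      have : (fun i_1 => ∑ j, ι (M i_1 j) * (P.map ι).pt (ι (τ N)) (ι (xs i)) (ι (ys i)) j) =
          fun i_1 => ι (∑ j, M i_1 j * P.pt (τ N) (xs i) (ys i) j) := by
        ext i1; simp only [map_sum, map_mul, map_pt]
      rw [this]
      exact aeval_algebraMap_apply k _ G
  have hT : {t : k | ∃ N ≥ N0, t = ι (τ N) ∧ (P.map ι).disc2 t ≠ 0}.Infinite := by
    set p : Polynomial k := ((P.map ι).map Polynomial.C).disc2 Polynomial.X with hp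
    have hpe : ∀ t, p.eval t = (P.map ι).disc2 t := by
      intro t
      have := map_disc2 (Polynomial.evalRingHom t) ((P.map ι).map Polynomial.C) Polynomial.X
      rw [map_C_eval] at this
      simpa using this
    have hp0 : p ≠ 0 := by
      intro h; apply ht0; rw [← hpe, h]; simp
    have hi : ((fun N => ι (τ N)) '' Set.Ici N0).Infinite :=
      (Set.Ici_infinite N0).image (hinj.comp hτinj).injOn
    refine (hi.sdiff (Polynomial.finite_setOfPred_isRoot hp0)).mono ?_
    rintro _ ⟨⟨N, hN, rfl⟩, hr⟩
    refine ⟨N, hN, rfl, ?_⟩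
    rw [← hpe]; exact hr
  have hall := surf_vanish (P.map ι) G' _ hT (by
    rintro _ ⟨N, hN, rfl, hd⟩ q r z hq
    exact hconic N hN hd q r z hq)
  let Λ : AlgebraicClosure K' →ₐ[K'] k := IsAlgClosed.lift
  obtain ⟨v, hv⟩ := hM (fun i => Λ (y i))
  have tr : ∀ q : MvPolynomial (Fin 5) K', Λ (aeval y q) =
      aeval (fun i => ∑ j, ι (M i j) * v j) q := by
    intro q
    rw [← hv]
    exact (comp_aeval_apply y Λ q)
  have f1 := h1 v
  have f2 := h2 v
  rw [← tr, hy1, map_zero] at f1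
  rw [← tr, hy2, map_zero] at f2
  have hdet' : ι x1 * ι y2 - ι x2 * ι y1 ≠ 0 := by
    rw [← map_mul, ← map_mul, ← map_sub, Ne, map_eq_zero]; exact hdet
  have hA0 : qA v = 0 := by
    apply (mul_eq_zero.mp (?_ : (ι x1 * ι y2 - ι x2 * ι y1) * qA v = 0)).resolve_left hdet'
    linear_combination (-ι y2) * f1 + ι y1 * f2
  have hB0 : (P.map ι).qB v = 0 := by
    apply (mul_eq_zero.mp (?_ : (ι x1 * ι y2 - ι x2 * ι y1) * (P.map ι).qB v = 0)).resolve_left hdet'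
    linear_combination (ι x2) * f1 - ι x1 * f2
  have := hall v hA0 hB0
  rw [hG'e, ← tr, map_eq_zero] at this
  exact hyG this

end DP4

namespace DP4

/-- Polarisation of `qA`. -/
def dA {A : Type*} [CommRing A] (x w : Fin 5 → A) : A :=
  x 0 * w 1 + x 1 * w 0 - x 2 * w 3 - x 3 * w 2

/-- Polarisation of `qB`. -/
def Prm.dB {A : Type*} [CommRing A] (P : Prm A) (x w : Fin 5 → A) : A :=
  2 * x 4 * w 4 + x 4 * (P.c1 * w 0 + P.c2 * w 2) + w 4 * (P.c1 * x 0 + P.c2 * x 2)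
    + 2 * P.a0 * x 1 * w 1 + P.a1 * (x 1 * w 3 + w 1 * x 3) + 2 * P.a2 * x 3 * w 3
    + P.b0 * (x 1 * w 2 + w 1 * x 2) + P.b1 * (x 1 * w 0 + w 1 * x 0)
    + P.b2 * (x 3 * w 0 + w 3 * x 0)

/-- Smoothness of the surface in coordinates. -/
def Prm.SX {k : Type*} [Field k] (P : Prm k) : Prop :=
  ∀ x : Fin 5 → k, x ≠ 0 → qA x = 0 → P.qB x = 0 → ∀ l m : k,
    (∀ w, l * dA x w + m * P.dB x w = 0) → m = 0

/-- Smoothness of the curve in coordinates. -/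
def Prm.SD {k : Type*} [Field k] (P : Prm k) : Prop :=
  ∀ x : Fin 5 → k, x ≠ 0 → qA x = 0 → P.qB x = 0 → P.hh x = 0 → ∀ l m n : k,
    (∀ w, l * dA x w + m * P.dB x w + n * P.hh w = 0) → m = 0

section coords
variable {k : Type*} [Field k] [CharZero k] (P : Prm k)

lemma dB_conic {A : Type*} [CommRing A] (P : Prm A) (t q r z : A) (w : Fin 5 → A) :
    P.dB ![t * r, q, r, t * q, z] w =
      (w 0 - t * w 2) * (P.c1 * z + P.b1 * q + P.b2 * t * q)
      + (w 3 - t * w 1) * (P.a1 * q + 2 * P.a2 * t * q + P.b2 * t * r)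
      + w 1 * (2 * P.a t * q + P.b t * r) + w 2 * (P.l t * z + P.b t * q)
      + w 4 * (2 * z + P.l t * r) := by
  simp [Prm.dB, Prm.a, Prm.b, Prm.l]; ring

lemma dA_conic {A : Type*} [CommRing A] (t q r z : A) (w : Fin 5 → A) :
    dA ![t * r, q, r, t * q, z] w = q * (w 0 - t * w 2) - r * (w 3 - t * w 1) := by
  simp [dA]; ring

lemma qB_conic {A : Type*} [CommRing A] (P : Prm A) (t q r z : A) :
    P.qB ![t * r, q, r, t * q, z] = z ^ 2 + P.l t * z * r + P.a t * q ^ 2 + P.b t * q * r := by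
  simp [Prm.qB, Prm.a, Prm.b, Prm.l]; ring

lemma del_ne (hX : P.SX) (τ : Fin 5 → k) (h1 : τ 1 = 0) (h2 : P.c1 * τ 4 + P.b2 * τ 3 = 0)
    (h3 : P.hh τ = 0) (h4 : qA τ ≠ 0) : P.del ≠ 0 := by
  intro hd
  simp only [Prm.del] at hd
  simp only [Prm.hh, h1] at h3
  simp only [qA, h1] at h4
  have h23 : τ 2 * τ 3 ≠ 0 := by intro h; apply h4; linear_combination -h
  have hc : P.c1 = 0 := by
    have : P.c1 * τ 2 = 0 := by linear_combination P.c1 * h3 - τ 3 * hd - P.h * h2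
    exact (mul_eq_zero.mp this).resolve_right (left_ne_zero_of_mul h23)
  have hb : P.b2 = 0 := by
    rw [hc] at h2
    have : P.b2 * τ 3 = 0 := by linear_combination h2
    exact (mul_eq_zero.mp this).resolve_right (right_ne_zero_of_mul h23)
  have := hX ![1, 0, 0, 0, 0] (by intro h; simpa using congrFun h 0) (by simp [qA])
    (by simp [Prm.qB]) (-P.b1) 1 (by
      intro w; simp [dA, Prm.dB, hc, hb])
  exact one_ne_zero this

lemma disc2_ne (hX : P.SX) (hd : P.del ≠ 0) : ∃ t, P.disc2 t ≠ 0 := by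
  by_contra hcon
  push Not at hcon
  by_cases hl : ∃ t, P.l t ≠ 0
  · obtain ⟨t, ht⟩ := hl
    set p : Polynomial k := (P.map Polynomial.C).disc2 Polynomial.X with hp
    have hpe : ∀ t, p.eval t = P.disc2 t := by
      intro t
      have := map_disc2 (Polynomial.evalRingHom t) (P.map Polynomial.C) Polynomial.X
      rw [map_C_eval] at this
      simpa using this
    have hp0 : p = 0 := Polynomial.funext fun t => by rw [hpe, hcon]; simp
    have hder : 2 * P.b t * (P.b1 + 2 * P.b2 * t) + (P.a1 + 2 * P.a2 * t) * P.l t ^ 2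
        + 2 * P.a t * P.l t * P.c1 = 0 := by
      have := congrArg (fun q => (Polynomial.derivative q).eval t) hp0
      simp [hp, Prm.disc2, Prm.a, Prm.b, Prm.l, Prm.map, pow_two] at this
      simp [Prm.a, Prm.b, Prm.l]
      linear_combination this
    have h0 : P.b t ^ 2 + P.a t * P.l t ^ 2 = 0 := hcon t
    have := hX ![t * (2 * P.b t), P.l t ^ 2, 2 * P.b t, t * P.l t ^ 2, - P.l t * P.b t]
      (by intro h; simpa [ht] using congrFun h 1) (by simp [qA]; ring)
      (by rw [qB_conic]; linear_combination P.l t ^ 2 * h0)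
      (P.c1 * (- P.l t * P.b t) + P.b1 * P.l t ^ 2 + P.b2 * t * P.l t ^ 2) (- P.l t ^ 2)
      (by
        intro w
        rw [dB_conic, dA_conic]
        linear_combination (-(w 3 - t * w 1)) * (P.l t ^ 2 * hder - 2 * P.c1 * P.l t * h0)
          - 2 * P.l t ^ 2 * w 1 * h0)
    exact pow_ne_zero 2 ht (neg_eq_zero.mp this)
  · push Not at hl
    have hb : ∀ t, P.b t = 0 := by
      intro t
      have := hcon t
      simpa [Prm.disc2, hl t] using this
    have l0 := hl 0
    have l1 := hl 1
    have b0 := hb 0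
    have b1 := hb 1
    have b2 := hb (-1)
    simp [Prm.l, Prm.b] at l0 l1 b0 b1 b2
    apply hd
    have hc1 : P.c1 = 0 := by linear_combination l1 - l0
    have hb2 : P.b2 = 0 := by linear_combination (1/2) * b1 + (1/2) * b2 - b0
    simp [Prm.del, hc1, hb2]

lemma disc_simple [IsAlgClosed k] (hD : P.SD) (t : k) (h0 : P.disc t = 0)
    (h1 : 2 * P.be t * (-(P.c1 * P.e t + P.l t * P.h2 + (P.b1 + 2 * P.b2 * t) * P.h))
      - 4 * (-(P.h * P.c1)) * P.ga t
      - 4 * P.al t * (P.a1 + 2 * P.a2 * t - (P.b1 + 2 * P.b2 * t) * P.e t - P.b t * P.h2) = 0) :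
    False := by
  obtain ⟨q, z, hqz, k1, k2, k3⟩ : ∃ q z : k, (q ≠ 0 ∨ z ≠ 0) ∧ 2 * P.al t * z + P.be t * q = 0 ∧
      P.be t * z + 2 * P.ga t * q = 0 ∧
      (-(P.h * P.c1)) * z ^ 2
      + (-(P.c1 * P.e t + P.l t * P.h2 + (P.b1 + 2 * P.b2 * t) * P.h)) * q * z
      + (P.a1 + 2 * P.a2 * t - (P.b1 + 2 * P.b2 * t) * P.e t - P.b t * P.h2) * q ^ 2 = 0 := by
    rw [Prm.disc] at h0
    generalize P.al t = α at *
    generalize P.be t = β at *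
    generalize P.ga t = γ at *
    generalize -(P.h * P.c1) = α' at *
    generalize -(P.c1 * P.e t + P.l t * P.h2 + (P.b1 + 2 * P.b2 * t) * P.h) = β' at *
    generalize P.a1 + 2 * P.a2 * t - (P.b1 + 2 * P.b2 * t) * P.e t - P.b t * P.h2 = γ' at *
    by_cases hα : α = 0
    · by_cases hγ : γ = 0
      · have hβ : β = 0 := by
          rw [hα] at h0
          have : β ^ 2 = 0 := by linear_combination h0
          simpa using this
        by_cases hα' : α' = 0
        · exact ⟨0, 1, Or.inr one_ne_zero, by simp [hα], by simp [hβ], by simp [hα']⟩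
        · obtain ⟨d, hd⟩ := IsAlgClosed.exists_pow_nat_eq (β' ^ 2 - 4 * α' * γ') (n := 2) (by norm_num)
          refine ⟨2 * α', -β' + d, Or.inl (by simp [hα']), by simp [hα, hβ], by simp [hβ, hγ], ?_⟩
          linear_combination α' * hd
      · refine ⟨-β, 2 * γ, Or.inr (by simp [hγ]), by linear_combination -h0, by ring, ?_⟩
        linear_combination γ' * h0 - γ * h1
    · refine ⟨2 * α, -β, Or.inl (by simp [hα]), by ring, by linear_combination -h0, ?_⟩
      linear_combination α' * h0 - α * h1
  have hq' : ∀ r, r = -P.e t * q - P.h * z → q ≠ 0 → False := by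
    intro r hr hq
    have := hD ![t * r, q, r, t * q, z]
      (by intro h; exact hq (by simpa using congrFun h 1))
      (by simp [qA]; ring)
      (by
        rw [qB_conic]
        simp only [Prm.al, Prm.be, Prm.ga] at k1 k2
        rw [hr]
        linear_combination (1/2) * z * k1 + (1/2) * q * k2)
      (by simp [Prm.hh, hr, Prm.e]; ring)
      (-(P.c1 * z + P.b1 * q + P.b2 * t * q)) q (-q * (P.l t * z + P.b t * q))
      (by
        intro w
        rw [dB_conic, dA_conic]
        simp only [Prm.al, Prm.be, Prm.ga] at k1 k2
        simp only [Prm.hh]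
        have he : P.e t = P.h1 + P.h2 * t := rfl
        rw [hr]
        linear_combination (w 3 - t * w 1) * k3 + q * w 1 * k2 + q * w 4 * k1
          + q * w 1 * (P.l t * z + P.b t * q) * he)
    exact hq this
  by_cases hq : q = 0
  · have hz : z ≠ 0 := by tauto
    rw [hq] at k1 k2 k3
    have hα : P.al t = 0 := by
      have : 2 * P.al t * z = 0 := by linear_combination k1
      simpa [hz] using this
    have hβ : P.be t = 0 := by
      have : P.be t * z = 0 := by linear_combination k2
      simpa [hz] using this
    have hc : P.h * P.c1 = 0 := by
      have : P.h * P.c1 * z ^ 2 = 0 := by linear_combination -k3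
      exact (mul_eq_zero.mp this).resolve_right (pow_ne_zero 2 hz)
    rw [Prm.al] at hα
    have hh : P.h ≠ 0 := by rintro h; rw [h] at hα; simp at hα
    have hc1 : P.c1 = 0 := (mul_eq_zero.mp hc).resolve_left hh
    have hlz : P.h * P.l t = 1 := by linear_combination -hα
    rw [Prm.be] at hβ
    have := hD ![t * (-P.h * z), 0, -P.h * z, t * 0, z]
      (by intro h; exact hz (by simpa using congrFun h 4))
      (by simp [qA])
      (by
        rw [qB_conic]
        linear_combination (-z ^ 2) * hlz)
      (by simp [Prm.hh])
      (-(P.l t * z * P.h2 - P.b2 * t * (-P.h * z))) (-P.h * z) (P.h * z * (P.l t * z))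
      (by
        intro w
        rw [dB_conic, dA_conic, hc1]
        simp only [Prm.hh]
        have := hβ
        simp only [Prm.e] at this
        linear_combination (2 * P.h * z ^ 2 * w 4) * hlz - P.h * z ^2 * w 1 * this)
    simp [hh, hz] at this
  · exact hq' _ rfl hq

lemma disc_quartic (P : Prm k) : ∃ A3 A2 A1 A0 : k, ∀ t,
    P.disc t = P.del ^ 2 * t ^ 4 + A3 * t ^ 3 + A2 * t ^ 2 + A1 * t + A0 := by
  obtain ⟨B2, hB2⟩ : ∃ x, x = P.c1 * P.h2 + P.b2 * P.h := ⟨_, rfl⟩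
  obtain ⟨B1, hB1⟩ : ∃ x, x = P.c1 * P.h1 + P.c2 * P.h2 + P.b1 * P.h := ⟨_, rfl⟩
  obtain ⟨B0, hB0⟩ : ∃ x, x = P.c2 * P.h1 + P.b0 * P.h := ⟨_, rfl⟩
  obtain ⟨u0, hu0⟩ : ∃ x, x = 1 - P.h * P.c2 := ⟨_, rfl⟩
  obtain ⟨u1, hu1⟩ : ∃ x, x = - P.h * P.c1 := ⟨_, rfl⟩
  obtain ⟨g3, hg3⟩ : ∃ x, x = - P.b2 * P.h2 := ⟨_, rfl⟩
  obtain ⟨g2, hg2⟩ : ∃ x, x = P.a2 - P.b2 * P.h1 - P.b1 * P.h2 := ⟨_, rfl⟩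
  obtain ⟨g1, hg1⟩ : ∃ x, x = P.a1 - P.b1 * P.h1 - P.b0 * P.h2 := ⟨_, rfl⟩
  obtain ⟨g0, hg0⟩ : ∃ x, x = P.a0 - P.b0 * P.h1 := ⟨_, rfl⟩
  refine ⟨2 * B2 * B1 - 4 * (u1 * g2 + u0 * g3), B1 ^ 2 + 2 * B2 * B0 - 4 * (u1 * g1 + u0 * g2),
    2 * B1 * B0 - 4 * (u1 * g0 + u0 * g1), B0 ^ 2 - 4 * u0 * g0, fun t => ?_⟩
  have e1 : P.be t = -(B2 * t ^ 2 + B1 * t + B0) := by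
    simp only [Prm.be, Prm.l, Prm.e, Prm.b, hB2, hB1, hB0]; ring
  have e2 : P.al t = u0 + u1 * t := by
    simp only [Prm.al, Prm.l, hu0, hu1]; ring
  have e3 : P.ga t = g3 * t ^ 3 + g2 * t ^ 2 + g1 * t + g0 := by
    simp only [Prm.ga, Prm.a, Prm.e, Prm.b, hg3, hg2, hg1, hg0]; ring
  have e4 : P.del ^ 2 = B2 ^ 2 - 4 * u1 * g3 := by
    rw [Prm.del, hB2, hu1, hg3]; ring
  rw [Prm.disc, e1, e2, e3, e4]; ring

lemma disc_split [IsAlgClosed k] (hD : P.SD) (hd : P.del ≠ 0) :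
    ∃ m0 m1 s0 s1 : k, s1 ≠ 0 ∧
      ∀ t, P.disc t = (P.del * t ^ 2 + m1 * t + m0) ^ 2 - (s1 * t + s0) ^ 2 := by
  obtain ⟨A3, A2, A1, A0, hA⟩ := disc_quartic P
  set f : Polynomial k := Polynomial.C (P.del ^ 2) * Polynomial.X ^ 4 +
    (Polynomial.C A3 * Polynomial.X ^ 3 + Polynomial.C A2 * Polynomial.X ^ 2 +
      Polynomial.C A1 * Polynomial.X + Polynomial.C A0) with hf
  have hfdeg : f.natDegree = 4 := by
    rw [hf]
    have : P.del ^ 2 ≠ 0 := pow_ne_zero 2 hd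
    compute_degree!
  have hlead : f.leadingCoeff = P.del ^ 2 := by
    rw [Polynomial.leadingCoeff, hfdeg, hf]
    simp [-map_pow]
  have hsp : f.Splits := IsAlgClosed.splits f
  have hcard : f.roots.card = 4 := by rw [← hfdeg]; exact hsp.natDegree_eq_card_roots.symm
  obtain ⟨e1, e2, e3, e4, hr⟩ := Multiset.card_eq_four.mp hcard
  have hprod : ∀ t, P.disc t = P.del ^ 2 * ((t - e1) * (t - e2) * (t - e3) * (t - e4)) := by
    intro t
    have := hsp.eval_eq_prod_roots t
    rw [hlead, hr] at this
    simp only [hf] at this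
    simp at this
    rw [hA]
    linear_combination this
  have h23 : e2 ≠ e3 := by
    intro h
    subst h
    refine disc_simple P hD e2 (by rw [hprod]; ring) ?_
    set p : Polynomial k := (P.map Polynomial.C).disc Polynomial.X with hp
    have hpe : ∀ t, p.eval t = P.disc t := by
      intro t
      have := map_disc (Polynomial.evalRingHom t) (P.map Polynomial.C) Polynomial.X
      rw [map_C_eval] at this
      simpa using this
    have hp2 : p = Polynomial.C (P.del ^ 2) * ((Polynomial.X - Polynomial.C e1) *
        (Polynomial.X - Polynomial.C e2) * (Polynomial.X - Polynomial.C e2) *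
        (Polynomial.X - Polynomial.C e4)) := by
      apply Polynomial.funext
      intro t
      rw [hpe, hprod]; simp
    have hz : (Polynomial.derivative p).eval e2 = 0 := by
      rw [hp2]; simp
    rw [hp] at hz
    simp [Prm.disc, Prm.be, Prm.al, Prm.ga, Prm.e, Prm.a, Prm.b, Prm.l, Prm.map, pow_two] at hz
    simp only [Prm.be, Prm.al, Prm.ga, Prm.e, Prm.a, Prm.b, Prm.l]
    linear_combination hz
  by_cases hs : e3 + e4 - e1 - e2 = 0
  · refine ⟨P.del / 2 * (e1 * e3 + e2 * e4), -P.del / 2 * (e1 + e2 + e3 + e4),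
      P.del / 2 * (e1 * e3 - e2 * e4), P.del / 2 * (e2 + e4 - e1 - e3), ?_, ?_⟩
    · refine mul_ne_zero (div_ne_zero hd two_ne_zero) ?_
      intro h
      apply h23
      linear_combination (1/2) * h - (1/2) * hs
    · intro t; rw [hprod]; ring
  · refine ⟨P.del / 2 * (e1 * e2 + e3 * e4), -P.del / 2 * (e1 + e2 + e3 + e4),
      P.del / 2 * (e1 * e2 - e3 * e4), P.del / 2 * (e3 + e4 - e1 - e2), ?_, ?_⟩
    · exact mul_ne_zero (div_ne_zero hd two_ne_zero) hs
    · intro t; rw [hprod]; ring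

end coords
end DP4

namespace DP4

section lin
variable {k : Type*} [Field k] {V : Type*} [AddCommGroup V] [Module k V]

/-- Smoothness of the intersection of two quadrics. -/
def SX (A B : V →ₗ[k] V →ₗ[k] k) : Prop :=
  ∀ v, v ≠ 0 → A v v = 0 → B v v = 0 → ∀ x y : k, (∀ w, x * A v w + y * B v w = 0) → x = 0 ∧ y = 0

/-- Smoothness of the hyperplane section. -/
def SD (A B : V →ₗ[k] V →ₗ[k] k) (h : V →ₗ[k] k) : Prop :=
  ∀ v, v ≠ 0 → A v v = 0 → B v v = 0 → h v = 0 → ∀ x y z : k,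
    (∀ w, x * A v w + y * B v w + z * h w = 0) → x = 0 ∧ y = 0 ∧ z = 0

lemma two_functionals (f g : V →ₗ[k] k)
    (hi : ∀ s t : k, (∀ w, s * f w + t * g w = 0) → s = 0 ∧ t = 0) : ∃ w, f w = 1 ∧ g w = 0 := by
  by_cases hc : ∃ w, g w = 0 ∧ f w ≠ 0
  · obtain ⟨w, hg, hf⟩ := hc
    exact ⟨(f w)⁻¹ • w, by simp [hf], by simp [hg]⟩
  · exfalso
    push Not at hc
    have hg : ∃ w0, g w0 ≠ 0 := by
      by_contra hg
      push Not at hg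
      exact one_ne_zero (hi 0 1 (by intro w; simp [hg])).2
    obtain ⟨w0, hw0⟩ := hg
    apply hw0
    apply (hi (g w0) (-f w0) ?_).1
    intro w
    have := hc (w - (g w / g w0) • w0) (by simp [hw0])
    simp only [map_sub, map_smul, smul_eq_mul] at this
    field_simp at this
    linear_combination this

/-- The combination of five vectors. -/
def comb (p q r s v : V) (x : Fin 5 → k) : V := x 0 • p + x 1 • q + x 2 • r + x 3 • s + x 4 • v

set_option maxHeartbeats 1000000 in
theorem normal_form [CharZero k] [IsAlgClosed k] [FiniteDimensional k V]
    (hV : Module.finrank k V = 5)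
    (A B : V →ₗ[k] V →ₗ[k] k) (hA : ∀ x y, A x y = A y x) (hB : ∀ x y, B x y = B y x)
    (h : V →ₗ[k] k) (hX : SX A B) (hD : SD A B h) (p r v τ : V)
    (hpr : ∀ s t : k, s • p + t • r = 0 → s = 0 ∧ t = 0)
    (App : A p p = 0) (Apr : A p r = 0) (Arr : A r r = 0)
    (Bpp : B p p = 0) (Bpr : B p r = 0) (Brr : B r r = 0) (hp : h p = 0) (hr : h r = 1)
    (Av : ∀ w, A v w = 0) (Bv : B v v = 1)
    (Apτ : A p τ = 0) (Bpτ : B p τ = 0) (hτ : h τ = 0) (Aτ : A τ τ ≠ 0) :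
    ∃ (p q r s v : V) (κ : k) (P : Prm k), (∀ y, ∃ x : Fin 5 → k, y = comb p q r s v x) ∧
      (∀ x : Fin 5 → k, A (comb p q r s v x) (comb p q r s v x) = qA x) ∧
      (∀ x : Fin 5 → k, B (comb p q r s v x) (comb p q r s v x) = P.qB x - κ * qA x) ∧
      (∀ x : Fin 5 → k, h (comb p q r s v x) = P.hh x) ∧
      P.del ≠ 0 ∧ (∃ t, P.disc2 t ≠ 0) ∧ ∃ m0 m1 s0 s1 : k, s1 ≠ 0 ∧
      ∀ t, P.disc t = (P.del * t ^ 2 + m1 * t + m0) ^ 2 - (s1 * t + s0) ^ 2 := by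
  have Arp : A r p = 0 := by rw [hA]; exact Apr
  have Brp : B r p = 0 := by rw [hB]; exact Bpr
  have Av' : ∀ w, A w v = 0 := fun w => by rw [hA, Av]
  have hind : ∀ s t : k, (∀ w, s * A p w + t * A r w = 0) → s = 0 ∧ t = 0 := by
    intro s t hst
    by_contra hne
    have hne' : s • p + t • r ≠ 0 := fun h0 => hne (hpr s t h0)
    have := hX (s • p + t • r) hne' (by simp [App, Apr, Arr, Arp]) (by simp [Bpp, Bpr, Brr, Brp])
      1 0 (by intro w; simpa using hst w)
    exact one_ne_zero this.1
  obtain ⟨q0', hq1, hq2⟩ := two_functionals (A p) (A r) hind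
  obtain ⟨s0', hs1, hs2⟩ := two_functionals (A r) (A p) (fun s t hst => 
    (hind t s (fun w => by rw [add_comm]; exact hst w)).symm)
  obtain ⟨q0, hpq0, hrq0⟩ : ∃ q0, A p q0 = 1 / 2 ∧ A r q0 = 0 :=
    ⟨(1 / 2 : k) • q0', by simp [hq1], by simp [hq2]⟩
  obtain ⟨s0, hps0, hrs0⟩ : ∃ s0, A p s0 = 0 ∧ A r s0 = -1 / 2 :=
    ⟨(-1 / 2 : k) • s0', by simp [hs2], by simp [hs1]⟩
  obtain ⟨q1, hpq1, hrq1, hqq1, hqs1⟩ : ∃ q1, A p q1 = 1 / 2 ∧ A r q1 = 0 ∧ A q1 q1 = 0 ∧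
      A q1 s0 = A q0 s0 := by
    refine ⟨q0 - (A q0 q0) • p, ?_, ?_, ?_, ?_⟩
    · simp [App, hpq0]
    · simp [Arp, hrq0]
    · simp [hpq0, App, hA q0 p]; ring
    · simp [hps0]
  obtain ⟨s1, hps1, hrs1, hss1, hqs1⟩ : ∃ s1, A p s1 = 0 ∧ A r s1 = -1 / 2 ∧ A s1 s1 = 0 ∧
      A q1 s1 = 0 := by
    refine ⟨s0 + (A s0 s0) • r - (2 * A q0 s0) • p, ?_, ?_, ?_, ?_⟩
    · simp [App, Apr, hps0]
    · simp [Arr, Arp, hrs0]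
    · simp [hrs0, hps0, App, Apr, Arp, Arr, hA s0 p, hA s0 r]; ring
    · simp [hqs1, hA q1 r, hA q1 p, hpq1, hrq1]; ring
  obtain ⟨q, hpq, hrq, hqq, hqs1, hqv⟩ : ∃ q, A p q = 1 / 2 ∧ A r q = 0 ∧ A q q = 0 ∧
      A q s1 = 0 ∧ B q v = 0 := by
    refine ⟨q1 - (B q1 v) • v, ?_, ?_, ?_, ?_, ?_⟩ <;>
      simp [Av, Av', hpq1, hrq1, hqq1, hqs1, Bv]
  obtain ⟨s, hps, hrs, hss, hqs, hsv⟩ : ∃ s, A p s = 0 ∧ A r s = -1 / 2 ∧ A s s = 0 ∧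
      A q s = 0 ∧ B s v = 0 := by
    refine ⟨s1 - (B s1 v) • v, ?_, ?_, ?_, ?_, ?_⟩ <;>
      simp [Av, Av', hps1, hrs1, hss1, hqs1, Bv]
  clear hqs1 hss1 hrs1 hps1 hqq1 hrq1 hpq1 hps0 hrs0 hpq0 hrq0 hs1 hs2 hq1 hq2
  obtain ⟨κ, hκ⟩ : ∃ κ, κ = 2 * B r s := ⟨_, rfl⟩
  obtain ⟨P, hP⟩ : ∃ P : Prm k, P = ⟨2 * B p v, 2 * B r v, B q q, 2 * B q s, B s s, 2 * B r q,
    2 * B p q + κ, 2 * B p s, h q, h s, h v⟩ := ⟨_, rfl⟩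
  set E : (Fin 5 → k) → V := comb p q r s v with hE
  have EA : ∀ x w, 2 * A (E x) (E w) = dA x w := by
    intro x w
    simp only [hE, comb, map_add, map_smul, LinearMap.add_apply, LinearMap.smul_apply, smul_eq_mul,
      App, Apr, Arr, Arp, Av, Av', hpq, hrq, hqq, hps, hrs, hss, hqs, hA q p, hA q r, hA s p, hA s r,
      hA s q, dA]
    ring
  have EB : ∀ x w, 2 * B (E x) (E w) = P.dB x w - κ * dA x w := by
    intro x w
    have hvq : B v q = 0 := by rw [hB, hqv]
    have hvs : B v s = 0 := by rw [hB, hsv]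
    simp only [hE, comb, map_add, map_smul, LinearMap.add_apply, LinearMap.smul_apply, smul_eq_mul,
      Bpp, Bpr, Brr, Brp, Bv, hqv, hsv, hvq, hvs, hB q p, hB q r, hB s p, hB s r,
      hB s q, hB v p, hB v r, dA, Prm.dB, hP, hκ]
    ring
  have EA' : ∀ x, A (E x) (E x) = qA x := by
    intro x
    have := EA x x
    simp only [dA, qA] at this ⊢
    linear_combination (1/2) * this
  have EB' : ∀ x, B (E x) (E x) = P.qB x - κ * qA x := by
    intro x
    have := EB x x
    simp only [dA, qA, Prm.dB, Prm.qB] at this ⊢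
    linear_combination (1/2) * this
  have Eh : ∀ x, h (E x) = P.hh x := by
    intro x
    simp [hE, comb, Prm.hh, hp, hr, hP]; ring
  have Einj : ∀ x, E x = 0 → x = 0 := by
    intro x hx
    have e := fun w => EA x w
    simp only [hx, map_zero, LinearMap.zero_apply, mul_zero] at e
    have e0 := e ![1, 0, 0, 0, 0]
    have e1 := e ![0, 1, 0, 0, 0]
    have e2 := e ![0, 0, 1, 0, 0]
    have e3 := e ![0, 0, 0, 1, 0]
    simp [dA] at e0 e1 e2 e3
    replace e0 := e0.symm
    replace e1 := e1.symm
    have hx4 : B (E x) v = 0 := by rw [hx]; simp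
    simp [hE, comb, e0, e1, e2, e3, Bv] at hx4
    funext i; fin_cases i <;> simp [e0, e1, e2, e3, hx4]
  let EL : (Fin 5 → k) →ₗ[k] V :=
    { toFun := E
      map_add' := by intro x y; simp only [hE, comb, Pi.add_apply]; module
      map_smul' := by intro c y; simp only [hE, comb, Pi.smul_apply, smul_eq_mul, RingHom.id_apply]; module }
  have hinj : Function.Injective EL := by
    rw [← LinearMap.ker_eq_bot, LinearMap.ker_eq_bot']
    exact Einj
  have hsurj : Function.Surjective EL :=
    (LinearMap.injective_iff_surjective_of_finrank_eq_finrank (by simp [hV])).mp hinj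
  have hPX : P.SX := by
    intro x hx hxA hxB l m hlm
    have := hX (E x) (fun h0 => hx (Einj x h0)) (by rw [EA', hxA]) (by rw [EB', hxA, hxB]; ring)
      (l + m * κ) m (by
        intro w
        obtain ⟨w, rfl⟩ := hsurj w
        change _ * A (E x) (E w) + _ * B (E x) (E w) = 0
        linear_combination (1/2) * (l + m * κ) * EA x w + (1/2) * m * EB x w + (1/2) * hlm w)
    exact this.2
  have hPD : P.SD := by
    intro x hx hxA hxB hxh l m n hlm
    have := hD (E x) (fun h0 => hx (Einj x h0)) (by rw [EA', hxA]) (by rw [EB', hxA, hxB]; ring)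
      (by rw [Eh, hxh]) (l + m * κ) m (n / 2) (by
        intro w
        obtain ⟨w, rfl⟩ := hsurj w
        change _ * A (E x) (E w) + _ * B (E x) (E w) + _ * h (E w) = 0
        rw [Eh]
        linear_combination (1/2) * (l + m * κ) * EA x w + (1/2) * m * EB x w + (1/2) * hlm w)
    exact this.2.1
  have hdel : P.del ≠ 0 := by
    obtain ⟨τ, rfl⟩ := hsurj τ
    change A p (E τ) = 0 at Apτ
    change B p (E τ) = 0 at Bpτ
    change A (E τ) (E τ) ≠ 0 at Aτ
    change h (E τ) = 0 at hτ
    have hpE : p = E ![1, 0, 0, 0, 0] := by simp [hE, comb]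
    have k1 := EA ![1, 0, 0, 0, 0] τ
    have k2 := EB ![1, 0, 0, 0, 0] τ
    rw [← hpE, Apτ] at k1
    rw [← hpE, Bpτ] at k2
    simp [dA, Prm.dB] at k1 k2
    apply del_ne P hPX τ k1.symm _ (by rw [← Eh]; exact hτ) (by rw [← EA']; exact Aτ)
    linear_combination -k2 + (P.b1 - κ) * k1
  exact ⟨p, q, r, s, v, κ, P, fun y => (hsurj y).imp fun x hx => hx.symm, EA', EB', Eh, hdel,
    disc2_ne P hPX hdel, disc_split P hPD hdel⟩

end lin
end DP4

namespace DP4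

section lin2
variable {k : Type*} [Field k]

lemma exists_split [IsAlgClosed k] {V : Type*} [AddCommGroup V] [Module k V]
    [FiniteDimensional k V] [Nontrivial V]
    (A B : V →ₗ[k] V →ₗ[k] k) (hX : SX A B) :
    ∃ (v : V) (f : V →ₗ[k] k) (a b : k), f v ≠ 0 ∧ (a ≠ 0 ∨ b ≠ 0) ∧
      (∀ w, A v w = a * f w) ∧ (∀ w, B v w = b * f w) := by
  obtain ⟨v, x, y, hv, hxy, h⟩ : ∃ (v : V) (x y : k), v ≠ 0 ∧ (x ≠ 0 ∨ y ≠ 0) ∧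
      ∀ w, x * A v w + y * B v w = 0 := by
    by_cases hA : Function.Injective A
    · let e : V ≃ₗ[k] Module.Dual k V :=
        LinearEquiv.ofInjectiveOfFinrankEq A hA (Subspace.dual_finrank_eq).symm
      obtain ⟨μ, hμ⟩ := Module.End.exists_eigenvalue (e.symm.toLinearMap ∘ₗ B)
      obtain ⟨v, hv⟩ := hμ.exists_hasEigenvector
      refine ⟨v, -μ, 1, hv.2, Or.inr one_ne_zero, fun w => ?_⟩
      have h1 : e.symm (B v) = μ • v := hv.apply_eq_smul
      have h2 : B v = e (μ • v) := by rw [← h1]; simp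
      have h3 : e (μ • v) = A (μ • v) := rfl
      rw [h2, h3]; simp
    · have : ∃ v, v ≠ 0 ∧ A v = 0 := by
        rw [← LinearMap.ker_eq_bot, LinearMap.ker_eq_bot'] at hA
        push Not at hA
        obtain ⟨v, h1, h2⟩ := hA
        exact ⟨v, h2, h1⟩
      obtain ⟨v, hv, h0⟩ := this
      exact ⟨v, 1, 0, hv, Or.inl one_ne_zero, fun w => by simp [h0]⟩
  by_cases hAv : A v v = 0
  · by_cases hBv : B v v = 0
    · have := hX v hv hAv hBv x y h
      tauto
    · have hx : x ≠ 0 := by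
        rintro rfl
        have := h v
        simp [hBv] at this
        tauto
      refine ⟨v, B v, -(y / x), 1, hBv, Or.inr one_ne_zero, fun w => ?_, fun w => by simp⟩
      field_simp
      linear_combination h w
  · have hy : y ≠ 0 := by
      rintro rfl
      have := h v
      simp [hAv] at this
      tauto
    refine ⟨v, A v, 1, -(x / y), hAv, Or.inl one_ne_zero, fun w => by simp, fun w => ?_⟩
    field_simp
    linear_combination h w

lemma exists_ortho [IsAlgClosed k] (n : ℕ) : ∀ {V : Type*} [AddCommGroup V] [Module k V]
    [FiniteDimensional k V] (A B : V →ₗ[k] V →ₗ[k] k) (_ : ∀ x y, A x y = A y x)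
    (_ : ∀ x y, B x y = B y x) (_ : SX A B) (_ : Module.finrank k V = n),
    ∃ e : Fin n → V, (∀ i j, i ≠ j → A (e i) (e j) = 0 ∧ B (e i) (e j) = 0) ∧
      ∀ i, A (e i) (e i) ≠ 0 ∨ B (e i) (e i) ≠ 0 := by
  induction n with
  | zero => intro V _ _ _ A B _ _ _ _; exact ⟨Fin.elim0, fun i => i.elim0, fun i => i.elim0⟩
  | succ n ih =>
    intro V _ _ _ A B hA hB hX hV
    have : Nontrivial V := Module.nontrivial_of_finrank_pos (R := k) (by omega)
    obtain ⟨v, f, a, b, hfv, hab, hAv, hBv⟩ := exists_split A B hX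
    let W := LinearMap.ker f
    have hW : Module.finrank k W = n := by
      have h1 := LinearMap.finrank_range_add_finrank_ker f
      have h2 : LinearMap.range f = ⊤ := by
        rw [LinearMap.range_eq_top]
        intro c
        exact ⟨(c / f v) • v, by simp [hfv]⟩
      rw [h2, finrank_top, Module.finrank_self, hV] at h1
      change Module.finrank k (LinearMap.ker f) = n
      omega
    obtain ⟨e, he1, he2⟩ := ih (V := W) (A.domRestrict₁₂ W W) (B.domRestrict₁₂ W W)
      (fun x y => hA _ _) (fun x y => hB _ _) (by
        intro w hw h1 h2 x y hxy
        apply hX w (by simpa using hw) h1 h2 x y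
        intro u
        have hu : u - (f u / f v) • v ∈ W := by simp [W, hfv]
        have := hxy ⟨_, hu⟩
        have hw0 : f w = 0 := w.2
        simp only [LinearMap.domRestrict₁₂_apply, map_sub, map_smul, smul_eq_mul] at this
        rw [hA w v, hB w v, hAv, hBv, hw0] at this
        linear_combination this) hW
    have hAve : ∀ i, A v (e i) = 0 := fun i => by
      have : f (e i) = 0 := (e i).2
      rw [hAv, this, mul_zero]
    have hBve : ∀ i, B v (e i) = 0 := fun i => by
      have : f (e i) = 0 := (e i).2
      rw [hBv, this, mul_zero]
    refine ⟨Fin.cons v (fun i => (e i : V)), ?_, ?_⟩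
    · intro i j
      refine Fin.cases ?_ (fun i => ?_) i <;> refine Fin.cases ?_ (fun j => ?_) j
      · simp
      · intro _; simp [hAve, hBve]
      · intro _; simp only [Fin.cons_succ, Fin.cons_zero]; rw [hA, hB]; simp [hAve, hBve]
      · intro hij
        simp only [Fin.cons_succ]
        exact he1 i j (by simpa using hij)
    · intro i
      refine Fin.cases ?_ (fun i => ?_) i
      · simp only [Fin.cons_zero]
        rw [hAv, hBv]
        simpa [hfv] using hab
      · simp only [Fin.cons_succ]
        exact he2 i

lemma no_line [IsAlgClosed k] [CharZero k] {V : Type*} [AddCommGroup V] [Module k V]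
    [FiniteDimensional k V] (hV : Module.finrank k V = 5)
    (A B : V →ₗ[k] V →ₗ[k] k) (hA : ∀ x y, A x y = A y x) (hB : ∀ x y, B x y = B y x)
    (h : V →ₗ[k] k) (hD : SD A B h) (p r : V)
    (hpr : ∀ s t : k, s • p + t • r = 0 → s = 0 ∧ t = 0)
    (App : A p p = 0) (Apr : A p r = 0) (Arr : A r r = 0)
    (Bpp : B p p = 0) (Bpr : B p r = 0) (Brr : B r r = 0) (hp : h p = 0) (hr : h r = 0) : False := by
  have Arp : A r p = 0 := by rw [hA]; exact Apr
  have Brp : B r p = 0 := by rw [hB]; exact Bpr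
  have hli : LinearIndependent k ![p, r] := by
    rw [LinearIndependent.pair_iff]; exact hpr
  let L := Submodule.span k (Set.range ![p, r])
  have hL : Module.finrank k L = 2 := by
    simpa using finrank_span_eq_card hli
  obtain ⟨C, hC⟩ := Submodule.exists_isCompl L
  have hCf : Module.finrank k C = 3 := by
    have := Submodule.finrank_add_eq_of_isCompl hC
    omega
  let u : Module.Basis (Fin 3) k C := Module.finBasisOfFinrankEq k C hCf
  have key : ∀ g : V →ₗ[k] k, g p = 0 → g r = 0 → (∀ j, g (u j) = 0) → ∀ w, g w = 0 := by
    intro g gp gr gu w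
    have hw : w ∈ L ⊔ C := by rw [hC.sup_eq_top]; trivial
    obtain ⟨l, hl, c, hc, rfl⟩ := Submodule.mem_sup.mp hw
    have h1 : g l = 0 := by
      have : L ≤ LinearMap.ker g := by
        rw [Submodule.span_le]
        rintro _ ⟨i, rfl⟩
        fin_cases i <;> simp [gp, gr]
      exact this hl
    have h2 : g c = 0 := by
      have : g ∘ₗ C.subtype = 0 := u.ext fun j => by simpa using gu j
      exact LinearMap.congr_fun this ⟨c, hc⟩
    rw [map_add, h1, h2, add_zero]
  let N : k → k → Matrix (Fin 3) (Fin 3) k := fun s t =>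
    ![fun j => A (s • p + t • r) (u j), fun j => B (s • p + t • r) (u j), fun j => h (u j)]
  have hdet : ∃ a b c : k, ∀ s t, (N s t).det = a * s ^ 2 + b * s * t + c * t ^ 2 := by
    refine ⟨(N 1 0).det, (N 1 1).det - (N 1 0).det - (N 0 1).det, (N 0 1).det, fun s t => ?_⟩
    rw [Matrix.det_fin_three, Matrix.det_fin_three, Matrix.det_fin_three, Matrix.det_fin_three]
    simp [N]
    ring
  obtain ⟨a, b, c, habc⟩ := hdet
  obtain ⟨s, t, hst, h0⟩ : ∃ s t : k, (s ≠ 0 ∨ t ≠ 0) ∧ (N s t).det = 0 := by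
    by_cases ha : a = 0
    · exact ⟨1, 0, Or.inl one_ne_zero, by rw [habc, ha]; ring⟩
    · obtain ⟨d, hd⟩ := IsAlgClosed.exists_pow_nat_eq (b ^ 2 - 4 * a * c) (n := 2) (by norm_num)
      refine ⟨-b + d, 2 * a, Or.inr (by simp [ha]), ?_⟩
      rw [habc]
      linear_combination a * hd
  obtain ⟨x, hx, hx0⟩ := Matrix.exists_vecMul_eq_zero_iff.mpr h0
  have hw : s • p + t • r ≠ 0 := by
    intro h
    have := hpr s t h
    tauto
  have := hD (s • p + t • r) hw (by simp [App, Apr, Arr, Arp]) (by simp [Bpp, Bpr, Brr, Brp])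
    (by simp [hp, hr]) (x 0) (x 1) (x 2) (by
      intro w
      have := key (x 0 • A (s • p + t • r) + x 1 • B (s • p + t • r) + x 2 • h)
        (by simp [App, Arp, Bpp, Brp, hp]) (by simp [Apr, Arr, Bpr, Brr, hr]) (by
          intro j
          have := congrFun hx0 j
          simp only [Matrix.vecMul, dotProduct, Fin.sum_univ_three, N] at this
          simp at this ⊢
          linear_combination this) w
      simp at this ⊢
      linear_combination this)
  apply hx
  funext i
  fin_cases i
  · exact this.1
  · exact this.2.1
  · exact this.2.2

end lin2
end DP4

namespace DP4

section lin3
variable {k : Type*} [Field k] {V : Type*} [AddCommGroup V] [Module k V]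

lemma diag_sum' (A : V →ₗ[k] V →ₗ[k] k) (e : Fin 5 → V)
    (ho : ∀ i j, i ≠ j → A (e i) (e j) = 0) (u : Fin 5 → k) (j : Fin 5) :
    A (∑ i, u i • e i) (e j) = u j * A (e j) (e j) := by
  rw [map_sum, LinearMap.sum_apply, Finset.sum_eq_single j]
  · simp
  · intro i _ hj; simp [ho i j hj]
  · simp

lemma diag_sum (A : V →ₗ[k] V →ₗ[k] k) (e : Fin 5 → V)
    (ho : ∀ i j, i ≠ j → A (e i) (e j) = 0) (u w : Fin 5 → k) :
    A (∑ i, u i • e i) (∑ i, w i • e i) = ∑ i, u i * w i * A (e i) (e i) := by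
  rw [map_sum]
  refine Finset.sum_congr rfl fun i _ => ?_
  rw [map_smul, diag_sum' A e ho, smul_eq_mul]
  ring

lemma ortho_span [FiniteDimensional k V] (hV : Module.finrank k V = 5)
    (A B : V →ₗ[k] V →ₗ[k] k) (e : Fin 5 → V)
    (ho : ∀ i j, i ≠ j → A (e i) (e j) = 0 ∧ B (e i) (e j) = 0)
    (hn : ∀ i, A (e i) (e i) ≠ 0 ∨ B (e i) (e i) ≠ 0) (y : V) :
    ∃ u : Fin 5 → k, y = ∑ i, u i • e i := by
  have hl : LinearIndependent k e := by
    rw [Fintype.linearIndependent_iff]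
    intro g hg i
    have h1 := diag_sum' A e (fun i j h => (ho i j h).1) g i
    have h2 := diag_sum' B e (fun i j h => (ho i j h).2) g i
    rw [hg] at h1 h2
    simp at h1 h2
    have := hn i
    tauto
  let b := basisOfLinearIndependentOfCardEqFinrank hl (by simp [hV])
  refine ⟨b.repr y, ?_⟩
  conv_lhs => rw [← b.sum_repr y]
  simp [b]

lemma d_ne [IsAlgClosed k] [FiniteDimensional k V] (hV : Module.finrank k V = 5)
    (A B : V →ₗ[k] V →ₗ[k] k) (hX : SX A B) (e : Fin 5 → V)
    (ho : ∀ i j, i ≠ j → A (e i) (e j) = 0 ∧ B (e i) (e j) = 0)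
    (hn : ∀ i, A (e i) (e i) ≠ 0 ∨ B (e i) (e i) ≠ 0) (i j : Fin 5) (hij : i ≠ j) :
    A (e i) (e i) * B (e j) (e j) - A (e j) (e j) * B (e i) (e i) ≠ 0 := by
  intro hd
  obtain ⟨κ, h1, h2⟩ : ∃ κ, A (e i) (e i) = κ * A (e j) (e j) ∧
      B (e i) (e i) = κ * B (e j) (e j) := by
    rcases hn j with h | h
    · refine ⟨A (e i) (e i) / A (e j) (e j), by field_simp, ?_⟩
      field_simp; linear_combination -hd
    · refine ⟨B (e i) (e i) / B (e j) (e j), ?_, by field_simp⟩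
      field_simp; linear_combination hd
  obtain ⟨c, hc⟩ := IsAlgClosed.exists_pow_nat_eq (-κ) (n := 2) (by norm_num)
  have := hX (e i + c • e j) ?_ ?_ ?_ (B (e j) (e j)) (-A (e j) (e j)) ?_
  · have := hn j
    simp_all
  · intro h0
    have h3 : A (e i + c • e j) (e i) = A (e i) (e i) := by simp [ho j i hij.symm]
    have h4 : B (e i + c • e j) (e i) = B (e i) (e i) := by simp [ho j i hij.symm]
    rw [h0] at h3 h4
    have := hn i
    simp at h3 h4
    rw [← h3, ← h4] at this
    tauto
  · simp [ho i j hij, ho j i hij.symm]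
    linear_combination h1 + A (e j) (e j) * hc
  · simp [ho i j hij, ho j i hij.symm]
    linear_combination h2 + B (e j) (e j) * hc
  · intro w
    obtain ⟨u, rfl⟩ := ortho_span hV A B e ho hn w
    simp only [map_sum, map_smul, smul_eq_mul, Finset.mul_sum, ← Finset.sum_add_distrib]
    refine Finset.sum_eq_zero fun l _ => ?_
    simp only [map_add, map_smul, LinearMap.add_apply, LinearMap.smul_apply, smul_eq_mul]
    by_cases hil : i = l
    · subst hil
      simp [ho j i hij.symm]
      linear_combination u i * hd
    · by_cases hjl : j = l
      · subst hjl
        simp [ho i j hij]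
        ring
      · simp [ho i l hil, ho j l hjl]

lemma exists_line [IsAlgClosed k] [FiniteDimensional k V] (hV : Module.finrank k V = 5)
    (A B : V →ₗ[k] V →ₗ[k] k) (hX : SX A B) (e : Fin 5 → V)
    (ho : ∀ i j, i ≠ j → A (e i) (e j) = 0 ∧ B (e i) (e j) = 0)
    (hn : ∀ i, A (e i) (e i) ≠ 0 ∨ B (e i) (e i) ≠ 0) :
    ∃ x y : V, (∀ s t : k, s • x + t • y = 0 → s = 0 ∧ t = 0) ∧
      A x x = 0 ∧ A x y = 0 ∧ A y y = 0 ∧ B x x = 0 ∧ B x y = 0 ∧ B y y = 0 := by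
  have hd := d_ne hV A B hX e ho hn
  set α : Fin 5 → k := fun i => A (e i) (e i) with hα
  set β : Fin 5 → k := fun i => B (e i) (e i) with hβ
  let F : (Fin 5 → k) →ₗ[k] (Fin 4 → k) :=
    Matrix.mulVecLin (Matrix.of fun (a : Fin 4) i => α i ^ (a : ℕ) * β i ^ (3 - (a : ℕ)))
  have hF : LinearMap.ker F ≠ ⊥ := LinearMap.ker_ne_bot_of_finrank_lt (by simp)
  obtain ⟨c, hc, hc0⟩ := Submodule.exists_mem_ne_zero_of_ne_bot hF
  have hs : ∀ a : Fin 4, ∑ i, α i ^ (a : ℕ) * β i ^ (3 - (a : ℕ)) * c i = 0 := by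
    intro a
    have := congrFun (LinearMap.mem_ker.1 hc) a
    simpa [F, Matrix.mulVec, dotProduct] using this
  choose g hg using fun i => IsAlgClosed.exists_pow_nat_eq (c i) (n := 2) (by norm_num)
  have h0 := hs 0
  have h1 := hs 1
  have h2 := hs 2
  have h3 := hs 3
  simp at h0 h1 h2 h3
  obtain ⟨i, hi⟩ : ∃ i, c i ≠ 0 := by
    by_contra h; push Not at h; exact hc0 (funext h)
  obtain ⟨j, hji, hj⟩ : ∃ j, j ≠ i ∧ c j ≠ 0 := by
    by_contra! h
    rw [Finset.sum_eq_single i (fun j _ hj => by simp [h j hj]) (by simp)] at h0 h3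
    simp [hi] at h0 h3
    have := hn i
    tauto
  have hgi : g i ≠ 0 := by intro h; apply hi; rw [← hg, h]; simp
  have hgj : g j ≠ 0 := by intro h; apply hj; rw [← hg, h]; simp
  have hoA := fun i j h => (ho i j h).1
  have hoB := fun i j h => (ho i j h).2
  refine ⟨∑ i, (α i * g i) • e i, ∑ i, (β i * g i) • e i, ?_, ?_, ?_, ?_, ?_, ?_, ?_⟩
  · intro s t hst
    have key : ∀ l, g l ≠ 0 → s * α l + t * β l = 0 := by
      intro l hl
      have e1 : A (s • ∑ i, (α i * g i) • e i + t • ∑ i, (β i * g i) • e i) (e l) = 0 := by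
        rw [hst]; simp
      have e2 : B (s • ∑ i, (α i * g i) • e i + t • ∑ i, (β i * g i) • e i) (e l) = 0 := by
        rw [hst]; simp
      rw [map_add, map_smul, map_smul, LinearMap.add_apply, LinearMap.smul_apply,
        LinearMap.smul_apply, diag_sum' _ _ hoA, diag_sum' _ _ hoA] at e1
      rw [map_add, map_smul, map_smul, LinearMap.add_apply, LinearMap.smul_apply,
        LinearMap.smul_apply, diag_sum' _ _ hoB, diag_sum' _ _ hoB] at e2
      simp only [smul_eq_mul] at e1 e2
      rcases hn l with h | h
      · apply mul_right_cancel₀ (mul_ne_zero hl h)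
        linear_combination e1
      · apply mul_right_cancel₀ (mul_ne_zero hl h)
        linear_combination e2
    have k1 := key i hgi
    have k2 := key j hgj
    have := hd i j hji.symm
    constructor
    · apply mul_right_cancel₀ this
      linear_combination β j * k1 - β i * k2
    · apply mul_right_cancel₀ this
      linear_combination α i * k2 - α j * k1
  all_goals first | rw [diag_sum _ _ hoA] | rw [diag_sum _ _ hoB]
  · rw [← h3]; refine Finset.sum_congr rfl fun i _ => ?_; rw [← hg]; simp only [hα]; ring
  · rw [← h2]; refine Finset.sum_congr rfl fun i _ => ?_; rw [← hg]; simp only [hα]; ring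
  · rw [← h1]; refine Finset.sum_congr rfl fun i _ => ?_; rw [← hg]; simp only [hα]; ring
  · rw [← h2]; refine Finset.sum_congr rfl fun i _ => ?_; rw [← hg]; simp only [hβ]; ring
  · rw [← h1]; refine Finset.sum_congr rfl fun i _ => ?_; rw [← hg]; simp only [hβ]; ring
  · rw [← h0]; refine Finset.sum_congr rfl fun i _ => ?_; rw [← hg]; simp only [hβ]; ring

set_option maxHeartbeats 1000000 in
theorem geom_normal [CharZero k] [IsAlgClosed k] [FiniteDimensional k V]
    (hV : Module.finrank k V = 5)
    (A B : V →ₗ[k] V →ₗ[k] k) (hA : ∀ x y, A x y = A y x) (hB : ∀ x y, B x y = B y x)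
    (h : V →ₗ[k] k) (hX : SX A B) (hD : SD A B h) :
    ∃ (p q r s v : V) (x1 y1 x2 y2 : k) (P : Prm k),
      (∀ y, ∃ x : Fin 5 → k, y = comb p q r s v x) ∧
      (∀ x : Fin 5 → k, A (comb p q r s v x) (comb p q r s v x) = x1 * qA x + y1 * P.qB x) ∧
      (∀ x : Fin 5 → k, B (comb p q r s v x) (comb p q r s v x) = x2 * qA x + y2 * P.qB x) ∧
      (∀ x : Fin 5 → k, h (comb p q r s v x) = P.hh x) ∧ x1 * y2 - x2 * y1 ≠ 0 ∧
      P.del ≠ 0 ∧ (∃ t, P.disc2 t ≠ 0) ∧ ∃ m0 m1 s0 s1 : k, s1 ≠ 0 ∧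
      ∀ t, P.disc t = (P.del * t ^ 2 + m1 * t + m0) ^ 2 - (s1 * t + s0) ^ 2 := by
  obtain ⟨e, ho, hn⟩ := exists_ortho 5 A B hA hB hX hV
  have hd := d_ne hV A B hX e ho hn
  obtain ⟨p, r, hpr, App, Apr, Arr, Bpp, Bpr, Brr, hp, hr⟩ : ∃ p r : V,
      (∀ s t : k, s • p + t • r = 0 → s = 0 ∧ t = 0) ∧
      A p p = 0 ∧ A p r = 0 ∧ A r r = 0 ∧ B p p = 0 ∧ B p r = 0 ∧ B r r = 0 ∧ h p = 0 ∧
      h r = 1 := by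
    have aux : ∀ x y : V, (∀ s t : k, s • x + t • y = 0 → s = 0 ∧ t = 0) → A x x = 0 →
      A x y = 0 → A y y = 0 → B x x = 0 → B x y = 0 → B y y = 0 → h y ≠ 0 → ∃ p r : V,
      (∀ s t : k, s • p + t • r = 0 → s = 0 ∧ t = 0) ∧
      A p p = 0 ∧ A p r = 0 ∧ A r r = 0 ∧ B p p = 0 ∧ B p r = 0 ∧ B r r = 0 ∧ h p = 0 ∧
      h r = 1 := by
      intro x y hxy a1 a2 a3 b1 b2 b3 hy
      have a4 : A y x = 0 := by rw [hA, a2]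
      have b4 : B y x = 0 := by rw [hB, b2]
      refine ⟨x - (h x / h y) • y, (h y)⁻¹ • y, ?_, by simp [a1, a2, a3, a4], by simp [a2, a3],
        by simp [a3], by simp [b1, b2, b3, b4], by simp [b2, b3], by simp [b3], by simp [hy], by simp [hy]⟩
      intro s t hst
      have := hxy s (-(s * (h x / h y)) + t * (h y)⁻¹) (by
        rw [← hst]; module)
      have h1 := this.1
      have h2 := this.2
      simp [h1, hy] at h2
      exact ⟨h1, h2⟩
    obtain ⟨x, y, hxy, a1, a2, a3, b1, b2, b3⟩ := exists_line hV A B hX e ho hn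
    by_cases hy : h y = 0
    · by_cases hx : h x = 0
      · exact (no_line hV A B hA hB h hD x y hxy a1 a2 a3 b1 b2 b3 hx hy).elim
      · exact aux y x (fun s t hst => (hxy t s (by rw [add_comm]; exact hst)).symm) a3
          (by rw [hA, a2]) a1 b3 (by rw [hB, b2]) b1 hx
    · exact aux x y hxy a1 a2 a3 b1 b2 b3 hy
  have hp0 : p ≠ 0 := by
    rintro rfl
    exact one_ne_zero (hpr 1 0 (by simp)).1
  obtain ⟨τ, hpτ, Apτ, Bpτ, hτ⟩ : ∃ τ : V, (∀ s t : k, s • p + t • τ = 0 → s = 0 ∧ t = 0) ∧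
      A p τ = 0 ∧ B p τ = 0 ∧ h τ = 0 := by
    by_contra! hcon
    let F : V →ₗ[k] k × k × k := (A p).prod ((B p).prod h)
    have hk : LinearMap.ker F ≤ Submodule.span k {p} := by
      intro τ hτ
      have hτ' : A p τ = 0 ∧ B p τ = 0 ∧ h τ = 0 := by
        simpa [F] using hτ
      by_contra hns
      refine hcon τ ?_ hτ'.1 hτ'.2.1 hτ'.2.2
      intro s t hst
      have ht : t = 0 := by
        by_contra ht
        apply hns
        rw [Submodule.mem_span_singleton]
        refine ⟨-(t⁻¹ * s), ?_⟩
        have : τ = t⁻¹ • (t • τ) := by simp [ht]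
        rw [this, eq_neg_of_add_eq_zero_right hst]
        module
      subst ht
      simpa [hp0] using hst
    have h1 := Submodule.finrank_mono hk
    rw [finrank_span_singleton hp0] at h1
    have h2 := F.finrank_range_add_finrank_ker
    have h3 := Submodule.finrank_le (LinearMap.range F)
    simp at h3
    omega
  obtain ⟨i, hi⟩ : ∃ i, B (e i) (e i) * A τ τ - A (e i) (e i) * B τ τ ≠ 0 := by
    by_contra! hcon
    have c0 := hcon 0
    have c1 := hcon 1
    have d := hd 0 1 (by decide)
    refine no_line hV A B hA hB h hD p τ hpτ App Apτ ?_ Bpp Bpτ ?_ hp hτ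
    · apply mul_left_cancel₀ d
      linear_combination A (e 0) (e 0) * c1 - A (e 1) (e 1) * c0
    · apply mul_left_cancel₀ d
      linear_combination B (e 0) (e 0) * c1 - B (e 1) (e 1) * c0
  set α := A (e i) (e i) with hα
  set β := B (e i) (e i) with hβ
  obtain ⟨u, w, huw⟩ : ∃ u w, u * α + w * β = 1 := by
    rcases hn i with h | h
    · exact ⟨α⁻¹, 0, by simp [hα, h]⟩
    · exact ⟨0, β⁻¹, by simp [hβ, h]⟩
  obtain ⟨A', hA'⟩ : ∃ A' : V →ₗ[k] V →ₗ[k] k, ∀ x y, A' x y = β * A x y - α * B x y :=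
    ⟨β • A - α • B, by intro x y; simp⟩
  obtain ⟨B', hB'⟩ : ∃ B' : V →ₗ[k] V →ₗ[k] k, ∀ x y, B' x y = u * A x y + w * B x y :=
    ⟨u • A + w • B, by intro x y; simp⟩
  have iA : ∀ x y, A x y = w * A' x y + α * B' x y := by
    intro x y; rw [hA', hB']; linear_combination -A x y * huw
  have iB : ∀ x y, B x y = -u * A' x y + β * B' x y := by
    intro x y; rw [hA', hB']; linear_combination -B x y * huw
  have rec2 : ∀ x y : k, x * β + y * u = 0 → -x * α + y * w = 0 → x = 0 ∧ y = 0 := by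
    intro x y h1 h2
    constructor
    · linear_combination w * h1 - u * h2 - x * huw
    · linear_combination α * h1 + β * h2 - y * huw
  have hX' : SX A' B' := by
    intro v hv h1 h2 x y hxy
    have := hX v hv (by rw [iA, h1, h2]; simp) (by rw [iB, h1, h2]; simp) (x * β + y * u)
      (-x * α + y * w) (by
        intro z
        have := hxy z
        rw [hA', hB'] at this
        linear_combination this)
    exact rec2 x y this.1 this.2
  have hD' : SD A' B' h := by
    intro v hv h1 h2 h3 x y z hxy
    have := hD v hv (by rw [iA, h1, h2]; simp) (by rw [iB, h1, h2]; simp) h3 (x * β + y * u)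
      (-x * α + y * w) z (by
        intro z
        have := hxy z
        rw [hA', hB'] at this
        linear_combination this)
    have h4 := rec2 x y this.1 this.2.1
    exact ⟨h4.1, h4.2, this.2.2⟩
  obtain ⟨p, q, r, s, v, κ, P, g1, g2, g3, g4, g5, g6, g7⟩ := normal_form hV A' B'
    (by intro x y; rw [hA', hA', hA, hB]) (by intro x y; rw [hB', hB', hA, hB]) h hX' hD' p r
    (e i) τ hpr (by simp [hA', App, Apr, Arr, Bpp, Bpr, Brr, Apτ, Bpτ]) (by simp [hA', App, Apr, Arr, Bpp, Bpr, Brr, Apτ, Bpτ]) (by simp [hA', App, Apr, Arr, Bpp, Bpr, Brr, Apτ, Bpτ]) (by simp [hB', App, Apr, Arr, Bpp, Bpr, Brr, Apτ, Bpτ])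
    (by simp [hB', App, Apr, Arr, Bpp, Bpr, Brr, Apτ, Bpτ]) (by simp [hB', App, Apr, Arr, Bpp, Bpr, Brr, Apτ, Bpτ]) hp hr
    (by
      intro z
      obtain ⟨c, rfl⟩ := ortho_span hV A B e ho hn z
      have hc : ∀ C : V →ₗ[k] V →ₗ[k] k, (∀ j, C (e i) (e j) = 0) → 
          C (e i) (∑ j, c j • e j) = 0 := by
        intro C hC; simp [hC]
      apply hc
      intro j
      rw [hA']
      by_cases hij : i = j
      · subst hij; rw [← hα, ← hβ]; ring
      · simp [ho i j hij])
    (by rw [hB', ← hα, ← hβ, huw]) (by simp [hA', App, Apr, Arr, Bpp, Bpr, Brr, Apτ, Bpτ]) (by simp [hB', App, Apr, Arr, Bpp, Bpr, Brr, Apτ, Bpτ]) hτ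
    (by rw [hA']; exact hi)
  refine ⟨p, q, r, s, v, w - α * κ, α, -u - β * κ, β, P, g1, ?_, ?_, g4, ?_, g5, g6, g7⟩
  · intro x; rw [iA, g2, g3]; ring
  · intro x; rw [iB, g2, g3]; ring
  · have : (w - α * κ) * β - (-u - β * κ) * α = 1 := by linear_combination huw
    rw [this]; exact one_ne_zero

end lin3
end DP4

namespace DP4

section forms
variable {K : Type*} [Field K] 

lemma linform (H : MvPolynomial (Fin 5) K) (hH : H.IsHomogeneous 1) :
    ∃ η : Fin 5 → K, (∀ i, pderiv i H = C (η i)) ∧ H = ∑ i, C (η i) * X i := by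
  have h0 : ∀ i, ∃ c, pderiv i H = C c := by
    intro i
    have : (pderiv i H).IsHomogeneous 0 := hH.pderiv
    rw [← totalDegree_zero_iff_isHomogeneous, totalDegree_eq_zero_iff_eq_C] at this
    exact ⟨_, this⟩
  choose η hη using h0
  refine ⟨η, hη, ?_⟩
  have := hH.sum_X_mul_pderiv
  rw [one_smul] at this
  conv_lhs => rw [← this]
  simp_rw [hη, mul_comm]

lemma pderiv_pderiv_comm (i j : Fin 5) (Q : MvPolynomial (Fin 5) K) :
    pderiv i (pderiv j Q) = pderiv j (pderiv i Q) := by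
  have : ⁅(pderiv i : Derivation K (MvPolynomial (Fin 5) K) (MvPolynomial (Fin 5) K)),
      (pderiv j : Derivation K (MvPolynomial (Fin 5) K) (MvPolynomial (Fin 5) K))⁆ = 0 := by
    apply MvPolynomial.derivation_ext
    intro l
    rw [Derivation.commutator_apply]
    simp [pderiv_X, Pi.single_apply]
    split_ifs <;> simp
  have h2 := congrArg (fun D => D Q) this
  simp only [Derivation.commutator_apply] at h2
  exact sub_eq_zero.1 h2

lemma quadform (Q : MvPolynomial (Fin 5) K) (hQ : Q.IsHomogeneous 2) :
    ∃ c : Fin 5 → Fin 5 → K, (∀ i, pderiv i Q = ∑ j, C (c i j) * X j) ∧ (∀ i j, c i j = c j i) ∧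
      2 * Q = ∑ i, X i * pderiv i Q := by
  choose c hc1 hc2 using fun i => linform (pderiv i Q) (hQ.pderiv)
  refine ⟨c, hc2, ?_, ?_⟩
  · intro i j
    apply C_injective (Fin 5) K
    rw [← hc1, ← hc1, pderiv_pderiv_comm]
  · rw [hQ.sum_X_mul_pderiv]; simp

variable (k : Type*) [Field k] [Algebra K k]

lemma quadform_bil (Q : MvPolynomial (Fin 5) K) (hQ : Q.IsHomogeneous 2) :
    ∃ A : (Fin 5 → k) →ₗ[k] (Fin 5 → k) →ₗ[k] k, (∀ x y, A x y = A y x) ∧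
      (∀ x, A x x = 2 * aeval x Q) ∧ ∀ x i, A x (Pi.single i 1) = aeval x (pderiv i Q) := by
  obtain ⟨c, h1, h2, h3⟩ := quadform Q hQ
  have hA : ∀ x y, Matrix.toLinearMap₂' k (Matrix.of fun i j => algebraMap K k (c i j)) x y =
      ∑ i, y i * aeval x (pderiv i Q) := by
    intro x y
    simp only [Matrix.toLinearMap₂'_apply, h1, map_sum, map_mul, aeval_C, aeval_X, Finset.mul_sum]
    rw [Finset.sum_comm]
    refine Finset.sum_congr rfl fun i _ => Finset.sum_congr rfl fun j _ => ?_
    simp [h2 i j]; ring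
  refine ⟨Matrix.toLinearMap₂' k (Matrix.of fun i j => algebraMap K k (c i j)), ?_, ?_, ?_⟩
  · intro x y
    simp only [Matrix.toLinearMap₂'_apply]
    rw [Finset.sum_comm]
    refine Finset.sum_congr rfl fun i _ => Finset.sum_congr rfl fun j _ => ?_
    simp [h2 i j]; ring
  · intro x
    rw [hA]
    have := congrArg (aeval x) h3
    rw [map_mul, map_sum] at this
    simpa using this.symm
  · intro x i
    rw [hA, Finset.sum_eq_single i]
    · simp
    · intro j _ hj; simp [hj]
    · simp

lemma linform_lin (H : MvPolynomial (Fin 5) K) (hH : H.IsHomogeneous 1) :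
    ∃ h : (Fin 5 → k) →ₗ[k] k, (∀ x, h x = aeval x H) ∧
      ∀ x i, h (Pi.single i 1) = aeval x (pderiv i H) := by
  obtain ⟨η, h1, h2⟩ := linform H hH
  refine ⟨∑ i, algebraMap K k (η i) • LinearMap.proj i, ?_, ?_⟩
  · intro x
    conv_rhs => rw [h2]
    simp [Algebra.smul_def]
  · intro x i
    rw [h1]
    simp [Pi.single_apply, Algebra.smul_def]

end forms

lemma exists_field (K : Type) [Field K] [NumberField K] (T : Set (AlgebraicClosure K))
    (hT : T.Finite) : ∃ (K' : IntermediateField K (AlgebraicClosure K)),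
      FiniteDimensional K K' ∧ NumberField K' ∧ ∀ x ∈ T, x ∈ K' := by
  have : Finite T := hT
  have hf : FiniteDimensional K (IntermediateField.adjoin K T) :=
    IntermediateField.finiteDimensional_adjoin fun x _ => Algebra.IsIntegral.isIntegral x
  refine ⟨IntermediateField.adjoin K T, hf, ?_, fun x hx => IntermediateField.subset_adjoin K T hx⟩
  exact NumberField.of_module_finite K _

set_option maxHeartbeats 4000000 in
theorem main_aux
    (K : Type) [Field K] [NumberField K]
    (Q₁ Q₂ H : MvPolynomial (Fin 5) K)
    (hQ₁ : Q₁.IsHomogeneous 2) (hQ₂ : Q₂.IsHomogeneous 2)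
    (hH : H.IsHomogeneous 1) (hHne : H ≠ 0)
    -- `X` is a smooth complete intersection of dimension 2: at every common nonzero
    -- zero of `Q₁, Q₂` over an algebraic closure the 2×5 Jacobian matrix has rank 2
    (hXsmooth : ∀ a : Fin 5 → AlgebraicClosure K, a ≠ 0 →
      aeval a Q₁ = 0 → aeval a Q₂ = 0 →
      ∃ i j : Fin 5,
        aeval a (pderiv i Q₁) * aeval a (pderiv j Q₂) ≠
          aeval a (pderiv j Q₁) * aeval a (pderiv i Q₂))
    -- `D = X ∩ {H = 0}` is a smooth curve: at every point of `D` over an algebraic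
    -- closure the 3×5 Jacobian matrix of `(Q₁, Q₂, H)` has rank 3
    (hDsmooth : ∀ a : Fin 5 → AlgebraicClosure K, a ≠ 0 →
      aeval a Q₁ = 0 → aeval a Q₂ = 0 → aeval a H = 0 →
      ∃ i j k : Fin 5,
        Matrix.det
          !![aeval a (pderiv i Q₁), aeval a (pderiv j Q₁), aeval a (pderiv k Q₁);
             aeval a (pderiv i Q₂), aeval a (pderiv j Q₂), aeval a (pderiv k Q₂);
             aeval a (pderiv i H), aeval a (pderiv j H), aeval a (pderiv k H)] ≠ 0) :
    ∃ (K' : Type) (_ : Field K') (_ : NumberField K') (_ : Algebra K K')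
      (_ : FiniteDimensional K K')
      (S : Finset (HeightOneSpectrum (𝓞 K'))),
      ∀ G : MvPolynomial (Fin 5) K', (∃ n : ℕ, G.IsHomogeneous n) →
        -- `G` does not vanish identically on `X`
        (∃ y : Fin 5 → AlgebraicClosure K',
          aeval y (MvPolynomial.map (algebraMap K K') Q₁) = 0 ∧
          aeval y (MvPolynomial.map (algebraMap K K') Q₂) = 0 ∧ aeval y G ≠ 0) →
        ∃ a : Fin 5 → ((S : Set (HeightOneSpectrum (𝓞 K'))).integer K'),
          -- the coordinates generate the unit ideal of `R`
          Ideal.span (Set.range a) = ⊤ ∧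
          -- the point lies on `X`
          eval (fun i => (a i : K')) (MvPolynomial.map (algebraMap K K') Q₁) = 0 ∧
          eval (fun i => (a i : K')) (MvPolynomial.map (algebraMap K K') Q₂) = 0 ∧
          -- `H` takes a unit value in `R` at the point
          (∃ u : ((S : Set (HeightOneSpectrum (𝓞 K'))).integer K')ˣ,
            ((u : ((S : Set (HeightOneSpectrum (𝓞 K'))).integer K')) : K') =
              eval (fun i => (a i : K')) (MvPolynomial.map (algebraMap K K') H)) ∧
          -- `G` does not vanish at the point
          eval (fun i => (a i : K')) G ≠ 0 := by
  classical
  obtain ⟨A, hA, hAA, hAd⟩ := quadform_bil (AlgebraicClosure K) Q₁ hQ₁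
  obtain ⟨B, hB, hBB, hBd⟩ := quadform_bil (AlgebraicClosure K) Q₂ hQ₂
  obtain ⟨h, hh, hhd⟩ := linform_lin (AlgebraicClosure K) H hH
  have two : (2 : AlgebraicClosure K) ≠ 0 := two_ne_zero
  have hX : SX A B := by
    intro v hv h1 h2 x y hxy
    rw [hAA] at h1
    rw [hBB] at h2
    obtain ⟨i, j, hij⟩ := hXsmooth v hv (by simpa using h1) (by simpa using h2)
    have e1 := hxy (Pi.single i 1)
    have e2 := hxy (Pi.single j 1)
    rw [hAd, hBd] at e1 e2
    have hd := sub_ne_zero.2 hij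
    constructor
    · apply mul_right_cancel₀ hd
      linear_combination aeval v (pderiv j Q₂) * e1 - aeval v (pderiv i Q₂) * e2
    · apply mul_right_cancel₀ hd
      linear_combination aeval v (pderiv i Q₁) * e2 - aeval v (pderiv j Q₁) * e1
  have hD : SD A B h := by
    intro v hv h1 h2 h3 x y z hxy
    rw [hAA] at h1
    rw [hBB] at h2
    rw [hh] at h3
    obtain ⟨i, j, l, hd⟩ := hDsmooth v hv (by simpa using h1) (by simpa using h2) h3
    have e1 := hxy (Pi.single i 1)
    have e2 := hxy (Pi.single j 1)
    have e3 := hxy (Pi.single l 1)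
    rw [hAd, hBd, hhd v] at e1 e2 e3
    have := Matrix.eq_zero_of_vecMul_eq_zero hd (v := ![x, y, z]) (by
      funext a
      fin_cases a
      · simp [Matrix.vecMul, dotProduct, Fin.sum_univ_three]; linear_combination e1
      · simp [Matrix.vecMul, dotProduct, Fin.sum_univ_three]; linear_combination e2
      · simp [Matrix.vecMul, dotProduct, Fin.sum_univ_three]; linear_combination e3)
    exact ⟨congrFun this 0, congrFun this 1, congrFun this 2⟩
  obtain ⟨p, q, r, s, v, x1, y1, x2, y2, P, g1, g2, g3, g4, g5, g6, ⟨t0, g7⟩, m0, m1, s0, s1, g8,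
    g9⟩ := geom_normal (by simp) A B hA hB h hX hD
  obtain ⟨K', hfin, hnf, hmem⟩ := exists_field K
    (Set.range p ∪ Set.range q ∪ Set.range r ∪ Set.range s ∪ Set.range v ∪
      {x1, y1, x2, y2, m0, m1, s0, s1, P.c1, P.c2, P.a0, P.a1, P.a2, P.b0, P.b1, P.b2, P.h1,
        P.h2, P.h}) (Set.toFinite _)
  have mp : ∀ i, p i ∈ K' := fun i => hmem _ (by simp)
  have mq : ∀ i, q i ∈ K' := fun i => hmem _ (by simp)
  have mr : ∀ i, r i ∈ K' := fun i => hmem _ (by simp)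
  have ms : ∀ i, s i ∈ K' := fun i => hmem _ (by simp)
  have mv : ∀ i, v i ∈ K' := fun i => hmem _ (by simp)
  let P' : Prm K' := ⟨⟨P.c1, hmem _ (by simp)⟩, ⟨P.c2, hmem _ (by simp)⟩,
    ⟨P.a0, hmem _ (by simp)⟩, ⟨P.a1, hmem _ (by simp)⟩, ⟨P.a2, hmem _ (by simp)⟩,
    ⟨P.b0, hmem _ (by simp)⟩, ⟨P.b1, hmem _ (by simp)⟩, ⟨P.b2, hmem _ (by simp)⟩,
    ⟨P.h1, hmem _ (by simp)⟩, ⟨P.h2, hmem _ (by simp)⟩, ⟨P.h, hmem _ (by simp)⟩⟩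
  have hP' : P'.map (algebraMap K' (AlgebraicClosure K)) = P := rfl
  let x1' : K' := ⟨x1, hmem _ (by simp)⟩
  let y1' : K' := ⟨y1, hmem _ (by simp)⟩
  let x2' : K' := ⟨x2, hmem _ (by simp)⟩
  let y2' : K' := ⟨y2, hmem _ (by simp)⟩
  let m0' : K' := ⟨m0, hmem _ (by simp)⟩
  let m1' : K' := ⟨m1, hmem _ (by simp)⟩
  let s0' : K' := ⟨s0, hmem _ (by simp)⟩
  let s1' : K' := ⟨s1, hmem _ (by simp)⟩
  let M : Fin 5 → Fin 5 → K' := fun i =>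
    ![⟨p i, mp i⟩, ⟨q i, mq i⟩, ⟨r i, mr i⟩, ⟨s i, ms i⟩, ⟨v i, mv i⟩]
  have hM : ∀ w : Fin 5 → AlgebraicClosure K,
      (fun i => ∑ j, algebraMap K' (AlgebraicClosure K) (M i j) * w j) = comb p q r s v w := by
    intro w
    funext i
    have e0 : algebraMap K' (AlgebraicClosure K) (M i 0) = p i := rfl
    have e1 : algebraMap K' (AlgebraicClosure K) (M i 1) = q i := rfl
    have e2 : algebraMap K' (AlgebraicClosure K) (M i 2) = r i := rfl
    have e3 : algebraMap K' (AlgebraicClosure K) (M i 3) = s i := rfl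
    have e4 : algebraMap K' (AlgebraicClosure K) (M i 4) = v i := rfl
    rw [Fin.sum_univ_five, e0, e1, e2, e3, e4]
    simp only [comb, Pi.add_apply, Pi.smul_apply, smul_eq_mul]
    ring
  obtain ⟨η, -, hη⟩ := linform H hH
  have two' : (2 : K') ≠ 0 := two_ne_zero
  have hinj : Function.Injective (algebraMap K' (AlgebraicClosure K)) :=
    (algebraMap K' (AlgebraicClosure K)).injective
  obtain ⟨S, hS⟩ := partC K' (AlgebraicClosure K) (MvPolynomial.map (algebraMap K K') Q₁)
    (MvPolynomial.map (algebraMap K K') Q₂) (MvPolynomial.map (algebraMap K K') H) M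
    (x1' / 2) (y1' / 2) (x2' / 2) (y2' / 2) P' m0' m1' s0' s1'
    (fun i => algebraMap K K' (η i)) t0
    (by
      intro w
      rw [hM, aeval_map_algebraMap, hP', map_div₀, map_div₀, map_ofNat]
      have := g2 w
      rw [hAA] at this
      change _ = x1 / 2 * qA w + y1 / 2 * P.qB w
      linear_combination this / 2)
    (by
      intro w
      rw [hM, aeval_map_algebraMap, hP', map_div₀, map_div₀, map_ofNat]
      have := g3 w
      rw [hBB] at this
      change _ = x2 / 2 * qA w + y2 / 2 * P.qB w
      linear_combination this / 2)
    (by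
      intro w
      rw [hM, aeval_map_algebraMap, hP', ← g4, hh])
    (by
      intro y
      obtain ⟨x, hx⟩ := g1 y
      exact ⟨x, by rw [hM, hx]⟩)
    (by
      intro h0
      apply g5
      have h1 : x1' * y2' - x2' * y1' = 0 := by
        linear_combination 4 * h0
      exact congrArg (algebraMap K' (AlgebraicClosure K)) h1)
    (by
      intro h0
      exact g8 (congrArg (algebraMap K' (AlgebraicClosure K)) h0))
    (by
      intro h0
      apply g6
      rw [← hP', ← map_del, h0, map_zero])
    (by
      intro t
      apply hinj
      have h1 := g9 (algebraMap K' (AlgebraicClosure K) t)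
      rw [← hP', ← map_disc, ← map_del] at h1
      rw [h1]
      simp only [map_sub, map_pow, map_add, map_mul]
      rfl)
    (by rw [hP']; exact g7)
    (by
      intro w
      rw [hη]
      simp)
  exact ⟨K', inferInstance, hnf, inferInstance, hfin, S, hS⟩

end DP4

/-- **Potential density of integral points on the complement of a smooth hyperplane
section of a smooth degree-4 Del Pezzo surface** (the degree-4 case of Theorem 7.1
of the paper).

Let `K` be a number field and `Q₁, Q₂` quadratic forms in five variables over `K` whose
common zero locus `X ⊂ ℙ⁴` is a smooth surface (a smooth complete intersection of
dimension 2), and let `H` be a nonzero linear form such that `D = X ∩ {H = 0}` is a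
smooth curve.  Then there are a finite extension `K'` of `K` and a finite set `S` of
maximal ideals of `𝓞 K'` such that, with `R` the ring of `S`-integers of `K'`, the set
of points of `ℙ⁴(K')` admitting primitive coordinates in `R`, lying on `X`, and at which
`H` takes a unit value in `R`, is Zariski dense in `X`. -/
theorem del_pezzo_deg_four_hyperplane_complement_integral_points_potentially_dense
    (K : Type) [Field K] [NumberField K]
    (Q₁ Q₂ H : MvPolynomial (Fin 5) K)
    (hQ₁ : Q₁.IsHomogeneous 2) (hQ₂ : Q₂.IsHomogeneous 2)
    (hH : H.IsHomogeneous 1) (hHne : H ≠ 0)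
    -- `X` is a smooth complete intersection of dimension 2: at every common nonzero
    -- zero of `Q₁, Q₂` over an algebraic closure the 2×5 Jacobian matrix has rank 2
    (hXsmooth : ∀ a : Fin 5 → AlgebraicClosure K, a ≠ 0 →
      aeval a Q₁ = 0 → aeval a Q₂ = 0 →
      ∃ i j : Fin 5,
        aeval a (pderiv i Q₁) * aeval a (pderiv j Q₂) ≠
          aeval a (pderiv j Q₁) * aeval a (pderiv i Q₂))
    -- `D = X ∩ {H = 0}` is a smooth curve: at every point of `D` over an algebraic
    -- closure the 3×5 Jacobian matrix of `(Q₁, Q₂, H)` has rank 3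
    (hDsmooth : ∀ a : Fin 5 → AlgebraicClosure K, a ≠ 0 →
      aeval a Q₁ = 0 → aeval a Q₂ = 0 → aeval a H = 0 →
      ∃ i j k : Fin 5,
        Matrix.det
          !![aeval a (pderiv i Q₁), aeval a (pderiv j Q₁), aeval a (pderiv k Q₁);
             aeval a (pderiv i Q₂), aeval a (pderiv j Q₂), aeval a (pderiv k Q₂);
             aeval a (pderiv i H), aeval a (pderiv j H), aeval a (pderiv k H)] ≠ 0) :
    ∃ (K' : Type) (_ : Field K') (_ : NumberField K') (_ : Algebra K K')
      (_ : FiniteDimensional K K')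
      (S : Finset (HeightOneSpectrum (𝓞 K'))),
      ∀ G : MvPolynomial (Fin 5) K', (∃ n : ℕ, G.IsHomogeneous n) →
        -- `G` does not vanish identically on `X`
        (∃ y : Fin 5 → AlgebraicClosure K',
          aeval y (MvPolynomial.map (algebraMap K K') Q₁) = 0 ∧
          aeval y (MvPolynomial.map (algebraMap K K') Q₂) = 0 ∧ aeval y G ≠ 0) →
        ∃ a : Fin 5 → ((S : Set (HeightOneSpectrum (𝓞 K'))).integer K'),
          -- the coordinates generate the unit ideal of `R`
          Ideal.span (Set.range a) = ⊤ ∧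
          -- the point lies on `X`
          eval (fun i => (a i : K')) (MvPolynomial.map (algebraMap K K') Q₁) = 0 ∧
          eval (fun i => (a i : K')) (MvPolynomial.map (algebraMap K K') Q₂) = 0 ∧
          -- `H` takes a unit value in `R` at the point
          (∃ u : ((S : Set (HeightOneSpectrum (𝓞 K'))).integer K')ˣ,
            ((u : ((S : Set (HeightOneSpectrum (𝓞 K'))).integer K')) : K') =
              eval (fun i => (a i : K')) (MvPolynomial.map (algebraMap K K') H)) ∧
          -- `G` does not vanish at the point
          eval (fun i => (a i : K')) G ≠ 0 := by
  exact DP4.main_aux K Q₁ Q₂ H hQ₁ hQ₂ hH hHne hXsmooth hDsmooth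
end

section
/- Let K be a number field, S a finite set of maximal ideals of O_K, and R = O_{K,S}; assume the unit group R^× is infinite. Let q₁ = (c₁ : d₁) and q₂ = (c₂ : d₂) be two distinct points of P¹(K) with c₁, d₁, c₂, d₂ ∈ R (so c₁d₂ − c₂d₁ ≠ 0). Suppose there exist a, b ∈ R with aR + bR = R, ad₁ − bc₁ ∈ R^× and ad₂ − bc₂ ∈ R^×. Then the set of points (a' : b') ∈ P¹(K) admitting representatives a', b' ∈ R with a'R + b'R = R, a'd₁ − b'c₁ ∈ R^× and a'd₂ − b'c₂ ∈ R^× is infinite, hence Zariski dense in P¹. -/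
open IsDedekindDomain NumberField

/-- Among more than `m ^ [K : ℚ]` elements of an additive subgroup, two agree mod `m`. -/
lemma exists_congr_of_card (K : Type) [Field K] [NumberField K] (m : ℕ) [NeZero m]
    (T : Finset K) (hT : m ^ Module.finrank ℚ K < T.card) :
    ∃ x ∈ T, ∃ y ∈ T, x ≠ y ∧ ∃ z ∈ Submodule.span ℤ (T : Set K), x - y = (m : K) * z := by
  classical
  set B := Submodule.span ℤ (T : Set K) with hB
  have : Module.Finite ℤ B := Module.Finite.iff_fg.mpr ⟨T, rfl⟩
  have : Module.Free ℤ B := inferInstance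
  let b := Module.finBasis ℤ B
  have hr : Module.finrank ℤ B ≤ Module.finrank ℚ K := by
    have h1 : LinearIndependent ℤ (fun i => ((b i : B) : K)) :=
      b.linearIndependent.map' B.subtype (Submodule.ker_subtype B)
    have h2 : LinearIndependent ℚ (fun i => ((b i : B) : K)) :=
      (LinearIndependent.iff_fractionRing ℤ ℚ).mp h1
    simpa using h2.fintype_card_le_finrank
  let g : B → (Fin (Module.finrank ℤ B) → ZMod m) := fun x i => ((b.repr x i : ℤ) : ZMod m)
  have hcard : Fintype.card (Fin (Module.finrank ℤ B) → ZMod m) < Fintype.card T := by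
    simp only [Fintype.card_pi, ZMod.card, Finset.prod_const, Finset.card_univ, Fintype.card_fin,
      Fintype.card_coe]
    exact (Nat.pow_le_pow_right (Nat.pos_of_ne_zero (NeZero.ne m)) hr).trans_lt hT
  obtain ⟨x, y, hxy, hg⟩ := Fintype.exists_ne_map_eq_of_card_lt
    (fun x : T => g ⟨x.1, Submodule.subset_span x.2⟩) hcard
  refine ⟨x, x.2, y, y.2, fun h => hxy (Subtype.ext h), ?_⟩
  set X : B := ⟨x.1, Submodule.subset_span x.2⟩ with hX
  set Y : B := ⟨y.1, Submodule.subset_span y.2⟩ with hY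
  have hd : ∀ i, ∃ k : ℤ, b.repr X i - b.repr Y i = m * k := by
    intro i
    have h := congrFun hg i
    have h' : ((b.repr Y i : ℤ) : ZMod m) = ((b.repr X i : ℤ) : ZMod m) := h.symm
    exact (ZMod.intCast_eq_intCast_iff_dvd_sub _ _ _).mp h'
  choose k hk using hd
  refine ⟨((∑ i, k i • b i : B) : K), Subtype.mem _, ?_⟩
  have : X - Y = (m : ℤ) • (∑ i, k i • b i) := by
    rw [← b.sum_repr X, ← b.sum_repr Y, ← Finset.sum_sub_distrib, Finset.smul_sum]
    refine Finset.sum_congr rfl fun i _ => ?_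
    rw [← sub_smul, hk, mul_smul]
  have h2 := congrArg (fun z : B => (z : K)) this
  simpa [hX, hY] using h2

lemma finite_quotient_natCast (K : Type) [Field K] [NumberField K] (A : Subalgebra (𝓞 K) K)
    (m : ℕ) [NeZero m] : Finite (A ⧸ Ideal.span {(m : A)}) := by
  classical
  by_contra hinf
  rw [not_finite_iff_infinite] at hinf
  obtain ⟨Q, hQ⟩ := Infinite.exists_subset_card_eq (A ⧸ Ideal.span {(m : A)})
    (m ^ Module.finrank ℚ K + 1)
  let s : A ⧸ Ideal.span {(m : A)} → A := Function.surjInv Ideal.Quotient.mk_surjective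
  have hs : ∀ q, Ideal.Quotient.mk _ (s q) = q := Function.surjInv_eq _
  have hinj : Function.Injective (fun q => (s q : K)) := by
    intro p q h
    have : s p = s q := Subtype.ext h
    rw [← hs p, ← hs q, this]
  obtain ⟨x, hx, y, hy, hne, z, hz, h⟩ := exists_congr_of_card K m (Q.image fun q => (s q : K))
    (by rw [Finset.card_image_of_injective _ hinj, hQ]; exact Nat.lt_succ_self _)
  have hzA : z ∈ A := by
    have : Submodule.span ℤ ((Q.image fun q => (s q : K) : Finset K) : Set K) ≤
        A.toSubring.toAddSubgroup.toIntSubmodule := by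
      rw [Submodule.span_le]
      intro w hw
      simp only [Finset.coe_image, Set.mem_image] at hw
      obtain ⟨q, _, rfl⟩ := hw
      exact (s q).2
    exact this hz
  obtain ⟨p, _, rfl⟩ := Finset.mem_image.mp hx
  obtain ⟨q, _, rfl⟩ := Finset.mem_image.mp hy
  apply hne
  have : p = q := by
    rw [← hs p, ← hs q, Ideal.Quotient.eq, Ideal.mem_span_singleton]
    exact ⟨⟨z, hzA⟩, Subtype.ext (by simpa using h)⟩
  rw [this]

lemma finite_quotient_span (K : Type) [Field K] [NumberField K] (A : Subalgebra (𝓞 K) K)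
    (D : A) (hD : D ≠ 0) : Finite (A ⧸ Ideal.span {D}) := by
  obtain ⟨x, y, hy, hxy⟩ := IsFractionRing.div_surjective (A := 𝓞 K) (D : K)
  have hy0 : y ≠ 0 := nonZeroDivisors.ne_zero hy
  have hy0' : algebraMap (𝓞 K) K y ≠ 0 := by simpa using hy0
  have hx0 : x ≠ 0 := by
    rintro rfl
    apply hD
    apply Subtype.ext
    simpa using hxy.symm
  have hm : Ideal.absNorm (Ideal.span {x}) ≠ 0 := by
    simpa [Ideal.absNorm_eq_zero_iff] using hx0
  have : NeZero (Ideal.absNorm (Ideal.span {x})) := ⟨hm⟩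
  obtain ⟨z, hz⟩ := Ideal.mem_span_singleton.mp (Ideal.absNorm_mem (Ideal.span {x}))
  have hle : Ideal.span {((Ideal.absNorm (Ideal.span {x}) : ℕ) : A)} ≤ Ideal.span {D} := by
    rw [Ideal.span_singleton_le_span_singleton]
    refine ⟨algebraMap (𝓞 K) A (y * z), Subtype.ext ?_⟩
    have h1 := congrArg (algebraMap (𝓞 K) K) hz
    rw [map_natCast, map_mul] at h1
    have h2 : (D : K) * algebraMap (𝓞 K) K y = algebraMap (𝓞 K) K x := by
      rw [← hxy]; field_simp
    have h3 : ((algebraMap (𝓞 K) A (y * z) : A) : K) = algebraMap (𝓞 K) K (y * z) := rfl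
    push_cast [h3]
    rw [h1, ← h2]; ring
  have := finite_quotient_natCast K A (Ideal.absNorm (Ideal.span {x}))
  exact Finite.of_surjective _ (Ideal.Quotient.factor_surjective hle)

lemma infinite_units_congr_one {A : Type} [CommRing A] (hA : Infinite Aˣ) (D : A)
    (hD : Finite (A ⧸ Ideal.span {D})) : Infinite {e : Aˣ // ∃ t : A, (e : A) = 1 + D * t} := by
  obtain ⟨q, hq⟩ := Finite.exists_infinite_fiber
    (fun e : Aˣ => Ideal.Quotient.mk (Ideal.span {D}) (e : A))
  obtain ⟨⟨e₀, he₀⟩⟩ := hq.nonempty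
  refine Infinite.of_injective (fun e : ((fun e : Aˣ => Ideal.Quotient.mk (Ideal.span {D}) (e : A))
    ⁻¹' {q}) => (⟨e.1 * e₀⁻¹, ?_⟩ : {e : Aˣ // ∃ t : A, (e : A) = 1 + D * t})) ?_
  · have h : Ideal.Quotient.mk (Ideal.span {D}) (e.1 : A) = Ideal.Quotient.mk _ (e₀ : A) :=
      e.2.trans he₀.symm
    rw [Ideal.Quotient.eq, Ideal.mem_span_singleton] at h
    obtain ⟨t, ht⟩ := h
    refine ⟨t * (e₀⁻¹ : Aˣ), ?_⟩
    have h1 : (e₀ : A) * (e₀⁻¹ : Aˣ) = 1 := e₀.mul_inv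
    push_cast
    linear_combination (e₀⁻¹ : Aˣ) * ht + h1
  · intro a b hab
    simpa [Subtype.ext_iff] using hab


lemma dense_aux
    (K : Type) [Field K] [NumberField K]
    (A : Subalgebra (𝓞 K) K)
    (hunits : Infinite Aˣ)
    (c₁ d₁ c₂ d₂ : A)
    (hdistinct : c₁ * d₂ - c₂ * d₁ ≠ 0)
    (hpt : ∃ a b : A,
      Ideal.span {a, b} = ⊤ ∧ IsUnit (a * d₁ - b * c₁) ∧ IsUnit (a * d₂ - b * c₂)) :
    { x : Projectivization K (Fin 2 → K) |
      ∃ a b : A,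
        Ideal.span {a, b} = ⊤ ∧ IsUnit (a * d₁ - b * c₁) ∧ IsUnit (a * d₂ - b * c₂) ∧
        ∃ h : ![(a : K), (b : K)] ≠ 0,
          x = Projectivization.mk K ![(a : K), (b : K)] h }.Infinite := by
  classical
  obtain ⟨a, b, -, ⟨u₁, hu₁⟩, ⟨u₂, hu₂⟩⟩ := hpt
  have hU := infinite_units_congr_one hunits (c₁ * d₂ - c₂ * d₁)
    (finite_quotient_span K A _ hdistinct)
  choose t ht using fun e : {e : Aˣ // ∃ t : A, (e : A) = 1 + (c₁ * d₂ - c₂ * d₁) * t} => e.2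
  let a' := fun e => a - u₁ * c₂ * t e
  let b' := fun e => b - u₁ * d₂ * t e
  have h₁ : ∀ e, a' e * d₁ - b' e * c₁ = u₁ * (e.1 : A) := by
    intro e
    simp only [a', b']
    linear_combination (-1 : A) * hu₁ - (u₁ : A) * ht e
  have h₂ : ∀ e, a' e * d₂ - b' e * c₂ = u₂ := by
    intro e
    simp only [a', b']
    linear_combination (-1 : A) * hu₂
  have hu₂0 : ((u₂ : A) : K) ≠ 0 := fun h => u₂.ne_zero (Subtype.ext h)
  have hu₁0 : ((u₁ : A) : K) ≠ 0 := fun h => u₁.ne_zero (Subtype.ext h)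
  have k₁ : ∀ e, (a' e : K) * d₁ - b' e * c₁ = (u₁ : A) * (e.1 : A) := fun e => by
    exact_mod_cast congrArg (Subtype.val) (h₁ e)
  have k₂ : ∀ e, (a' e : K) * d₂ - b' e * c₂ = (u₂ : A) := fun e => by
    exact_mod_cast congrArg (Subtype.val) (h₂ e)
  have hne : ∀ e, ![(a' e : K), (b' e : K)] ≠ 0 := by
    intro e h
    have ha : (a' e : K) = 0 := congrFun h 0
    have hb : (b' e : K) = 0 := congrFun h 1
    apply hu₂0
    rw [← k₂ e, ha, hb]; ring
  refine Set.infinite_of_injective_forall_mem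
    (f := fun e => Projectivization.mk K ![(a' e : K), (b' e : K)] (hne e)) ?_ ?_
  · intro e f hef
    obtain ⟨l, hl⟩ := (Projectivization.mk_eq_mk_iff' K _ _ (hne e) (hne f)).mp hef
    have ha : l * (a' f : K) = a' e := by simpa using congrFun hl 0
    have hb : l * (b' f : K) = b' e := by simpa using congrFun hl 1
    have hl1 : l = 1 := by
      apply mul_right_cancel₀ hu₂0
      linear_combination (1 - l) * k₂ e + (d₂ : K) * ha - (c₂ : K) * hb + l * k₂ e - l * k₂ f
    subst hl1
    apply Subtype.ext
    apply Units.ext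
    apply Subtype.ext
    apply mul_left_cancel₀ hu₁0
    rw [← k₁ e, ← k₁ f, ← ha, ← hb]; ring
  · intro e
    refine ⟨a' e, b' e, ?_, ?_, ?_, hne e, rfl⟩
    · refine Ideal.eq_top_of_isUnit_mem _ (x := (u₂ : A)) ?_ u₂.isUnit
      rw [← h₂ e, Ideal.mem_span_pair]
      exact ⟨d₂, -c₂, by ring⟩
    · rw [h₁ e]; exact u₁.isUnit.mul e.1.isUnit
    · rw [h₂ e]; exact u₂.isUnit

/-- **A rational curve with a reducible rational bisection removed has Zariski dense
`S`-integral points once it has one and the rank is positive** (part (a) of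
Corollary 6.6 of the paper, after Beukers, stated in coordinates).

Let `K` be a number field, `S` a finite set of maximal ideals of `𝓞 K` and `R` the ring
of `S`-integers; assume `Rˣ` is infinite (the split torus `𝔾ₘ` has positive rank over
`R`).  Let `q₁ = (c₁ : d₁)` and `q₂ = (c₂ : d₂)` be distinct points of `ℙ¹(K)` with
coordinates in `R` (so `c₁d₂ − c₂d₁ ≠ 0`).  If there exist `a, b ∈ R` with
`aR + bR = R`, `ad₁ − bc₁ ∈ Rˣ` and `ad₂ − bc₂ ∈ Rˣ`, then the set of points
`(a' : b') ∈ ℙ¹(K)` admitting representatives `a', b' ∈ R` with `a'R + b'R = R`,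
`a'd₁ − b'c₁ ∈ Rˣ` and `a'd₂ − b'c₂ ∈ Rˣ` is infinite, hence Zariski dense in `ℙ¹`. -/
theorem projective_line_minus_two_points_integral_points_dense
    (K : Type) [Field K] [NumberField K]
    (S : Finset (HeightOneSpectrum (𝓞 K)))
    (hunits : Infinite ((S : Set (HeightOneSpectrum (𝓞 K))).integer K)ˣ)
    (c₁ d₁ c₂ d₂ : ((S : Set (HeightOneSpectrum (𝓞 K))).integer K))
    (hdistinct : c₁ * d₂ - c₂ * d₁ ≠ 0)
    (hpt : ∃ a b : ((S : Set (HeightOneSpectrum (𝓞 K))).integer K),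
      Ideal.span {a, b} = ⊤ ∧ IsUnit (a * d₁ - b * c₁) ∧ IsUnit (a * d₂ - b * c₂)) :
    { x : Projectivization K (Fin 2 → K) |
      ∃ a b : ((S : Set (HeightOneSpectrum (𝓞 K))).integer K),
        Ideal.span {a, b} = ⊤ ∧ IsUnit (a * d₁ - b * c₁) ∧ IsUnit (a * d₂ - b * c₂) ∧
        ∃ h : ![(a : K), (b : K)] ≠ 0,
          x = Projectivization.mk K ![(a : K), (b : K)] h }.Infinite := by
  exact dense_aux K _ hunits c₁ d₁ c₂ d₂ hdistinct hpt
end
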